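/- Let f ∈ ℤ[X] be a monic squarefree polynomial of positive degree. Then there are infinitely many Carmichael numbers n such that for every prime p dividing n, the image of f in (ZMod p)[X] splits into linear factors. -/

import Mathlib

/-- A Carmichael number: a composite natural number `n > 1` such that
`a ^ (n - 1) ≡ 1 (mod n)` for every integer `a` coprime to `n`. -/
def IsCarmichael (n : ℕ) : Prop :=
  1 < n ∧ ¬ n.Prime ∧ ∀ a : ℤ, IsCoprime a (n : ℤ) → a ^ (n - 1) ≡ 1 [ZMOD (n : ℤ)]

/-- The image of `f` in `(ZMod p)[X]` is a product of linear factors. -/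
def SplitsModLinear (f : Polynomial ℤ) (p : ℕ) : Prop :=
  ∃ s : Multiset (ZMod p),
    f.map (Int.castRingHom (ZMod p)) =
      (s.map fun a => Polynomial.X - Polynomial.C a).prod

namespace CS

open Finset in
/-- Greedy choice of values killing many characters. -/
theorem greedy_kill (N : ℕ) [NeZero N] (M : ℕ) (hM : 0 < M) {ι : Type*} [DecidableEq ι]
    (g : ι → (ZMod N)ˣ) (s : Finset ι) (hg : ∀ i ∈ s, g i ^ M = 1) :
    ∃ a : ι → ℂ, (∀ i ∈ s, a i ≠ 0) ∧
      ((univ.filter fun ψ : DirichletCharacter ℂ N => ∀ i ∈ s, ψ (g i : ZMod N) ≠ a i).card : ℝ)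
        ≤ N * (1 - 1 / (M : ℝ)) ^ s.card := by
  classical
  induction s using Finset.induction_on with
  | empty =>
    refine ⟨fun _ => 1, by simp, ?_⟩
    have : (Fintype.card (DirichletCharacter ℂ N)) ≤ N := by
      rw [← Nat.card_eq_fintype_card, DirichletCharacter.card_eq_totient_of_hasEnoughRootsOfUnity]
      exact Nat.totient_le N
    simpa using this
  | insert j s hj ih =>
    obtain ⟨a, ha0, ha⟩ := ih (fun i hi => hg i (mem_insert_of_mem hi))
    set R := univ.filter fun ψ : DirichletCharacter ℂ N => ∀ i ∈ s, ψ (g i : ZMod N) ≠ a i with hR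
    set T := Polynomial.nthRootsFinset M (1 : ℂ) with hT
    have hTc : T.card ≤ M := by
      rw [hT, Polynomial.nthRootsFinset_def]
      exact (Multiset.toFinset_card_le _).trans (Polynomial.card_nthRoots M 1)
    have hmaps : ∀ ψ ∈ R, ψ (g j : ZMod N) ∈ T := by
      intro ψ _
      rw [hT, Polynomial.mem_nthRootsFinset hM]
      rw [← map_pow, ← Units.val_pow_eq_pow_val, hg j (mem_insert_self _ _)]
      simp
    have hTne : T.Nonempty := ⟨1, by rw [hT, Polynomial.mem_nthRootsFinset hM]; simp⟩
    obtain ⟨y, hy, hle⟩ : ∃ y ∈ T, (R.card : ℝ) / M ≤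
        ((R.filter fun ψ => ψ (g j : ZMod N) = y).card : ℝ) := by
      apply Finset.exists_le_card_fiber_of_nsmul_le_card_of_maps_to hmaps hTne
      rw [nsmul_eq_mul]
      have hM' : (0 : ℝ) < M := by exact_mod_cast hM
      calc (T.card : ℝ) * ((R.card : ℝ) / M) ≤ M * ((R.card : ℝ) / M) := by
            gcongr
        _ = R.card := by field_simp
    refine ⟨Function.update a j y, ?_, ?_⟩
    · intro i hi
      by_cases hij : i = j
      · subst hij
        simp only [Function.update_self]
        rintro rfl
        rw [hT, Polynomial.mem_nthRootsFinset hM] at hy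
        simp [hM.ne'] at hy
      · rw [Function.update_of_ne hij]
        exact ha0 i ((mem_insert.1 hi).resolve_left hij)
    · have hsub : (univ.filter fun ψ : DirichletCharacter ℂ N =>
          ∀ i ∈ insert j s, ψ (g i : ZMod N) ≠ Function.update a j y i)
          = R \ (R.filter fun ψ => ψ (g j : ZMod N) = y) := by
        ext ψ
        simp only [mem_filter, mem_univ, true_and, mem_sdiff, hR, mem_insert, forall_eq_or_imp,
          Function.update_self]
        have : ∀ i ∈ s, Function.update a j y i = a i := fun i hi =>
          Function.update_of_ne (fun h : i = j => hj (h ▸ hi)) _ _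
        constructor
        · rintro ⟨h1, h2⟩
          have h3 : ∀ i ∈ s, ψ (g i : ZMod N) ≠ a i := fun i hi => by
            rw [← this i hi]; exact h2 i hi
          exact ⟨h3, fun h => h1 h.2⟩
        · rintro ⟨h1, h2⟩
          exact ⟨fun h => h2 ⟨h1, h⟩, fun i hi => by rw [this i hi]; exact h1 i hi⟩
      rw [hsub, card_sdiff_of_subset (filter_subset _ _), Nat.cast_sub (card_le_card (filter_subset _ _)),
        card_insert_of_notMem hj, pow_succ]
      have hM' : (1 : ℝ) ≤ M := by exact_mod_cast hM
      have h1 : (0 : ℝ) ≤ 1 - 1 / (M : ℝ) := by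
        rw [sub_nonneg, div_le_one (by linarith)]; exact hM'
      calc (R.card : ℝ) - _ ≤ R.card - R.card / M := by linarith
        _ = R.card * (1 - 1 / (M : ℝ)) := by ring
        _ ≤ (N * (1 - 1 / (M : ℝ)) ^ s.card) * (1 - 1 / (M : ℝ)) := by gcongr
        _ = _ := by ring

open Finset in
/-- A bound for the Davenport constant, via characters. -/
theorem exists_subset_prod_one (N : ℕ) [NeZero N] (M : ℕ) (hM : 0 < M) {ι : Type*} [DecidableEq ι]
    (g : ι → (ZMod N)ˣ) (s : Finset ι) (hg : ∀ i ∈ s, g i ^ M = 1)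
    (hcard : M * Real.log N < s.card) :
    ∃ t ⊆ s, t.Nonempty ∧ ∏ i ∈ t, g i = 1 := by
  classical
  obtain ⟨a, ha0, ha⟩ := greedy_kill N M hM g s hg
  have hN : (0 : ℝ) < N := by exact_mod_cast NeZero.pos N
  have hM' : (1 : ℝ) ≤ M := by exact_mod_cast hM
  have hlt : (N : ℝ) * (1 - 1 / (M : ℝ)) ^ s.card < 1 := by
    have h1 : (0 : ℝ) ≤ 1 - 1 / (M : ℝ) := by
      rw [sub_nonneg, div_le_one (by linarith)]; exact hM'
    have h2 : 1 - 1 / (M : ℝ) ≤ Real.exp (-(1 / (M : ℝ))) := by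
      have := Real.add_one_le_exp (-(1 / (M : ℝ)))
      linarith
    calc (N : ℝ) * (1 - 1 / (M : ℝ)) ^ s.card ≤ N * (Real.exp (-(1 / (M : ℝ)))) ^ s.card := by gcongr
      _ = Real.exp (Real.log N - s.card / M) := by
          rw [← Real.exp_nat_mul, sub_eq_add_neg, Real.exp_add, Real.exp_log hN]
          congr 2; ring
      _ < 1 := by
          rw [Real.exp_lt_one_iff, sub_neg, lt_div_iff₀ (by linarith)]
          linarith
  have hempty : (univ.filter fun ψ : DirichletCharacter ℂ N =>
      ∀ i ∈ s, ψ (g i : ZMod N) ≠ a i) = ∅ := by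
    rw [← card_eq_zero]
    have := ha.trans_lt hlt
    exact_mod_cast Nat.lt_one_iff.1 (by exact_mod_cast this)
  have hzero : ∀ ψ : DirichletCharacter ℂ N, ∏ i ∈ s, (-ψ (g i : ZMod N) + a i) = 0 := by
    intro ψ
    have : ψ ∉ (univ.filter fun ψ : DirichletCharacter ℂ N =>
      ∀ i ∈ s, ψ (g i : ZMod N) ≠ a i) := by simp [hempty]
    simp only [mem_filter, mem_univ, true_and, not_forall] at this
    obtain ⟨i, hi, h⟩ := this
    rw [not_not] at h
    exact prod_eq_zero hi (by rw [h]; ring)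
  by_contra hcon
  push Not at hcon
  have hsum : ∑ ψ : DirichletCharacter ℂ N, ∏ i ∈ s, (-ψ (g i : ZMod N) + a i) = 0 :=
    sum_eq_zero fun ψ _ => hzero ψ
  simp_rw [Finset.prod_add] at hsum
  rw [sum_comm] at hsum
  have hterm : ∀ t ∈ s.powerset, t ≠ ∅ → ∑ ψ : DirichletCharacter ℂ N,
      (∏ i ∈ t, -ψ (g i : ZMod N)) * ∏ i ∈ s \ t, a i = 0 := by
    intro t ht hne
    have h1 : ∀ ψ : DirichletCharacter ℂ N, (∏ i ∈ t, -ψ (g i : ZMod N)) =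
        (∏ i ∈ t, (-1)) * ψ ((∏ i ∈ t, g i : (ZMod N)ˣ) : ZMod N) := by
      intro ψ
      rw [Units.coe_prod, map_prod, ← prod_mul_distrib]
      exact prod_congr rfl fun i _ => by ring
    have h2 : ((∏ i ∈ t, g i : (ZMod N)ˣ) : ZMod N) ≠ 1 := by
      have := hcon t (mem_powerset.1 ht) (nonempty_iff_ne_empty.2 hne)
      simpa [Units.ext_iff] using this
    simp_rw [h1]
    rw [← sum_mul, ← mul_sum, DirichletCharacter.sum_characters_eq_zero ℂ h2]
    simp
  rw [sum_eq_single ∅ hterm (by simp)] at hsum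
  simp only [prod_empty, one_mul, sdiff_empty, sum_const, card_univ, nsmul_eq_mul] at hsum
  rcases mul_eq_zero.1 hsum with h | h
  · have : Fintype.card (DirichletCharacter ℂ N) ≠ 0 := Fintype.card_ne_zero
    exact this (by exact_mod_cast h)
  · exact (prod_ne_zero_iff.2 ha0) h

/-- Korselt's criterion (the needed direction) for a finite set of primes. -/
theorem korselt (t : Finset ℕ) (hp : ∀ p ∈ t, p.Prime) (h2 : 1 < t.card)
    (h : ∀ p ∈ t, p - 1 ∣ (∏ p ∈ t, p) - 1) : IsCarmichael (∏ p ∈ t, p) := by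
  classical
  set n := ∏ p ∈ t, p with hn
  have hnpos : 0 < n := Finset.prod_pos fun p hp' => (hp p hp').pos
  obtain ⟨p, hpt, q, hqt, hpq⟩ := Finset.one_lt_card.1 h2
  have hpn : p ∣ n := Finset.dvd_prod_of_mem _ hpt
  have hqn : q ∣ n := Finset.dvd_prod_of_mem _ hqt
  refine ⟨?_, ?_, ?_⟩
  · exact lt_of_lt_of_le (hp p hpt).one_lt (Nat.le_of_dvd hnpos hpn)
  · intro hprime
    have h1 := (Nat.prime_dvd_prime_iff_eq (hp p hpt) hprime).1 hpn
    have h2 := (Nat.prime_dvd_prime_iff_eq (hp q hqt) hprime).1 hqn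
    exact hpq (h1.trans h2.symm)
  · intro a ha
    apply Int.ModEq.symm
    rw [Int.modEq_iff_dvd, hn]
    push_cast
    apply Finset.prod_dvd_of_coprime
    · intro x hx y hy hxy
      exact Nat.isCoprime_iff_coprime.2 ((Nat.coprime_primes (hp x hx) (hp y hy)).2 hxy)
    · intro x hx
      have := Fact.mk (hp x hx)
      obtain ⟨c, hc⟩ := h x hx
      have hxn : (x : ℤ) ∣ n := by exact_mod_cast Finset.dvd_prod_of_mem _ hx
      have hax : IsCoprime a (x : ℤ) := ha.of_isCoprime_of_dvd_right hxn
      have h0 := Int.ModEq.pow_card_sub_one_eq_one (hp x hx) hax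
      have h1 : a ^ (n - 1) ≡ 1 [ZMOD x] := by
        rw [hc, pow_mul]
        simpa using h0.pow c
      exact (Int.modEq_iff_dvd.1 h1.symm)

theorem pow_gcd_dvd (k L p E : ℕ) (hk : k ∣ p - 1) (hp : 1 ≤ p) (hL : p ^ E ≡ 1 [MOD L]) :
    p ^ (E * Nat.gcd k L) ≡ 1 [MOD (k * L)] := by
  have hkE : p ^ E ≡ 1 [MOD k] := by
    have : p ≡ 1 [MOD k] := ((Nat.modEq_iff_dvd' hp).2 hk).symm
    simpa using this.pow E
  have hpE : 1 ≤ p ^ E := Nat.one_le_pow _ _ hp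
  have h1 : k ∣ p ^ E - 1 := (Nat.modEq_iff_dvd' hpE).1 hkE.symm
  have h2 : L ∣ p ^ E - 1 := (Nat.modEq_iff_dvd' hpE).1 hL.symm
  obtain ⟨t, ht⟩ := Nat.lcm_dvd h1 h2
  have h3 : p ^ E = 1 + Nat.lcm k L * t := by omega
  rw [pow_mul, h3]
  set m := Nat.lcm k L
  set g := Nat.gcd k L
  have hgm : g ∣ m := (Nat.gcd_dvd_left k L).trans (Nat.dvd_lcm_left k L)
  have hmg : g * m = k * L := Nat.gcd_mul_lcm k L
  rw [← hmg]
  apply Nat.ModEq.symm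
  rw [Nat.modEq_iff_dvd]
  push_cast
  have key : ∀ (x : ℤ) (n : ℕ), ∃ c : ℤ, (1 + x) ^ n = 1 + n * x + x ^ 2 * c := by
    intro x n
    induction n with
    | zero => exact ⟨0, by simp⟩
    | succ n ih =>
      obtain ⟨c, hc⟩ := ih
      refine ⟨n + c * (1 + x), ?_⟩
      rw [pow_succ, hc]
      push_cast
      ring
  obtain ⟨c, hc⟩ := key ((m : ℤ) * t) g
  rw [hc]
  obtain ⟨e, he⟩ := hgm
  refine ⟨t + e * t ^ 2 * c, ?_⟩
  have he' : (m : ℤ) = g * e := by exact_mod_cast he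
  have : ((m : ℤ) * t) ^ 2 * c = (m : ℤ) * m * t ^ 2 * c := by ring
  rw [this]
  nth_rewrite 3 [he']
  ring

/-- Combination: many primes `p = d k + 1` with `d ∣ L` give a Carmichael number. -/
theorem carmichael_of_many (k L E : ℕ) (hk : 0 < k) (hL : 0 < L) (hE : 0 < E)
    (Q : Finset ℕ) (hQ : ∀ q ∈ Q, q.Prime) (hLQ : L = ∏ q ∈ Q, q)
    (hEQ : ∀ q ∈ Q, q - 1 ∣ E) (P : Finset ℕ) (hP : ∀ p ∈ P, p.Prime)
    (hPQ : ∀ p ∈ P, p ∉ Q) (hPd : ∀ p ∈ P, ∃ d, d ∣ L ∧ d < L ∧ p = d * k + 1)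
    (hcard : ((E * Nat.gcd k L : ℕ) : ℝ) * Real.log ((k * L : ℕ) : ℝ) < P.card) :
    ∃ t ⊆ P, t.Nonempty ∧ IsCarmichael (∏ p ∈ t, p) := by
  classical
  have hcop : ∀ p ∈ P, Nat.Coprime p (k * L) := by
    intro p hp
    apply Nat.Coprime.mul_right
    · obtain ⟨d, _, _, rfl⟩ := hPd p hp
      simp
    · rw [hLQ]
      apply Nat.Coprime.prod_right
      intro q hq
      exact (Nat.coprime_primes (hP p hp) (hQ q hq)).2 (fun h => hPQ p hp (h ▸ hq))
  have : NeZero (k * L) := ⟨(Nat.mul_pos hk hL).ne'⟩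
  let g : ℕ → (ZMod (k * L))ˣ := fun p => if h : Nat.Coprime p (k * L) then ZMod.unitOfCoprime p h else 1
  have hgv : ∀ p ∈ P, ((g p : (ZMod (k * L))ˣ) : ZMod (k * L)) = (p : ZMod (k * L)) := by
    intro p hp
    simp only [g]
    rw [dif_pos (hcop p hp)]
    simp
  obtain ⟨t, htP, htne, ht⟩ := exists_subset_prod_one (k * L) (E * Nat.gcd k L)
    (Nat.mul_pos hE (Nat.gcd_pos_of_pos_left _ hk)) g P (by
      intro p hp
      rw [Units.ext_iff, Units.val_pow_eq_pow_val, hgv p hp, Units.val_one]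
      have hmod : p ^ E ≡ 1 [MOD L] := by
        rw [hLQ]
        apply Nat.ModEq.symm
        rw [Nat.modEq_iff_dvd]
        push_cast
        apply Finset.prod_dvd_of_coprime
        · intro x hx y hy hxy
          exact Nat.isCoprime_iff_coprime.2 ((Nat.coprime_primes (hQ x hx) (hQ y hy)).2 hxy)
        · intro q hq
          obtain ⟨c, hc⟩ := hEQ q hq
          have hpq : IsCoprime (p : ℤ) (q : ℤ) := Nat.isCoprime_iff_coprime.2
            ((Nat.coprime_primes (hP p hp) (hQ q hq)).2 (fun h => hPQ p hp (h ▸ hq)))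
          have h0 := Int.ModEq.pow_card_sub_one_eq_one (hQ q hq) hpq
          have h1 : (p : ℤ) ^ E ≡ 1 [ZMOD q] := by
            rw [hc, pow_mul]
            simpa using h0.pow c
          exact Int.modEq_iff_dvd.1 h1.symm
      have hk1 : k ∣ p - 1 := by
        obtain ⟨d, _, _, rfl⟩ := hPd p hp
        simp
      have := pow_gcd_dvd k L p E hk1 (hP p hp).one_le hmod
      have h2 := (ZMod.natCast_eq_natCast_iff _ _ _).2 this
      push_cast at h2
      exact h2) hcard
  refine ⟨t, htP, htne, ?_⟩
  have hprod : (∏ p ∈ t, p) ≡ 1 [MOD (k * L)] := by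
    rw [← ZMod.natCast_eq_natCast_iff]
    have := congrArg (fun u : (ZMod (k * L))ˣ => (u : ZMod (k * L))) ht
    simp only [Units.coe_prod, Units.val_one] at this
    push_cast
    rw [← this]
    exact Finset.prod_congr rfl fun p hp => (hgv p (htP hp)).symm
  have hpos : 1 ≤ ∏ p ∈ t, p := Finset.prod_pos fun p hp => (hP p (htP hp)).pos
  have hdvd : k * L ∣ (∏ p ∈ t, p) - 1 := (Nat.modEq_iff_dvd' hpos).1 hprod.symm
  apply korselt t (fun p hp => hP p (htP hp))
  · by_contra hle
    obtain ⟨p, rfl⟩ := Finset.card_eq_one.1 (le_antisymm (not_lt.1 hle) htne.card_pos)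
    have hp : p ∈ P := htP (Finset.mem_singleton_self p)
    obtain ⟨d, hd, hdL, hpd⟩ := hPd p hp
    simp only [Finset.prod_singleton] at hdvd
    have hd0 : 0 < d := Nat.pos_of_dvd_of_pos hd hL
    have : k * L ≤ d * k := by
      apply Nat.le_of_dvd (Nat.mul_pos hd0 hk)
      rw [hpd] at hdvd
      simpa using hdvd
    nlinarith
  · intro p hp
    obtain ⟨d, hd, hdL, hpd⟩ := hPd p (htP hp)
    refine Dvd.dvd.trans ?_ hdvd
    rw [hpd, Nat.add_sub_cancel, mul_comm]
    exact Nat.mul_dvd_mul_left k hd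

end CS

namespace CS
open Finset

/-- cancellation in lattice sums of a mean-zero periodic function against a Lipschitz function -/
theorem lattice_cancel {ι : Type*} [Fintype ι] [DecidableEq ι] (L : ℕ) (hL : 0 < L)
    (a : (ι → ℤ) → ℂ) (ha : ∀ v, ‖a v‖ ≤ 1)
    (hper : ∀ v w : ι → ℤ, a (fun i => v i + L * w i) = a v)
    (hmean : ∑ γ : ι → Fin L, a (fun i => ((γ i : ℕ) : ℤ)) = 0)
    (Ψ : (ι → ℝ) → ℂ) (Λ R : ℝ) (hΛ : 0 ≤ Λ) (hR : 0 ≤ R)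
    (hlip : ∀ x y, ‖Ψ x - Ψ y‖ ≤ Λ * ‖x - y‖)
    (hsupp : ∀ x, R < ‖x‖ → Ψ x = 0) (T : ℝ) (hT : (L : ℝ) ≤ T) :
    ‖∑' v : ι → ℤ, a v * Ψ (fun i => (v i : ℝ) / T)‖
      ≤ Λ * (3 * (R + 1)) ^ (Fintype.card ι) * L / T * T ^ (Fintype.card ι) := by
  classical
  have hLpos : (0 : ℝ) < L := by exact_mod_cast hL
  have hL1 : (1 : ℝ) ≤ L := by exact_mod_cast hL
  have hTpos : 0 < T := lt_of_lt_of_le hLpos hT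
  have : NeZero L := ⟨hL.ne'⟩
  let e : (ι → ℤ) ≃ (ι → ℤ) × (ι → Fin L) :=
    ((Equiv.refl ι).arrowCongr (Int.divModEquiv L)).trans (Equiv.arrowProdEquivProdArrow ι (fun _ => ℤ) (fun _ => Fin L))
  have he : ∀ w γ, e.symm (w, γ) = fun i => ((γ i : ℕ) : ℤ) + L * w i := by
    intro w γ
    funext i
    show (Int.divModEquiv L).symm (w i, γ i) = _
    simp [Int.divModEquiv]
    ring
  set F : (ι → ℤ) → ℂ := fun v => a v * Ψ (fun i => (v i : ℝ) / T) with hF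
  set Y : ℝ := (R + 1) * T / L with hY
  have hYpos : 0 ≤ Y := by positivity
  let N : ℤ := ⌊Y⌋
  let box : Finset (ι → ℤ) := Fintype.piFinset fun _ => Finset.Icc (-N) N
  -- outside the box everything vanishes
  have hout : ∀ w, w ∉ box → ∀ γ : ι → Fin L, Ψ (fun i => (((γ i : ℕ) : ℝ) + L * w i) / T) = 0 := by
    intro w hw γ
    have : ∃ i, w i ∉ Finset.Icc (-N) N := by
      by_contra h
      push Not at h
      exact hw (Fintype.mem_piFinset.2 h)
    obtain ⟨i, hi⟩ := this
    apply hsupp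
    have h1 : Y < |(w i : ℝ)| := by
      by_contra h
      push Not at h
      rw [abs_le] at h
      apply hi
      rw [Finset.mem_Icc]
      constructor
      · have : -(w i) ≤ N := Int.le_floor.2 (by push_cast; linarith [h.1])
        linarith
      · exact Int.le_floor.2 h.2
    have h2 : (γ i : ℝ) ≤ L := by exact_mod_cast (γ i).2.le
    have h3 : (0 : ℝ) ≤ (γ i : ℕ) := by positivity
    have h4 : R < |(((γ i : ℕ) : ℝ) + L * w i) / T| := by
      rw [abs_div, abs_of_pos hTpos, lt_div_iff₀ hTpos]
      have : (R + 1) * T < L * |(w i : ℝ)| := by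
        rw [hY, div_lt_iff₀ hLpos] at h1; linarith
      have h5 : |(L : ℝ) * w i| - |((γ i : ℕ) : ℝ)| ≤ |((γ i : ℕ) : ℝ) + L * w i| := by
        have := abs_sub_abs_le_abs_sub ((L : ℝ) * w i) (-((γ i : ℕ) : ℝ))
        rw [abs_neg, sub_neg_eq_add, add_comm ((L : ℝ) * w i)] at this
        exact this
      rw [abs_mul, abs_of_pos hLpos, abs_of_nonneg h3] at h5
      nlinarith
    refine lt_of_lt_of_le h4 ?_
    exact norm_le_pi_norm (fun i => (((γ i : ℕ) : ℝ) + L * w i) / T) i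
  have hfin : ∀ p : (ι → ℤ) × (ι → Fin L), p ∉ box ×ˢ (univ : Finset (ι → Fin L)) → F (e.symm p) = 0 := by
    rintro ⟨w, γ⟩ hp
    rw [Finset.mem_product, not_and_or] at hp
    have hw : w ∉ box := by simpa using hp
    rw [he, hF]
    simp only
    have := hout w hw γ
    push_cast
    rw [this, mul_zero]
  have h1 : ∑' v, F v = ∑ w ∈ box, ∑ γ : ι → Fin L, F (e.symm (w, γ)) := by
    rw [← e.symm.tsum_eq F, tsum_eq_sum (s := box ×ˢ (univ : Finset (ι → Fin L))) (fun p hp => hfin p hp),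
      Finset.sum_product]
  rw [h1]
  have h2 : ∀ w ∈ box, ‖∑ γ : ι → Fin L, F (e.symm (w, γ))‖ ≤ (L : ℝ) ^ (Fintype.card ι) * (Λ * (L / T)) := by
    intro w _
    have h3 : ∑ γ : ι → Fin L, F (e.symm (w, γ))
        = ∑ γ : ι → Fin L, a (fun i => ((γ i : ℕ) : ℤ)) *
          (Ψ (fun i => (((γ i : ℕ) : ℝ) + L * w i) / T) - Ψ (fun i => ((L : ℝ) * w i) / T)) := by
      simp_rw [mul_sub]
      rw [Finset.sum_sub_distrib, ← Finset.sum_mul, hmean, zero_mul, sub_zero]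
      apply Finset.sum_congr rfl
      intro γ _
      rw [he, hF]
      simp only
      rw [hper (fun i => ((γ i : ℕ) : ℤ)) w]
      push_cast
      rfl
    rw [h3]
    refine (norm_sum_le _ _).trans ?_
    have h4 : ∀ γ ∈ (univ : Finset (ι → Fin L)), ‖a (fun i => ((γ i : ℕ) : ℤ)) *
          (Ψ (fun i => (((γ i : ℕ) : ℝ) + L * w i) / T) - Ψ (fun i => ((L : ℝ) * w i) / T))‖ ≤ Λ * (L / T) := by
      intro γ _
      rw [norm_mul]
      have h5 := hlip (fun i => (((γ i : ℕ) : ℝ) + L * w i) / T) (fun i => ((L : ℝ) * w i) / T)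
      have h6 : ‖(fun i => (((γ i : ℕ) : ℝ) + L * w i) / T) - (fun i => ((L : ℝ) * w i) / T)‖ ≤ L / T := by
        rw [pi_norm_le_iff_of_nonneg (by positivity)]
        intro i
        simp only [Pi.sub_apply]
        rw [← sub_div, add_sub_cancel_right, Real.norm_eq_abs, abs_of_nonneg (by positivity)]
        gcongr
        exact_mod_cast (γ i).2.le
      calc _ ≤ 1 * (Λ * (L / T)) := by
            apply mul_le_mul (ha _) (h5.trans (by gcongr)) (norm_nonneg _) zero_le_one
        _ = _ := one_mul _
    refine (Finset.sum_le_sum h4).trans ?_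
    rw [Finset.sum_const, nsmul_eq_mul]
    simp
  refine (norm_sum_le _ _).trans ((Finset.sum_le_sum h2).trans ?_)
  rw [Finset.sum_const, nsmul_eq_mul]
  have hbox : (box.card : ℝ) ≤ (3 * (R + 1) * T / L) ^ (Fintype.card ι) := by
    have : box.card = (2 * N + 1).toNat ^ (Fintype.card ι) := by
      simp only [box, Fintype.card_piFinset, Int.card_Icc, Finset.prod_const, Finset.card_univ]
      congr 2
      ring
    rw [this]
    push_cast
    have hN : 0 ≤ N := Int.floor_nonneg.2 hYpos
    have h7 : ((2 * N + 1).toNat : ℝ) = 2 * (N : ℝ) + 1 := by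
      have : ((2 * N + 1).toNat : ℤ) = 2 * N + 1 := Int.toNat_of_nonneg (by omega)
      exact_mod_cast this
    rw [h7]
    have h8 : (N : ℝ) ≤ Y := Int.floor_le Y
    have h9 : 1 ≤ Y := by
      rw [hY, le_div_iff₀ hLpos]; nlinarith
    have hN' : (0 : ℝ) ≤ N := by exact_mod_cast hN
    apply pow_le_pow_left₀ (by positivity)
    calc 2 * (N : ℝ) + 1 ≤ 3 * Y := by linarith
      _ = _ := by rw [hY]; ring
  calc (box.card : ℝ) * ((L : ℝ) ^ (Fintype.card ι) * (Λ * (L / T)))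
      ≤ (3 * (R + 1) * T / L) ^ (Fintype.card ι) * ((L : ℝ) ^ (Fintype.card ι) * (Λ * (L / T))) := by
        gcongr
    _ = _ := by
        rw [div_pow, mul_pow (3 * (R + 1)) T]
        field_simp

end CS

namespace CS
open Finset

/-- the hat function -/
noncomputable def hat (c : ℝ) : ℝ := max 0 (1 - |c|)

theorem hat_nonneg (c : ℝ) : 0 ≤ hat c := le_max_left _ _
theorem hat_le_one (c : ℝ) : hat c ≤ 1 := max_le zero_le_one (by linarith [abs_nonneg c])
theorem hat_eq_zero {c : ℝ} (h : 1 ≤ |c|) : hat c = 0 := max_eq_left (by linarith)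
theorem hat_of_le {c : ℝ} (h : |c| ≤ 1) : hat c = 1 - |c| := max_eq_right (by linarith)
theorem hat_lip (a b : ℝ) : |hat a - hat b| ≤ |a - b| := by
  unfold hat
  refine (abs_max_sub_max_le_abs (1 - |a|) (1 - |b|) 0 |>.trans_eq' ?_).trans ?_
  · rw [max_comm 0, max_comm 0]
  · rw [show (1 - |a|) - (1 - |b|) = |b| - |a| by ring, abs_sub_comm]
    rw [abs_sub_comm a b]
    rw [abs_sub_comm b a]
    exact abs_abs_sub_abs_le a b

theorem hat_sum_pair (c : ℝ) :
    (∑ m ∈ ({-⌊c⌋, -⌊c⌋ - 1} : Finset ℤ), hat (c + m)) = 1 := by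
  rw [Finset.sum_pair (by omega)]
  have h0 := Int.floor_le c
  have h1 := Int.lt_floor_add_one c
  push_cast
  rw [hat_of_le (by rw [abs_le]; constructor <;> linarith), hat_of_le (by rw [abs_le]; constructor <;> linarith),
    abs_of_nonneg (by linarith), abs_of_nonpos (by linarith)]
  ring

theorem hat_out (c : ℝ) (m : ℤ) (hm : m ∉ ({-⌊c⌋, -⌊c⌋ - 1} : Finset ℤ)) : hat (c + m) = 0 := by
  apply hat_eq_zero
  have h0 := Int.floor_le c
  have h1 := Int.lt_floor_add_one c
  simp only [Finset.mem_insert, Finset.mem_singleton, not_or] at hm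
  rw [le_abs]
  rcases lt_or_gt_of_ne hm.1 with h | h
  · have : m ≤ -⌊c⌋ - 2 := by omega
    have : (m : ℝ) ≤ -⌊c⌋ - 2 := by exact_mod_cast this
    right; linarith
  · have : -⌊c⌋ + 1 ≤ m := by omega
    have : -(⌊c⌋ : ℝ) + 1 ≤ m := by exact_mod_cast this
    left; linarith

theorem hasSum_hat_prod {ι : Type*} [Fintype ι] (c : ι → ℝ) :
    HasSum (fun m : ι → ℤ => ∏ i, hat (c i + m i)) 1 := by
  classical
  have h1 : (∑ m ∈ Fintype.piFinset (fun i => ({-⌊c i⌋, -⌊c i⌋ - 1} : Finset ℤ)), ∏ i, hat (c i + m i)) = 1 := by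
    rw [← Finset.prod_univ_sum (fun i => ({-⌊c i⌋, -⌊c i⌋ - 1} : Finset ℤ)) (fun i m => hat (c i + m))]
    exact Finset.prod_eq_one fun i _ => hat_sum_pair (c i)
  rw [← h1]
  apply hasSum_sum_of_ne_finset_zero
  intro m hm
  rw [Fintype.mem_piFinset] at hm
  push Not at hm
  obtain ⟨i, hi⟩ := hm
  exact Finset.prod_eq_zero (Finset.mem_univ i) (hat_out _ _ hi)

theorem hasSum_hat (c : ℝ) : HasSum (fun m : ℤ => hat (c + m)) 1 := by
  rw [← hat_sum_pair c]
  exact hasSum_sum_of_ne_finset_zero (fun m hm => hat_out _ _ hm)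

/-- difference of products of bounded factors -/
theorem prod_diff_le {ι : Type*} (S : Finset ι) (a b : ι → ℝ)
    (ha : ∀ i, |a i| ≤ 1) (hb : ∀ i, |b i| ≤ 1) :
    |∏ i ∈ S, a i - ∏ i ∈ S, b i| ≤ ∑ i ∈ S, |a i - b i| := by
  classical
  induction S using Finset.induction_on with
  | empty => simp
  | insert j S hj ih =>
    rw [prod_insert hj, prod_insert hj, sum_insert hj]
    have h1 : |∏ i ∈ S, b i| ≤ 1 := by
      rw [Finset.abs_prod]
      exact Finset.prod_le_one (fun i _ => abs_nonneg _) (fun i _ => hb i)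
    calc |a j * ∏ i ∈ S, a i - b j * ∏ i ∈ S, b i|
        = |a j * (∏ i ∈ S, a i - ∏ i ∈ S, b i) + (a j - b j) * ∏ i ∈ S, b i| := by ring_nf
      _ ≤ |a j * (∏ i ∈ S, a i - ∏ i ∈ S, b i)| + |(a j - b j) * ∏ i ∈ S, b i| := abs_add_le _ _
      _ ≤ 1 * |∏ i ∈ S, a i - ∏ i ∈ S, b i| + |a j - b j| * 1 := by
          rw [abs_mul, abs_mul]
          gcongr
          exact ha j
      _ ≤ _ := by linarith

/-- the one-dimensional window `hat y * 2^{-s y}` -/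
noncomputable def win (s : ℂ) (y : ℝ) : ℂ := (hat y : ℂ) * Complex.exp (-s * (y * Real.log 2 : ℝ))

theorem win_bound (s : ℂ) (hs : ‖s‖ ≤ 3) (y : ℝ) : ‖win s y‖ ≤ Real.exp 3 := by
  unfold win
  rw [norm_mul, Complex.norm_real, Real.norm_eq_abs, abs_of_nonneg (hat_nonneg y)]
  rcases le_or_gt 1 |y| with h | h
  · rw [hat_eq_zero h, zero_mul]; positivity
  · have h2 : ‖Complex.exp (-s * (y * Real.log 2 : ℝ))‖ ≤ Real.exp 3 := by
      refine (Complex.norm_exp_le_exp_norm _).trans (Real.exp_le_exp.2 ?_)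
      rw [norm_mul, norm_neg, Complex.norm_real, Real.norm_eq_abs, abs_mul,
        abs_of_pos (Real.log_pos one_lt_two)]
      have := Real.log_two_lt_d9
      have h3 : |y| * Real.log 2 ≤ 1 := by
        have := Real.log_pos one_lt_two
        nlinarith [abs_nonneg y]
      have h4 : 0 ≤ |y| * Real.log 2 := by
        have := Real.log_pos one_lt_two
        positivity
      nlinarith [norm_nonneg s]
    calc _ ≤ 1 * Real.exp 3 := mul_le_mul (hat_le_one y) h2 (norm_nonneg _) zero_le_one
      _ = _ := one_mul _

theorem win_zero (s : ℂ) {y : ℝ} (h : 1 ≤ |y|) : win s y = 0 := by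
  simp [win, hat_eq_zero h]

theorem exp_lip (s : ℂ) (hs : ‖s‖ ≤ 3) (y y' : ℝ) (hy : |y| ≤ 1) (hy' : |y'| ≤ 1) :
    ‖Complex.exp (-s * (y * Real.log 2 : ℝ)) - Complex.exp (-s * (y' * Real.log 2 : ℝ))‖
      ≤ (3 * Real.exp 3) * |y - y'| := by
  have hd : ∀ t ∈ Set.Icc (-1 : ℝ) 1, HasDerivWithinAt
      (fun t : ℝ => Complex.exp (-s * (t * Real.log 2 : ℝ)))
      (Complex.exp (-s * (t * Real.log 2 : ℝ)) * (-s * (Real.log 2 : ℝ))) (Set.Icc (-1 : ℝ) 1) t := by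
    intro t _
    apply HasDerivAt.hasDerivWithinAt
    apply HasDerivAt.cexp
    have h1 : HasDerivAt (fun t : ℝ => ((t * Real.log 2 : ℝ) : ℂ)) ((Real.log 2 : ℝ) : ℂ) t := by
      have := (hasDerivAt_mul_const (x := t) (Real.log 2)).ofReal_comp
      simpa using this
    exact h1.const_mul (-s)
  have hb : ∀ t ∈ Set.Icc (-1 : ℝ) 1, ‖Complex.exp (-s * (t * Real.log 2 : ℝ)) * (-s * (Real.log 2 : ℝ))‖ ≤ 3 * Real.exp 3 := by
    intro t ht
    have hl := Real.log_pos one_lt_two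
    have hl2 : Real.log 2 ≤ 1 := by have := Real.log_two_lt_d9; linarith
    have ht' : |t| ≤ 1 := abs_le.2 ht
    have h2 : ‖Complex.exp (-s * (t * Real.log 2 : ℝ))‖ ≤ Real.exp 3 := by
      refine (Complex.norm_exp_le_exp_norm _).trans (Real.exp_le_exp.2 ?_)
      rw [norm_mul, norm_neg, Complex.norm_real, Real.norm_eq_abs, abs_mul, abs_of_pos hl]
      have h3 : |t| * Real.log 2 ≤ 1 := by nlinarith [abs_nonneg t]
      have h4 : 0 ≤ |t| * Real.log 2 := by positivity
      nlinarith [norm_nonneg s]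
    rw [norm_mul, norm_mul, norm_neg, Complex.norm_real, Real.norm_eq_abs, abs_of_pos hl]
    have : ‖s‖ * Real.log 2 ≤ 3 := by nlinarith [norm_nonneg s]
    calc _ ≤ Real.exp 3 * 3 := by gcongr
      _ = _ := by ring
  have := (convex_Icc (-1 : ℝ) 1).norm_image_sub_le_of_norm_hasDerivWithin_le hd hb
    (abs_le.1 hy') (abs_le.1 hy)
  simpa [Real.norm_eq_abs] using this

theorem win_lip (s : ℂ) (hs : ‖s‖ ≤ 3) (y y' : ℝ) :
    ‖win s y - win s y'‖ ≤ (4 * Real.exp 3) * |y - y'| := by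
  -- wlog reduce to clamped points
  let cl : ℝ → ℝ := fun t => max (-1) (min 1 t)
  have hcl : ∀ t, |cl t| ≤ 1 := by
    intro t
    rw [abs_le]
    exact ⟨le_max_left _ _, max_le (by norm_num) (min_le_left _ _)⟩
  have hclw : ∀ t, win s t = (hat t : ℂ) * Complex.exp (-s * (cl t * Real.log 2 : ℝ)) := by
    intro t
    rcases le_or_gt 1 |t| with h | h
    · rw [win_zero s h, hat_eq_zero h]; simp
    · rw [abs_lt] at h
      have : cl t = t := by
        simp only [cl]
        rw [min_eq_right h.2.le, max_eq_right h.1.le]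
      rw [this]; rfl
  have hcll : |cl y - cl y'| ≤ |y - y'| := by
    simp only [cl]
    refine le_trans ?_ (abs_min_sub_min_le_max 1 y 1 y' |>.trans (by simp))
    refine (abs_max_sub_max_le_max (-1) _ (-1) _).trans (by simp)
  have hE : ∀ t, ‖Complex.exp (-s * (cl t * Real.log 2 : ℝ))‖ ≤ Real.exp 3 := by
    intro t
    have hl := Real.log_pos one_lt_two
    have hl2 : Real.log 2 ≤ 1 := by have := Real.log_two_lt_d9; linarith
    refine (Complex.norm_exp_le_exp_norm _).trans (Real.exp_le_exp.2 ?_)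
    rw [norm_mul, norm_neg, Complex.norm_real, Real.norm_eq_abs, abs_mul, abs_of_pos hl]
    have h3 : |cl t| * Real.log 2 ≤ 1 := by nlinarith [abs_nonneg (cl t), hcl t]
    have h4 : 0 ≤ |cl t| * Real.log 2 := by positivity
    nlinarith [norm_nonneg s]
  rw [hclw, hclw]
  have hsplit : ∀ a b : ℂ, ∀ e e' : ℂ, a * e - b * e' = (a - b) * e + b * (e - e') := by
    intros; ring
  rw [hsplit]
  refine (norm_add_le _ _).trans ?_
  rw [norm_mul, norm_mul, ← Complex.ofReal_sub, Complex.norm_real, Complex.norm_real, Real.norm_eq_abs,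
    Real.norm_eq_abs, abs_of_nonneg (hat_nonneg y')]
  have h1 := exp_lip s hs (cl y) (cl y') (hcl _) (hcl _)
  have h5 : |hat y - hat y'| * ‖Complex.exp (-s * (cl y * Real.log 2 : ℝ))‖ ≤ |y - y'| * Real.exp 3 :=
    mul_le_mul (hat_lip _ _) (hE y) (norm_nonneg _) (abs_nonneg _)
  have h6 : hat y' * ‖Complex.exp (-s * (cl y * Real.log 2 : ℝ)) - Complex.exp (-s * (cl y' * Real.log 2 : ℝ))‖
      ≤ 1 * (3 * Real.exp 3 * |y - y'|) := by
    apply mul_le_mul (hat_le_one _) (h1.trans _) (norm_nonneg _) zero_le_one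
    gcongr
  linarith

end CS

namespace CS
open Finset

theorem theta_exists {P ι : Type*} [Fintype P] [Fintype ι] (ℓ : (P → ℝ) →ₗ[ℝ] ℝ)
    (c : ι → (P → ℝ) →ₗ[ℝ] ℝ) (hinj : ∀ v, ℓ v = 0 → (∀ i, c i v = 0) → v = 0) :
    ∃ R M : ℝ, 0 < R ∧ 0 ≤ M ∧ ∀ s : ℂ, ‖s‖ ≤ 3 →
      (∀ v v', ‖win s (ℓ v) * ((∏ i, hat (c i v) : ℝ) : ℂ)
          - win s (ℓ v') * ((∏ i, hat (c i v') : ℝ) : ℂ)‖ ≤ M * ‖v - v'‖) ∧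
      ∀ v, R < ‖v‖ → win s (ℓ v) * ((∏ i, hat (c i v) : ℝ) : ℂ) = 0 := by
  classical
  let ℓ' := LinearMap.toContinuousLinearMap ℓ
  let c' := fun i => LinearMap.toContinuousLinearMap (c i)
  have hℓ : ∀ v v', |ℓ v - ℓ v'| ≤ ‖ℓ'‖ * ‖v - v'‖ := by
    intro v v'
    rw [← map_sub, ← Real.norm_eq_abs]
    exact ℓ'.le_opNorm (v - v')
  have hc : ∀ i v v', |c i v - c i v'| ≤ ‖c' i‖ * ‖v - v'‖ := by
    intro i v v'
    rw [← map_sub, ← Real.norm_eq_abs]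
    exact (c' i).le_opNorm (v - v')
  let A : (P → ℝ) →ₗ[ℝ] (ℝ × (ι → ℝ)) := LinearMap.prod ℓ (LinearMap.pi c)
  have hA : LinearMap.ker A = ⊥ := by
    rw [LinearMap.ker_eq_bot']
    intro v hv
    simp only [A, LinearMap.prod_apply, Function.prod_apply, Prod.mk_eq_zero] at hv
    exact hinj v hv.1 (fun i => congrFun hv.2 i)
  obtain ⟨κ, hκ, hanti⟩ := LinearMap.exists_antilipschitzWith A hA
  refine ⟨κ, 4 * Real.exp 3 * ‖ℓ'‖ + Real.exp 3 * ∑ i, ‖c' i‖, by exact_mod_cast hκ,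
    by positivity, fun s hs => ⟨?_, ?_⟩⟩
  · intro v v'
    set p := ∏ i, hat (c i v)
    set p' := ∏ i, hat (c i v')
    have hp : |p - p'| ≤ ∑ i, ‖c' i‖ * ‖v - v'‖ := by
      refine (prod_diff_le _ _ _ ?_ ?_).trans ?_
      · intro i; rw [abs_of_nonneg (hat_nonneg _)]; exact hat_le_one _
      · intro i; rw [abs_of_nonneg (hat_nonneg _)]; exact hat_le_one _
      · exact Finset.sum_le_sum fun i _ => (hat_lip _ _).trans (hc i v v')
    have hp1 : |p| ≤ 1 := by
      rw [Finset.abs_prod]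
      exact Finset.prod_le_one (fun i _ => abs_nonneg _)
        (fun i _ => by rw [abs_of_nonneg (hat_nonneg _)]; exact hat_le_one _)
    have h1 : win s (ℓ v) * (p : ℂ) - win s (ℓ v') * (p' : ℂ)
        = (win s (ℓ v) - win s (ℓ v')) * (p : ℂ) + win s (ℓ v') * ((p - p' : ℝ) : ℂ) := by
      push_cast; ring
    rw [h1]
    refine (norm_add_le _ _).trans ?_
    rw [norm_mul, norm_mul, Complex.norm_real, Complex.norm_real, Real.norm_eq_abs, Real.norm_eq_abs]
    have h2 : ‖win s (ℓ v) - win s (ℓ v')‖ * |p| ≤ (4 * Real.exp 3 * (‖ℓ'‖ * ‖v - v'‖)) * 1 := by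
      apply mul_le_mul ((win_lip s hs _ _).trans _) hp1 (abs_nonneg _) (by positivity)
      gcongr
      exact hℓ v v'
    have h3 : ‖win s (ℓ v')‖ * |p - p'| ≤ Real.exp 3 * (∑ i, ‖c' i‖ * ‖v - v'‖) :=
      mul_le_mul (win_bound s hs _) hp (abs_nonneg _) (by positivity)
    rw [← Finset.sum_mul] at h3
    nlinarith
  · intro v hv
    by_contra hne
    have h1 : |ℓ v| < 1 := by
      by_contra h
      push Not at h
      exact hne (by rw [win_zero s h, zero_mul])
    have h2 : ∀ i, |c i v| < 1 := by
      intro i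
      by_contra h
      push Not at h
      apply hne
      rw [Finset.prod_eq_zero (Finset.mem_univ i) (hat_eq_zero h)]
      simp
    have h3 : ‖A v‖ ≤ 1 := by
      rw [Prod.norm_def]
      apply max_le
      · exact h1.le
      · rw [pi_norm_le_iff_of_nonneg zero_le_one]
        exact fun i => (h2 i).le
    have h4 := hanti.le_mul_dist v 0
    rw [dist_zero_right, map_zero, dist_zero_right] at h4
    have hκ' : (0 : ℝ) < κ := by exact_mod_cast hκ
    nlinarith

theorem log_max_lip {δ : ℝ} (hδ : 0 < δ) (a b : ℝ) :
    |Real.log (max a δ) - Real.log (max b δ)| ≤ δ⁻¹ * |a - b| := by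
  have key : ∀ x y : ℝ, δ ≤ x → δ ≤ y → Real.log x - Real.log y ≤ δ⁻¹ * |x - y| := by
    intro x y hx hy
    have hx0 := hδ.trans_le hx
    have hy0 := hδ.trans_le hy
    rw [← Real.log_div hx0.ne' hy0.ne']
    refine (Real.log_le_sub_one_of_pos (by positivity)).trans ?_
    rw [div_sub_one hy0.ne', div_eq_inv_mul]
    calc y⁻¹ * (x - y) ≤ y⁻¹ * |x - y| := by gcongr; exact le_abs_self _
      _ ≤ δ⁻¹ * |x - y| := by gcongr
  have h1 := key (max a δ) (max b δ) (le_max_right _ _) (le_max_right _ _)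
  have h2 := key (max b δ) (max a δ) (le_max_right _ _) (le_max_right _ _)
  have h3 := abs_max_sub_max_le_abs a b δ
  have hδ' : 0 < δ⁻¹ := inv_pos.2 hδ
  rw [abs_sub_comm (max b δ)] at h2
  rw [abs_le]
  constructor <;> nlinarith

theorem phi_exists {P ι : Type*} [Fintype P] [Fintype ι] (ℓ : (P → ℝ) →ₗ[ℝ] ℝ)
    (c : ι → (P → ℝ) →ₗ[ℝ] ℝ) (hinj : ∀ v, ℓ v = 0 → (∀ i, c i v = 0) → v = 0) :
    ∃ R M : ℝ, 0 < R ∧ 0 ≤ M ∧ ∀ s : ℂ, ‖s‖ ≤ 3 → ∃ Φ : (P → ℝ) → ℂ,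
      (∀ y y', ‖Φ y - Φ y'‖ ≤ M * ‖y - y'‖) ∧
      (∀ y w, R < y w → Φ y = 0) ∧ (∀ y w, y w ≤ 0 → Φ y = 0) ∧
      (∀ y, (∀ w, 0 < y w) → Φ y = win s (ℓ fun w => Real.log (y w)) *
        ((∏ i, hat (c i fun w => Real.log (y w)) : ℝ) : ℂ)) := by
  obtain ⟨R, M, hR, hM, h⟩ := theta_exists ℓ c hinj
  set δ : ℝ := Real.exp (-(R + 1)) with hδdef
  have hδ : 0 < δ := Real.exp_pos _
  refine ⟨Real.exp R, M * δ⁻¹, Real.exp_pos _, by positivity, fun s hs => ?_⟩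
  obtain ⟨h1, h2⟩ := h s hs
  have hbig : ∀ (v : P → ℝ) w, R < |v w| → R < ‖v‖ := fun v w hw =>
    hw.trans_le (by rw [← Real.norm_eq_abs]; exact norm_le_pi_norm v w)
  refine ⟨fun y => win s (ℓ fun w => Real.log (max (y w) δ)) *
        ((∏ i, hat (c i fun w => Real.log (max (y w) δ)) : ℝ) : ℂ), ?_, ?_, ?_, ?_⟩
  · intro y y'
    refine (h1 _ _).trans ?_
    rw [mul_assoc]
    gcongr
    rw [pi_norm_le_iff_of_nonneg (by positivity)]
    intro w
    refine (log_max_lip hδ (y w) (y' w)).trans ?_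
    gcongr
    rw [← Real.norm_eq_abs]
    exact norm_le_pi_norm (y - y') w
  · intro y w hw
    apply h2
    apply hbig _ w
    have : R < Real.log (max (y w) δ) := by
      rw [Real.lt_log_iff_exp_lt (lt_max_of_lt_right hδ)]
      exact lt_max_of_lt_left hw
    exact this.trans_le (le_abs_self _)
  · intro y w hw
    apply h2
    apply hbig _ w
    rw [max_eq_right (hw.trans hδ.le), hδdef, Real.log_exp, abs_neg, abs_of_pos (by linarith)]
    linarith
  · intro y hy
    by_cases hall : ∀ w, δ ≤ y w
    · have : (fun w => Real.log (max (y w) δ)) = fun w => Real.log (y w) := by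
        funext w; rw [max_eq_left (hall w)]
      simp only [this]
    · push Not at hall
      obtain ⟨w, hw⟩ := hall
      have e1 := h2 (fun w => Real.log (max (y w) δ)) (by
        apply hbig _ w
        rw [max_eq_right hw.le, hδdef, Real.log_exp, abs_neg, abs_of_pos (by linarith)]
        linarith)
      have e2 := h2 (fun w => Real.log (y w)) (by
        apply hbig _ w
        have : Real.log (y w) < -(R + 1) := by
          rw [Real.log_lt_iff_lt_exp (hy w)]; exact hw
        rw [abs_of_neg (by linarith)]
        linarith)
      rw [e2]; exact e1

end CS

namespace CS
open Finset NumberField NumberField.InfinitePlace NumberField.mixedEmbedding NumberField.Units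
  NumberField.Units.dirichletUnitTheorem

variable (K : Type*) [Field K] [NumberField K]

open scoped Classical in
/-- the real basis of the log space coming from the unit lattice -/
noncomputable def lbasis : Module.Basis (Fin (rank K)) ℝ (logSpace K) :=
  (basisUnitLattice K).ofZLatticeBasis ℝ _

/-- partition of unity modulo units -/
noncomputable def unitW (x : mixedSpace K) : ℝ := ∏ i, hat ((lbasis K).repr (logMap x) i)

theorem unitW_nonneg (x : mixedSpace K) : 0 ≤ unitW K x :=
  Finset.prod_nonneg fun _ _ => hat_nonneg _

/-- units as torsion times integer vectors -/
noncomputable def unitEquiv : (torsion K × (Fin (rank K) → ℤ)) ≃ (𝓞 K)ˣ :=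
  Equiv.ofBijective (fun p => (p.1 : (𝓞 K)ˣ) * ∏ i, (fundSystem K i) ^ (p.2 i)) (by
    constructor
    · intro p q h
      obtain ⟨r, _, hr⟩ := exist_unique_eq_mul_prod K ((p.1 : (𝓞 K)ˣ) * ∏ i, (fundSystem K i) ^ (p.2 i))
      rw [hr p rfl, hr q h]
    · intro u
      obtain ⟨p, hp, _⟩ := exist_unique_eq_mul_prod K u
      exact ⟨p, hp.symm⟩)

theorem lbasis_repr_unit (ζ : torsion K) (m : Fin (rank K) → ℤ) (i : Fin (rank K)) :
    (lbasis K).repr (logEmbedding K (Additive.ofMul (unitEquiv K (ζ, m)))) i = m i := by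
  classical
  have h0 : logEmbedding K (Additive.ofMul (ζ : (𝓞 K)ˣ)) = 0 :=
    logEmbedding_eq_zero_iff.mpr ζ.2
  have h1 : logEmbedding K (Additive.ofMul (unitEquiv K (ζ, m))) = ∑ j, (m j : ℝ) • lbasis K j := by
    change logEmbedding K (Additive.ofMul ((ζ : (𝓞 K)ˣ) * ∏ i, (fundSystem K i) ^ (m i))) = _
    rw [ofMul_mul, map_add, h0, zero_add, ofMul_prod, map_sum]
    apply Finset.sum_congr rfl
    intro j _
    rw [ofMul_zpow, map_zsmul, logEmbedding_fundSystem, lbasis,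
      Module.Basis.ofZLatticeBasis_apply, Int.cast_smul_eq_zsmul]
  rw [h1, map_sum, Finsupp.finsetSum_apply]
  simp [Finsupp.single_apply]

theorem hasSum_unitW (x : mixedSpace K) (hx : mixedEmbedding.norm x ≠ 0) :
    HasSum (fun u : (𝓞 K)ˣ => unitW K (u • x)) (torsionOrder K) := by
  rw [← (unitEquiv K).hasSum_iff]
  have hft : Fintype (torsion K) := Fintype.ofFinite _
  have h1 : ((fun u : (𝓞 K)ˣ => unitW K (u • x)) ∘ (unitEquiv K)) =
      fun p : torsion K × (Fin (rank K) → ℤ) => ∏ i, hat ((lbasis K).repr (logMap x) i + p.2 i) := by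
    funext ⟨ζ, m⟩
    simp only [Function.comp, unitW]
    apply Finset.prod_congr rfl
    intro i _
    rw [logMap_unit_smul _ hx, map_add, Finsupp.add_apply, lbasis_repr_unit, add_comm]
  rw [h1]
  have h2 := hasSum_hat_prod (fun i => (lbasis K).repr (logMap x) i)
  have h4 : ∀ z : torsion K, HasSum (fun m : Fin (rank K) → ℤ => ∏ i, hat ((lbasis K).repr (logMap x) i + m i)) 1 :=
    fun _ => h2
  have hs : Summable (fun p : torsion K × (Fin (rank K) → ℤ) => ∏ i, hat ((lbasis K).repr (logMap x) i + p.2 i)) := by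
    rw [summable_prod_of_nonneg (fun p => Finset.prod_nonneg fun _ _ => hat_nonneg _)]
    exact ⟨fun z => (h4 z).summable, (hasSum_fintype _).summable⟩
  have h5 := hs.hasSum.prod_fiberwise h4
  have h6 := h5.unique (hasSum_fintype _)
  have h7 : (∑ _z : torsion K, (1 : ℝ)) = torsionOrder K := by
    rw [Finset.sum_const, Finset.card_univ, nsmul_eq_mul, mul_one, torsionOrder, Nat.card_eq_fintype_card]
  rw [← h7, ← h6]
  exact hs.hasSum

end CS

namespace CS
open Finset NumberField NumberField.InfinitePlace NumberField.mixedEmbedding NumberField.Units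
  NumberField.Units.dirichletUnitTheorem

variable (K : Type*) [Field K] [NumberField K]

theorem mnorm_ne_zero {x : 𝓞 K} (hx : x ≠ 0) : mixedEmbedding.norm (mixedEmbedding K (x : K)) ≠ 0 := by
  rw [norm_eq_norm]
  simpa [Algebra.norm_eq_zero_iff] using hx

open scoped Classical in
theorem hasSum_assoc {V : Type*} (y : V → 𝓞 K) (hy : Function.Injective y) (J : Ideal (𝓞 K))
    (hyJ : ∀ x, x ∈ J ↔ ∃ v, y v = x) (γ : 𝓞 K) (hγ : γ ∈ J) (hγ0 : γ ≠ 0) :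
    HasSum (fun v => if Ideal.span {y v} = Ideal.span {γ} then unitW K (mixedEmbedding K (y v : K)) else 0)
      (torsionOrder K : ℝ) := by
  have h1 : ∀ u : (𝓞 K)ˣ, ∃ v, y v = u * γ := fun u => (hyJ _).1 (J.mul_mem_left _ hγ)
  choose g hg using h1
  have hginj : Function.Injective g := by
    intro u u' h
    have : (u : 𝓞 K) * γ = u' * γ := by rw [← hg, ← hg, h]
    exact Units.ext (mul_right_cancel₀ hγ0 this)
  rw [← hginj.hasSum_iff]
  · refine (hasSum_unitW K (mixedEmbedding K (γ : K)) (mnorm_ne_zero K hγ0)).congr_fun ?_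
    intro u
    have h2 : Ideal.span {y (g u)} = Ideal.span {γ} := by
      rw [hg, Ideal.span_singleton_eq_span_singleton]
      exact associated_unit_mul_left _ _ u.isUnit
    simp only [Function.comp, h2, if_true]
    rw [hg, unitSMul_smul, ← map_mul, ← map_mul]
  · intro v hv
    rw [if_neg]
    intro h
    rw [Ideal.span_singleton_eq_span_singleton] at h
    obtain ⟨u, hu⟩ := h.symm
    apply hv
    refine ⟨u, hy ?_⟩
    rw [hg, ← hu, mul_comm]

open scoped Classical in
theorem hasSum_class {V : Type*} (y : V → 𝓞 K) (hy : Function.Injective y) (J : Ideal (𝓞 K)) (hJ : J ≠ ⊥)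
    (hyJ : ∀ x, x ∈ J ↔ ∃ v, y v = x) (F : ℕ → ℂ) (S : Finset (Ideal (𝓞 K)))
    (hS : ∀ I ∈ S, I ≠ ⊥ ∧ (I * J).IsPrincipal)
    (hF0 : F 0 = 0) (hFS : ∀ I : Ideal (𝓞 K), I ≠ ⊥ → (I * J).IsPrincipal → I ∉ S → F (Ideal.absNorm I) = 0) :
    HasSum (fun v => F ((Algebra.norm ℤ (y v)).natAbs / Ideal.absNorm J) *
      (unitW K (mixedEmbedding K (y v : K)) : ℂ))
      (torsionOrder K * ∑ I ∈ S, F (Ideal.absNorm I)) := by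
  have h1 : HasSum (fun v => ∑ I ∈ S, F (Ideal.absNorm I) *
      ((if Ideal.span {y v} = I * J then unitW K (mixedEmbedding K (y v : K)) else 0 : ℝ) : ℂ))
      (∑ I ∈ S, F (Ideal.absNorm I) * (torsionOrder K : ℝ)) := by
    apply hasSum_sum
    intro I hI
    obtain ⟨γ, hγ⟩ := (hS I hI).2
    rw [← Ideal.span] at hγ
    apply HasSum.mul_left
    rw [Complex.hasSum_ofReal]
    have hγJ : γ ∈ J := Ideal.mul_le_right (I := I) (J := J) (by rw [hγ]; exact Ideal.mem_span_singleton_self γ)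
    have hγ0 : γ ≠ 0 := by
      rintro rfl
      rw [Ideal.span_singleton_eq_bot.2 rfl] at hγ
      rcases Ideal.mul_eq_bot.1 hγ with h | h
      · exact (hS I hI).1 h
      · exact hJ h
    rw [hγ]
    exact hasSum_assoc K y hy J hyJ γ hγJ hγ0
  rw [← Finset.sum_mul, mul_comm] at h1
  push_cast at h1
  refine h1.congr_fun ?_
  intro v
  by_cases hv : y v = 0
  · rw [hv]
    have : ∀ I ∈ S, ¬ (Ideal.span {(0 : 𝓞 K)} = I * J) := by
      intro I hI h
      rw [Ideal.span_singleton_eq_bot.2 rfl] at h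
      rcases Ideal.mul_eq_bot.1 h.symm with h | h
      · exact (hS I hI).1 h
      · exact hJ h
    rw [Finset.sum_eq_zero]
    · simp [hF0]
    · intro I hI
      rw [if_neg (this I hI)]; simp
  · have hvJ : y v ∈ J := (hyJ _).2 ⟨v, rfl⟩
    have : J ∣ Ideal.span {y v} := by
      rw [Ideal.dvd_iff_le, Ideal.span_singleton_le_iff_mem]; exact hvJ
    obtain ⟨I, hI⟩ := this
    rw [mul_comm] at hI
    have hI0 : I ≠ ⊥ := by
      rintro rfl
      rw [Ideal.bot_mul] at hI
      exact hv (Ideal.span_singleton_eq_bot.1 hI)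
    have hIp : (I * J).IsPrincipal := ⟨y v, hI.symm⟩
    have hN : (Algebra.norm ℤ (y v)).natAbs / Ideal.absNorm J = Ideal.absNorm I := by
      rw [← Ideal.absNorm_span_singleton, hI, map_mul, Nat.mul_div_cancel]
      exact Nat.pos_of_ne_zero (by rwa [Ne, Ideal.absNorm_eq_zero_iff])
    rw [hN]
    have huniq : ∀ I', I' * J = I * J → I' = I := fun I' h => mul_right_cancel₀ (by simpa using hJ) h
    by_cases hIS : I ∈ S
    · rw [Finset.sum_eq_single_of_mem I hIS]
      · simp [hI]
      · intro I' hI' hne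
        rw [if_neg]
        · simp
        · rw [hI]; intro h; exact hne (huniq I' h.symm)
    · rw [hFS I hI0 hIp hIS, zero_mul, Finset.sum_eq_zero]
      intro I' hI'
      rw [if_neg]
      · simp
      · rw [hI]; intro h; exact hIS (huniq I' h.symm ▸ hI')
end CS

namespace CS
open Finset NumberField NumberField.InfinitePlace NumberField.mixedEmbedding NumberField.Units
  NumberField.Units.dirichletUnitTheorem

theorem norm_congr (K : Type*) [Field K] [NumberField K] (L : ℕ) (x z : 𝓞 K) :
    ((Algebra.norm ℤ (x + (L : 𝓞 K) * z) : ℤ) : ZMod L) = ((Algebra.norm ℤ x : ℤ) : ZMod L) := by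
  classical
  let b := RingOfIntegers.basis K
  rw [Algebra.norm_eq_matrix_det b, Algebra.norm_eq_matrix_det b]
  change (Int.castRingHom (ZMod L)) _ = (Int.castRingHom (ZMod L)) _
  rw [RingHom.map_det, RingHom.map_det]
  congr 1
  ext i j
  rw [map_add, map_mul]
  have : Algebra.leftMulMatrix b (L : 𝓞 K) = ((L : ℕ) : Matrix _ _ ℤ) := by
    rw [map_natCast]
  rw [this, ← nsmul_eq_mul]
  simp only [RingHom.mapMatrix_apply, Matrix.map_apply, Matrix.add_apply, Matrix.smul_apply]
  simp

/-- mean zero of a norm character on the ideal lattice -/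
theorem mean_zero (K : Type*) [Field K] [NumberField K] {ι : Type*} [Fintype ι] [DecidableEq ι]
    (J : Ideal (𝓞 K)) (b : Module.Basis ι ℤ J) (L : ℕ) (hL : 0 < L) (χ : DirichletCharacter ℂ L)
    (β : 𝓞 K) (hβ : IsCoprime (Algebra.norm ℤ β) (L : ℤ))
    (hχ : χ ((Algebra.norm ℤ β : ℤ) : ZMod L) ≠ 1) :
    ∑ γ : ι → Fin L, χ ((Algebra.norm ℤ ((b.equivFun.symm (fun i => ((γ i : ℕ) : ℤ)) : J) : 𝓞 K) : ℤ) : ZMod L)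
      = 0 := by
  have : NeZero L := ⟨hL.ne'⟩
  obtain ⟨δ, hδ⟩ : β ∣ ((Algebra.norm ℤ β : ℤ) : 𝓞 K) := by
    have h := Ideal.absNorm_mem (Ideal.span {β})
    rw [Ideal.absNorm_span_singleton, Ideal.mem_span_singleton] at h
    rcases Int.natAbs_eq (Algebra.norm ℤ β) with h2 | h2
    · rw [h2, Int.cast_natCast]; exact h
    · rw [h2, Int.cast_neg, Int.cast_natCast, dvd_neg]; exact h
  obtain ⟨p, q, hpq⟩ := hβ
  -- the multiplication by beta
  have hLZ : (L : ℤ) ≠ 0 := by exact_mod_cast hL.ne'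
  let Y : (ι → ℤ) → J := fun v => b.equivFun.symm v
  let π : (ι → Fin L) → (ι → Fin L) := fun γ i =>
    ⟨((b.equivFun (β • Y (fun i => ((γ i : ℕ) : ℤ))) i) % (L : ℤ)).toNat, by
      have h1 := Int.emod_lt_of_pos (b.equivFun (β • Y (fun i => ((γ i : ℕ) : ℤ))) i) (by exact_mod_cast hL : (0:ℤ) < L)
      have h2 := Int.emod_nonneg (b.equivFun (β • Y (fun i => ((γ i : ℕ) : ℤ))) i) hLZ
      omega⟩
  have hπval : ∀ γ i, (((π γ i : ℕ)) : ℤ) = (b.equivFun (β • Y (fun i => ((γ i : ℕ) : ℤ))) i) % (L : ℤ) := by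
    intro γ i
    have h2 := Int.emod_nonneg (b.equivFun (β • Y (fun i => ((γ i : ℕ) : ℤ))) i) hLZ
    simp only [π]
    exact Int.toNat_of_nonneg h2
  have hmod : ∀ γ, ∃ z : J, Y (fun i => ((π γ i : ℕ) : ℤ)) = β • Y (fun i => ((γ i : ℕ) : ℤ)) + (L : ℤ) • z := by
    intro γ
    refine ⟨Y (fun i => - ((b.equivFun (β • Y (fun i => ((γ i : ℕ) : ℤ))) i) / (L : ℤ))), ?_⟩
    apply b.equivFun.injective
    ext i
    simp only [map_add, map_smul, Y, LinearEquiv.apply_symm_apply, Pi.add_apply, Pi.smul_apply, smul_eq_mul]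
    rw [hπval]
    have := Int.emod_add_mul_ediv (b.equivFun (β • Y (fun i => ((γ i : ℕ) : ℤ))) i) (L : ℤ)
    simp only [Y] at this ⊢
    linarith
  have hinj : Function.Injective π := by
    intro γ γ' h
    obtain ⟨z, hz⟩ := hmod γ
    obtain ⟨z', hz'⟩ := hmod γ'
    rw [h, hz'] at hz
    have hz2 : ((β • Y (fun i => ((γ' i : ℕ) : ℤ)) + (L : ℤ) • z' : J) : 𝓞 K) = ((β • Y (fun i => ((γ i : ℕ) : ℤ)) + (L : ℤ) • z : J) : 𝓞 K) := by rw [hz]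
    have h3 : Y (fun i => ((γ i : ℕ) : ℤ)) - Y (fun i => ((γ' i : ℕ) : ℤ)) =
        (L : ℤ) • ((p : 𝓞 K) • δ • (z' - z) + q • (Y (fun i => ((γ i : ℕ) : ℤ)) - Y (fun i => ((γ' i : ℕ) : ℤ)))) := by
      apply Subtype.ext
      have hpq' : (p : 𝓞 K) * (β * δ) + q * L = 1 := by
        rw [← hδ]
        simpa using congrArg (fun t : ℤ => (t : 𝓞 K)) hpq
      push_cast
      simp only [Submodule.coe_add, Submodule.coe_smul_of_tower, smul_eq_mul, zsmul_eq_mul, Int.cast_natCast] at hz2 ⊢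
      linear_combination (-(p:𝓞 K) * δ) * hz2 - ((Y (fun i => ((γ i : ℕ) : ℤ)) : 𝓞 K) - Y (fun i => ((γ' i : ℕ) : ℤ))) * hpq'
    ext i
    have h4 := congrFun (congrArg b.equivFun h3) i
    simp only [map_sub, map_smul, Y, LinearEquiv.apply_symm_apply, Pi.sub_apply, Pi.smul_apply, smul_eq_mul] at h4
    have h5 : ((γ i : ℕ) : ℤ) ≡ ((γ' i : ℕ) : ℤ) [ZMOD L] := by
      rw [Int.modEq_comm, Int.modEq_iff_dvd, h4]
      exact dvd_mul_right _ _
    have h6 : (γ i : ℕ) ≡ (γ' i : ℕ) [MOD L] := by exact_mod_cast h5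
    exact Nat.ModEq.eq_of_lt_of_lt h6 (γ i).2 (γ' i).2
  have hbij : Function.Bijective π := Finite.injective_iff_bijective.1 hinj
  set A : (ι → Fin L) → ℂ := fun γ => χ ((Algebra.norm ℤ ((Y (fun i => ((γ i : ℕ) : ℤ)) : J) : 𝓞 K) : ℤ) : ZMod L) with hA
  have hAπ : ∀ γ, A (π γ) = χ ((Algebra.norm ℤ β : ℤ) : ZMod L) * A γ := by
    intro γ
    obtain ⟨z, hz⟩ := hmod γ
    simp only [hA]
    rw [hz]
    have : ((β • Y (fun i => ((γ i : ℕ) : ℤ)) + (L : ℤ) • z : J) : 𝓞 K) =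
      β * (Y (fun i => ((γ i : ℕ) : ℤ)) : 𝓞 K) + (L : 𝓞 K) * z := by
      simp
    rw [this, norm_congr, map_mul, Int.cast_mul, map_mul]
  have hsum : ∑ γ, A γ = χ ((Algebra.norm ℤ β : ℤ) : ZMod L) * ∑ γ, A γ := by
    rw [Finset.mul_sum, ← Finset.sum_congr rfl (fun γ _ => hAπ γ)]
    exact (Equiv.sum_comp (Equiv.ofBijective π hbij) A).symm
  change ∑ γ, A γ = 0
  have : (1 - χ ((Algebra.norm ℤ β : ℤ) : ZMod L)) * ∑ γ, A γ = 0 := by linear_combination hsum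
  rcases mul_eq_zero.1 this with h | h
  · exact absurd (sub_eq_zero.1 h).symm hχ
  · exact h
end CS

namespace CS
open Finset NumberField NumberField.InfinitePlace NumberField.mixedEmbedding NumberField.Units
  NumberField.Units.dirichletUnitTheorem

variable (K : Type*) [Field K] [NumberField K]

/-- log norm functional -/
noncomputable def ellN : (InfinitePlace K → ℝ) →ₗ[ℝ] ℝ :=
  ∑ w : InfinitePlace K, ((w.mult : ℝ)) • LinearMap.proj w

theorem ellN_apply (v : InfinitePlace K → ℝ) : ellN K v = ∑ w, (w.mult : ℝ) * v w := by
  simp [ellN]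

/-- linear version of logMap -/
noncomputable def logD : (InfinitePlace K → ℝ) →ₗ[ℝ] logSpace K :=
  LinearMap.pi fun w => ((w.val.mult : ℝ)) • (LinearMap.proj w.val - (Module.finrank ℚ K : ℝ)⁻¹ • ellN K)

theorem logD_apply (v : InfinitePlace K → ℝ) (w : {w : InfinitePlace K // w ≠ w₀}) :
    logD K v w = w.val.mult * (v w.val - ellN K v * (Module.finrank ℚ K : ℝ)⁻¹) := by
  simp [logD]
  ring_nf

theorem ellN_log (X : mixedSpace K) (hX : mixedEmbedding.norm X ≠ 0) :
    ellN K (fun w => Real.log (normAtPlace w X)) = Real.log (mixedEmbedding.norm X) := by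
  rw [ellN_apply, mixedEmbedding.norm_apply, Real.log_prod]
  · simp
  · intro w _
    rw [mixedEmbedding.norm_apply, Finset.prod_ne_zero_iff] at hX
    exact hX w (Finset.mem_univ _)

theorem logD_log (X : mixedSpace K) (hX : mixedEmbedding.norm X ≠ 0) :
    logD K (fun w => Real.log (normAtPlace w X)) = logMap X := by
  funext w
  rw [logD_apply, ellN_log K X hX, logMap_apply]

theorem ell_inj (v : InfinitePlace K → ℝ) (h1 : ((Real.log 2)⁻¹ • ellN K) v = 0)
    (h2 : ∀ i, (((lbasis K).coord i) ∘ₗ logD K) v = 0) : v = 0 := by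
  have hl : Real.log 2 ≠ 0 := (Real.log_pos one_lt_two).ne'
  have h3 : ellN K v = 0 := by
    simpa [hl] using h1
  have h4 : logD K v = 0 := by
    apply (lbasis K).ext_elem
    intro i
    have := h2 i
    simpa using this
  have h5 : ∀ w : InfinitePlace K, w ≠ w₀ → v w = 0 := by
    intro w hw
    have := congrFun h4 ⟨w, hw⟩
    rw [logD_apply, h3] at this
    simpa [mult_coe_ne_zero] using this
  have h6 : v w₀ = 0 := by
    rw [ellN_apply, Finset.sum_eq_single w₀] at h3
    · simpa [mult_coe_ne_zero] using h3
    · intro w _ hw; rw [h5 w hw, mul_zero]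
    · simp
  funext w
  by_cases hw : w = w₀
  · rw [hw, h6]; rfl
  · exact h5 w hw

open scoped Classical in
theorem place_lip (X Y : mixedSpace K) :
    ‖(fun w : InfinitePlace K => normAtPlace w X) - (fun w => normAtPlace w Y)‖ ≤ ‖X - Y‖ := by
  rw [pi_norm_le_iff_of_nonneg (norm_nonneg _)]
  intro w
  have hle : normAtPlace w (X - Y) ≤ ‖X - Y‖ := by
    rw [norm_eq_sup'_normAtPlace]
    exact Finset.le_sup' (fun w => normAtPlace w (X - Y)) (Finset.mem_univ w)
  have h1 : normAtPlace w X ≤ normAtPlace w (X - Y) + normAtPlace w Y := by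
    have := normAtPlace_add_le w (X - Y) Y
    rwa [sub_add_cancel] at this
  have h2 : normAtPlace w Y ≤ normAtPlace w (X - Y) + normAtPlace w X := by
    have := normAtPlace_add_le w (Y - X) X
    rw [sub_add_cancel] at this
    have h3 : normAtPlace w (Y - X) = normAtPlace w (X - Y) := by
      rw [← neg_sub, normAtPlace_neg]
    rwa [h3] at this
  rw [Pi.sub_apply, Real.norm_eq_abs, abs_le]
  constructor <;> linarith

open scoped Classical in
theorem place_big (X : mixedSpace K) (R : ℝ) (h : R < ‖X‖) : ∃ w : InfinitePlace K, R < normAtPlace w X := by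
  rw [norm_eq_sup'_normAtPlace, Finset.lt_sup'_iff] at h
  obtain ⟨w, _, hw⟩ := h
  exact ⟨w, hw⟩

theorem lattice_map (J : Ideal (𝓞 K)) (hJ : J ≠ ⊥) : ∃ b : Module.Basis (Module.Free.ChooseBasisIndex ℤ (𝓞 K)) ℤ J,
    ∃ E : (Module.Free.ChooseBasisIndex ℤ (𝓞 K) → ℝ) →ₗ[ℝ] mixedSpace K,
    (∀ v : Module.Free.ChooseBasisIndex ℤ (𝓞 K) → ℤ, E (fun i => (v i : ℝ)) =
      mixedEmbedding K (((b.equivFun.symm v : J) : 𝓞 K) : K)) ∧ LinearMap.ker E = ⊥ := by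
  classical
  let b := Ideal.selfBasis (RingOfIntegers.basis K) J hJ
  let E : (Module.Free.ChooseBasisIndex ℤ (𝓞 K) → ℝ) →ₗ[ℝ] mixedSpace K :=
    Fintype.linearCombination ℝ (fun i => mixedEmbedding K ((b i : 𝓞 K) : K))
  have hE : ∀ v : Module.Free.ChooseBasisIndex ℤ (𝓞 K) → ℤ, E (fun i => (v i : ℝ)) =
      mixedEmbedding K (((b.equivFun.symm v : J) : 𝓞 K) : K) := by
    intro v
    rw [Module.Basis.equivFun_symm_apply]
    simp [E, Fintype.linearCombination_apply, Int.cast_smul_eq_zsmul]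
  refine ⟨b, E, hE, ?_⟩
  rw [LinearMap.ker_eq_bot]
  have hfr : Module.finrank ℝ (Module.Free.ChooseBasisIndex ℤ (𝓞 K) → ℝ) = Module.finrank ℝ (mixedSpace K) := by
    rw [Module.finrank_eq_card_basis (latticeBasis K), Module.finrank_fintype_fun_eq_card]
  rw [LinearMap.injective_iff_surjective_of_finrank_eq_finrank hfr, ← LinearMap.range_eq_top, eq_top_iff,
    ← (latticeBasis K).span_eq, Submodule.span_le]
  rintro _ ⟨j, rfl⟩
  have hNJ : Ideal.absNorm J ≠ 0 := by rwa [Ne, Ideal.absNorm_eq_zero_iff]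
  let x : J := ⟨(Ideal.absNorm J : 𝓞 K) * RingOfIntegers.basis K j, J.mul_mem_right _ (Ideal.absNorm_mem J)⟩
  refine ⟨((Ideal.absNorm J : ℝ)⁻¹) • (fun i => ((b.equivFun x i : ℤ) : ℝ)), ?_⟩
  rw [map_smul, hE, LinearEquiv.symm_apply_apply, latticeBasis_apply]
  simp only [x, map_mul, map_natCast]
  rw [← nsmul_eq_mul, ← Nat.cast_smul_eq_nsmul ℝ, smul_smul, inv_mul_cancel₀ (by exact_mod_cast hNJ), one_smul,
    integralBasis_apply]

end CS

namespace CS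
open Finset NumberField NumberField.InfinitePlace NumberField.mixedEmbedding NumberField.Units
  NumberField.Units.dirichletUnitTheorem

variable (K : Type*) [Field K] [NumberField K]

open scoped Classical in
theorem window_J (hpos : ∀ x : 𝓞 K, 0 ≤ Algebra.norm ℤ x) (J : Ideal (𝓞 K)) (hJ : J ≠ ⊥) :
    ∃ C : ℝ, 0 ≤ C ∧ ∀ (L : ℕ), 0 < L → ∀ χ : DirichletCharacter ℂ L, (∃ β : 𝓞 K,
      IsCoprime (Algebra.norm ℤ β) (L : ℤ) ∧ χ ((Algebra.norm ℤ β : ℤ) : ZMod L) ≠ 1) →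
      Nat.Coprime (Ideal.absNorm J) L → ∀ s : ℂ, ‖s‖ ≤ 3 → ∀ i : ℕ, 1 ≤ i →
      L ^ (Module.finrank ℚ K) ≤ 2 ^ i → ∀ S : Finset (Ideal (𝓞 K)),
      (∀ I ∈ S, I ≠ ⊥ ∧ (I * J).IsPrincipal) →
      (∀ I : Ideal (𝓞 K), I ≠ ⊥ → (I * J).IsPrincipal → Ideal.absNorm I ≤ 2 ^ (i + 1) → I ∈ S) →
      ‖∑ I ∈ S, χ (Ideal.absNorm I : ZMod L) * win s (Real.logb 2 (Ideal.absNorm I) - i)‖ ≤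
        C * L * (2 : ℝ) ^ i * ((2 : ℝ) ^ i) ^ (-(Module.finrank ℚ K : ℝ)⁻¹) := by
  set n := Module.finrank ℚ K with hn
  have hn0 : 0 < n := Module.finrank_pos
  obtain ⟨b, E, hE, hEker⟩ := lattice_map K J hJ
  obtain ⟨R, M, hR, hM, hΦ⟩ := phi_exists ((Real.log 2)⁻¹ • ellN K)
    (fun i => ((lbasis K).coord i) ∘ₗ logD K) (ell_inj K)
  obtain ⟨κ, hκ, hanti⟩ := LinearMap.exists_antilipschitzWith E hEker
  let E' := LinearMap.toContinuousLinearMap E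
  set NJ := Ideal.absNorm J with hNJ
  have hNJ0 : 0 < NJ := Nat.pos_of_ne_zero (by rwa [Ne, Ideal.absNorm_eq_zero_iff])
  have hNJr : (0 : ℝ) < NJ := by exact_mod_cast hNJ0
  have hcard : Fintype.card (Module.Free.ChooseBasisIndex ℤ (𝓞 K)) = n := by
    rw [← Module.finrank_eq_card_chooseBasisIndex, RingOfIntegers.rank]
  refine ⟨(M * ‖E'‖) * (3 * (κ * R + 1)) ^ n * NJ, by positivity, ?_⟩
  intro L hL χ ⟨β, hβ1, hβ2⟩ hcop s hs i hi hLi S hS hS2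
  obtain ⟨Φ, hΦ1, hΦ2, hΦ3, hΦ4⟩ := hΦ s hs
  set T : ℝ := ((2 : ℝ) ^ i * NJ) ^ ((n : ℝ)⁻¹) with hT
  have hTpos : 0 < T := by positivity
  have hTn : T ^ n = (2 : ℝ) ^ i * NJ := by
    rw [hT, Real.rpow_inv_natCast_pow (by positivity) hn0.ne']
  have hLT : (L : ℝ) ≤ T := by
    apply le_of_pow_le_pow_left₀ hn0.ne' hTpos.le
    rw [hTn]
    have h1 : (L : ℝ) ^ n ≤ 2 ^ i := by exact_mod_cast hLi
    have h2 : (1 : ℝ) ≤ NJ := by exact_mod_cast hNJ0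
    nlinarith [pow_pos (two_pos : (0:ℝ) < 2) i]
  let y : (Module.Free.ChooseBasisIndex ℤ (𝓞 K) → ℤ) → 𝓞 K := fun v => (b.equivFun.symm v : J)
  have hyinj : Function.Injective y := fun v v' h => b.equivFun.symm.injective (Subtype.ext h)
  have hyJ : ∀ x, x ∈ J ↔ ∃ v, y v = x := by
    intro x
    constructor
    · intro hx
      exact ⟨b.equivFun ⟨x, hx⟩, by simp only [y]; rw [LinearEquiv.symm_apply_apply]⟩
    · rintro ⟨v, rfl⟩
      exact Subtype.prop _
  let F : ℕ → ℂ := fun m => χ (m : ZMod L) * win s (Real.logb 2 m - i)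
  have hF0 : F 0 = 0 := by
    have : win s (Real.logb 2 ((0 : ℕ) : ℝ) - i) = 0 := by
      apply win_zero
      have : (1 : ℝ) ≤ i := by exact_mod_cast hi
      simp [this]
    simp only [F, this, mul_zero]
  have hFS : ∀ I : Ideal (𝓞 K), I ≠ ⊥ → (I * J).IsPrincipal → I ∉ S → F (Ideal.absNorm I) = 0 := by
    intro I hI1 hI2 hI3
    have h4 : 2 ^ (i + 1) < Ideal.absNorm I := by
      by_contra h
      exact hI3 (hS2 I hI1 hI2 (not_lt.1 h))
    have h5 : (i : ℝ) + 1 ≤ Real.logb 2 (Ideal.absNorm I) := by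
      rw [Real.le_logb_iff_rpow_le one_lt_two (by exact_mod_cast (pow_pos two_pos _).trans h4)]
      have : (2 : ℝ) ^ ((i : ℝ) + 1) = ((2 ^ (i + 1) : ℕ) : ℝ) := by
        push_cast
        rw [← Real.rpow_natCast]
        push_cast; rfl
      rw [this]
      exact_mod_cast h4.le
    have : win s (Real.logb 2 (Ideal.absNorm I) - i) = 0 := by
      apply win_zero
      rw [abs_of_nonneg] <;> linarith
    simp only [F, this, mul_zero]
  have hsum := hasSum_class K y hyinj J hJ hyJ F S hS hF0 hFS
  let a : (Module.Free.ChooseBasisIndex ℤ (𝓞 K) → ℤ) → ℂ := fun v => χ ((Algebra.norm ℤ (y v) : ℤ) : ZMod L)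
  let Ψ : (Module.Free.ChooseBasisIndex ℤ (𝓞 K) → ℝ) → ℂ := fun x => Φ (fun w => normAtPlace w (E x))
  have key : ∀ v, a v * Ψ (fun j => (v j : ℝ) / T) = χ (NJ : ZMod L) *
      (F ((Algebra.norm ℤ (y v)).natAbs / Ideal.absNorm J) * (unitW K (mixedEmbedding K (y v : K)) : ℂ)) := by
    intro v
    have hEv : E (fun j => (v j : ℝ) / T) = T⁻¹ • mixedEmbedding K (y v : K) := by
      rw [← hE v, ← map_smul]
      congr 1
      funext j
      simp [div_eq_inv_mul]
    by_cases hv : y v = 0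
    · have h1 : Ψ (fun j => (v j : ℝ) / T) = 0 := by
        simp only [Ψ]
        apply hΦ3 _ w₀
        rw [hEv, hv]
        simp
      rw [h1, hv]
      simp [hF0]
    · have hX0 : mixedEmbedding.norm (mixedEmbedding K (y v : K)) ≠ 0 := mnorm_ne_zero K hv
      set X := mixedEmbedding K (y v : K) with hX
      have hTX : mixedEmbedding.norm (T⁻¹ • X) ≠ 0 := by
        rw [mixedEmbedding.norm_smul]
        positivity
      obtain ⟨m, hm⟩ : NJ ∣ (Algebra.norm ℤ (y v)).natAbs := by
        have := Ideal.absNorm_dvd_norm_of_mem ((hyJ (y v)).2 ⟨v, rfl⟩)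
        exact Int.natCast_dvd.1 this
      have hm0 : m ≠ 0 := by
        rintro rfl
        rw [mul_zero, Int.natAbs_eq_zero, Algebra.norm_eq_zero_iff] at hm
        exact hv hm
      have hnormX : mixedEmbedding.norm X = (NJ : ℝ) * m := by
        rw [hX, norm_eq_norm, ← Algebra.coe_norm_int]
        have : ((Algebra.norm ℤ (y v)).natAbs : ℝ) = NJ * m := by rw [hm]; push_cast; rfl
        rw [← this]
        push_cast
        rw [Nat.cast_natAbs]
        push_cast; rfl
      have hnormTX : mixedEmbedding.norm (T⁻¹ • X) = m / 2 ^ i := by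
        rw [mixedEmbedding.norm_smul, hnormX, abs_of_pos (by positivity), ← hn, inv_pow, hTn]
        field_simp
      have hpl : ∀ w, 0 < normAtPlace w (T⁻¹ • X) := by
        intro w
        refine lt_of_le_of_ne (normAtPlace_nonneg w _) (Ne.symm ?_)
        rw [mixedEmbedding.norm_apply, Finset.prod_ne_zero_iff] at hTX
        exact fun h => hTX w (Finset.mem_univ w) (by rw [h, zero_pow (mult_pos).ne'])
      have h1 : Ψ (fun j => (v j : ℝ) / T) = win s (Real.logb 2 m - i) * (unitW K X : ℂ) := by
        simp only [Ψ]
        rw [hEv, hΦ4 _ hpl]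
        congr 1
        · congr 1
          rw [LinearMap.smul_apply, ellN_log K _ hTX, hnormTX, Real.log_div (by exact_mod_cast hm0) (by positivity),
            Real.log_pow, Real.logb, smul_eq_mul]
          have := (Real.log_pos one_lt_two).ne'
          field_simp
        · congr 1
          rw [unitW]
          apply Finset.prod_congr rfl
          intro j _
          rw [LinearMap.comp_apply, logD_log K _ hTX, logMap_real_smul hX0 (by positivity), Module.Basis.coord_apply]
      have h2 : a v = χ (NJ : ZMod L) * χ (m : ZMod L) := by
        simp only [a]
        rw [← map_mul]
        congr 1
        have : Algebra.norm ℤ (y v) = ((NJ * m : ℕ) : ℤ) := by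
          rw [← hm, Int.natAbs_of_nonneg (hpos _)]
        rw [this]
        push_cast; rfl
      rw [h1, h2, hm, Nat.mul_div_cancel_left _ hNJ0]
      simp only [F]
      ring
  have hlc := lattice_cancel L hL a (fun v => DirichletCharacter.norm_le_one χ _) (by
      intro v w
      simp only [a]
      congr 1
      have : y (fun i => v i + L * w i) = y v + (L : 𝓞 K) * y w := by
        have h1 : (fun i => v i + L * w i) = v + (L : ℤ) • w := by
          funext i; simp
        simp only [y]
        rw [h1, map_add, map_smul]
        simp
      rw [this, norm_congr]) (mean_zero K J b L hL χ β hβ1 hβ2) Ψ (M * ‖E'‖) (κ * R) (by positivity) (by positivity)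
      (by
        intro x x'
        refine (hΦ1 _ _).trans ?_
        rw [mul_assoc]
        refine mul_le_mul_of_nonneg_left ?_ hM
        refine (place_lip K _ _).trans ?_
        rw [← map_sub]
        exact E'.le_opNorm _)
      (by
        intro x hx
        have h1 : ‖x‖ ≤ κ * ‖E x‖ := by
          have := hanti.le_mul_dist x 0
          simpa using this
        obtain ⟨w, hw⟩ := place_big K (E x) R (by
          have h2 := hx.trans_le h1
          exact lt_of_mul_lt_mul_left h2 κ.coe_nonneg)
        exact hΦ2 _ w hw) T hLT
  rw [tsum_congr key, tsum_mul_left, hsum.tsum_eq, hcard, norm_mul, norm_mul] at hlc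
  have hu : ‖χ (NJ : ZMod L)‖ = 1 := by
    have : IsUnit (NJ : ZMod L) := (ZMod.isUnit_iff_coprime NJ L).2 hcop
    obtain ⟨u, hu⟩ := this
    rw [← hu]
    exact DirichletCharacter.unit_norm_eq_one χ u
  rw [hu, one_mul, Complex.norm_natCast] at hlc
  have h1 : (1 : ℝ) ≤ torsionOrder K := by exact_mod_cast torsionOrder_pos K
  have h2 := (le_mul_of_one_le_left (norm_nonneg (∑ I ∈ S, F (Ideal.absNorm I))) h1).trans hlc
  refine h2.trans ?_
  rw [hTn]
  have h3 : 1 / T ≤ ((2 : ℝ) ^ i) ^ (-(n : ℝ)⁻¹) := by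
    rw [Real.rpow_neg (by positivity), one_div]
    apply inv_anti₀ (by positivity)
    rw [hT]
    apply Real.rpow_le_rpow (by positivity) _ (by positivity)
    have h2 : (1 : ℝ) ≤ NJ := by exact_mod_cast hNJ0
    nlinarith [pow_pos (two_pos : (0:ℝ) < 2) i]
  calc M * ‖E'‖ * (3 * (κ * R + 1)) ^ n * L / T * (2 ^ i * NJ)
      = (M * ‖E'‖ * (3 * (κ * R + 1)) ^ n * NJ * L * 2 ^ i) * (1 / T) := by ring
    _ ≤ (M * ‖E'‖ * (3 * (κ * R + 1)) ^ n * NJ * L * 2 ^ i) * ((2 : ℝ) ^ i) ^ (-(n : ℝ)⁻¹) := by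
        apply mul_le_mul_of_nonneg_left h3; positivity
end CS

namespace CS
open Finset NumberField

/-- number of ideals of given norm -/
noncomputable def rK (K : Type*) [Field K] [NumberField K] (m : ℕ) : ℕ :=
  Nat.card {I : Ideal (𝓞 K) // Ideal.absNorm I = m}

variable (K : Type*) [Field K] [NumberField K]

theorem finite_norm_eq (m : ℕ) : {I : Ideal (𝓞 K) | Ideal.absNorm I = m}.Finite :=
  (Ideal.finite_setOfPred_absNorm_le m).subset (fun _ h => le_of_eq h)

theorem rK_eq_card (m : ℕ) : rK K m = (finite_norm_eq K m).toFinset.card := by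
  rw [rK, ← Set.ncard_eq_toFinset_card _ (finite_norm_eq K m)]
  rfl

/-- nonzero ideals of norm at most `B` -/
noncomputable def idealsLE (B : ℕ) : Finset (Ideal (𝓞 K)) := by
  classical
  exact (Ideal.finite_setOfPred_absNorm_le (S := 𝓞 K) B).toFinset.filter (· ≠ ⊥)

theorem mem_idealsLE {B : ℕ} {I : Ideal (𝓞 K)} : I ∈ idealsLE K B ↔ Ideal.absNorm I ≤ B ∧ I ≠ ⊥ := by
  simp [idealsLE]

theorem sum_ideals (B : ℕ) (F : ℕ → ℂ) (hF : F 0 = 0) :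
    ∑ m ∈ Finset.range (B + 1), (rK K m : ℂ) * F m = ∑ I ∈ idealsLE K B, F (Ideal.absNorm I) := by
  classical
  rw [← Finset.sum_fiberwise_of_maps_to (s := idealsLE K B) (t := Finset.range (B + 1))
    (g := fun I => Ideal.absNorm I)]
  · apply Finset.sum_congr rfl
    intro m hm
    by_cases h0 : m = 0
    · subst h0
      rw [hF, mul_zero, Finset.sum_eq_zero]
      intro I hI
      rw [(Finset.mem_filter.1 hI).2, hF]
    · have h1 : (idealsLE K B).filter (fun I => Ideal.absNorm I = m) = (finite_norm_eq K m).toFinset := by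
        ext I
        rw [Finset.mem_filter, mem_idealsLE, Set.Finite.mem_toFinset, Set.mem_ofPred_eq]
        constructor
        · exact fun h => h.2
        · intro h
          refine ⟨⟨?_, ?_⟩, h⟩
          · rw [h]; exact Nat.lt_succ_iff.1 (Finset.mem_range.1 hm)
          · rintro rfl
            apply h0
            rw [← h]; simp
      rw [h1, Finset.sum_congr rfl (g := fun _ => F m), Finset.sum_const, rK_eq_card, nsmul_eq_mul]
      intro I hI
      rw [Set.Finite.mem_toFinset, Set.mem_ofPred_eq] at hI
      rw [hI]
  · intro I hI
    rw [mem_idealsLE] at hI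
    simp; omega

theorem window_all (hpos : ∀ x : 𝓞 K, 0 ≤ Algebra.norm ℤ x) :
    ∃ (C : ℝ) (N1 : ℕ), 0 ≤ C ∧ 0 < N1 ∧ ∀ (L : ℕ), 0 < L → ∀ χ : DirichletCharacter ℂ L, (∃ β : 𝓞 K,
      IsCoprime (Algebra.norm ℤ β) (L : ℤ) ∧ χ ((Algebra.norm ℤ β : ℤ) : ZMod L) ≠ 1) →
      Nat.Coprime N1 L → ∀ s : ℂ, ‖s‖ ≤ 3 → ∀ i : ℕ, 1 ≤ i →
      L ^ (Module.finrank ℚ K) ≤ 2 ^ i →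
      ‖∑ m ∈ Finset.range (2 ^ (i + 1) + 1), (rK K m : ℂ) * (χ (m : ZMod L) * win s (Real.logb 2 m - i))‖ ≤
        C * L * (2 : ℝ) ^ i * ((2 : ℝ) ^ i) ^ (-(Module.finrank ℚ K : ℝ)⁻¹) := by
  classical
  have hJ : ∀ c : ClassGroup (𝓞 K), ∃ J : nonZeroDivisors (Ideal (𝓞 K)), ClassGroup.mk0 J = c :=
    fun c => ClassGroup.mk0_surjective c
  choose J hJ using hJ
  have hJ0 : ∀ c, (J c : Ideal (𝓞 K)) ≠ ⊥ := fun c => nonZeroDivisors.ne_zero (J c).2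
  choose C hC hw using fun c => window_J K hpos (J c) (hJ0 c)
  refine ⟨∑ c, C c, ∏ c, Ideal.absNorm (J c : Ideal (𝓞 K)), Finset.sum_nonneg fun c _ => hC c,
    Finset.prod_pos fun c _ => Nat.pos_of_ne_zero (by rw [Ne, Ideal.absNorm_eq_zero_iff]; exact hJ0 c), ?_⟩
  intro L hL χ hβ hcop s hs i hi hLi
  have hF0 : (χ ((0 : ℕ) : ZMod L) * win s (Real.logb 2 (0 : ℕ) - i)) = 0 := by
    have : win s (Real.logb 2 ((0 : ℕ) : ℝ) - i) = 0 := by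
      apply win_zero
      have : (1 : ℝ) ≤ i := by exact_mod_cast hi
      simp [this]
    rw [this, mul_zero]
  rw [sum_ideals K _ (fun m => χ (m : ZMod L) * win s (Real.logb 2 m - i)) hF0]
  let S : ClassGroup (𝓞 K) → Finset (Ideal (𝓞 K)) := fun c =>
    (idealsLE K (2 ^ (i + 1))).filter (fun I => (I * (J c : Ideal (𝓞 K))).IsPrincipal)
  have hprin : ∀ I : Ideal (𝓞 K), ∀ hI : I ≠ ⊥, ∀ c, (I * (J c : Ideal (𝓞 K))).IsPrincipal ↔
      (ClassGroup.mk0 ⟨I, mem_nonZeroDivisors_of_ne_zero hI⟩)⁻¹ = c := by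
    intro I hI c
    have h1 := ClassGroup.mk0_eq_one_iff (I := I * (J c : Ideal (𝓞 K)))
      (mem_nonZeroDivisors_of_ne_zero (mul_ne_zero hI (hJ0 c)))
    rw [← h1]
    have h2 : (⟨I * (J c : Ideal (𝓞 K)), mem_nonZeroDivisors_of_ne_zero (mul_ne_zero hI (hJ0 c))⟩ :
      nonZeroDivisors (Ideal (𝓞 K))) = ⟨I, mem_nonZeroDivisors_of_ne_zero hI⟩ * J c := rfl
    rw [h2, map_mul, hJ, mul_eq_one_iff_inv_eq]
  have hsplit : ∑ I ∈ idealsLE K (2 ^ (i + 1)), (χ (Ideal.absNorm I : ZMod L) * win s (Real.logb 2 (Ideal.absNorm I) - i)) =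
      ∑ c, ∑ I ∈ S c, (χ (Ideal.absNorm I : ZMod L) * win s (Real.logb 2 (Ideal.absNorm I) - i)) := by
    simp only [S, Finset.sum_filter]
    rw [Finset.sum_comm]
    apply Finset.sum_congr rfl
    intro I hI
    have hI0 := ((mem_idealsLE K).1 hI).2
    rw [Finset.sum_eq_single (ClassGroup.mk0 ⟨I, mem_nonZeroDivisors_of_ne_zero hI0⟩)⁻¹]
    · rw [if_pos ((hprin I hI0 _).2 rfl)]
    · intro c _ hc
      rw [if_neg]
      rw [hprin I hI0]
      exact fun h => hc h.symm
    · simp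
  rw [hsplit]
  refine (norm_sum_le _ _).trans ?_
  simp only [Finset.sum_mul]
  apply Finset.sum_le_sum
  intro c _
  refine hw c L hL χ hβ (hcop.coprime_dvd_left (Finset.dvd_prod_of_mem (fun c => Ideal.absNorm (J c : Ideal (𝓞 K))) (Finset.mem_univ c))) s hs i hi hLi (S c) ?_ ?_
  · intro I hI
    rw [Finset.mem_filter, mem_idealsLE] at hI
    exact ⟨hI.1.2, hI.2⟩
  · intro I h1 h2 h3
    rw [Finset.mem_filter, mem_idealsLE]
    exact ⟨⟨h3, h1⟩, h2⟩
end CS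

namespace CS
open Finset NumberField

variable (K : Type*) [Field K] [NumberField K]

/-- a prime having a degree one prime above it -/
def Good (p : ℕ) : Prop := p.Prime ∧ ∃ P : Ideal (𝓞 K), Ideal.absNorm P = p

theorem good_int {q : ℕ} (hq : q.Prime) (P : Ideal (𝓞 K)) (hP : Ideal.absNorm P = q) (x : 𝓞 K) :
    ∃ a : ℤ, x - a ∈ P := by
  have : Fact q.Prime := ⟨hq⟩
  have hcard : Nat.card (𝓞 K ⧸ P) = q := by
    rw [← hP, Ideal.absNorm_apply, Submodule.cardQuot_apply]
  have h1 : (1 : 𝓞 K ⧸ P) ≠ 0 := by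
    intro h
    have : P = ⊤ := by
      rw [Ideal.eq_top_iff_one, ← Ideal.Quotient.eq_zero_iff_mem]
      simpa using h
    rw [this, Ideal.absNorm_top] at hP
    exact hq.one_lt.ne hP
  have h2 := mem_zmultiples_of_prime_card hcard h1 (g' := Ideal.Quotient.mk P x)
  obtain ⟨a, ha⟩ := AddSubgroup.mem_zmultiples_iff.1 h2
  refine ⟨a, ?_⟩
  rw [← Ideal.Quotient.eq_zero_iff_mem, map_sub, ← ha]
  simp

theorem good_dvd {q : ℕ} (hq : q.Prime) (P : Ideal (𝓞 K)) (hP : Ideal.absNorm P = q) (m : ℤ)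
    (hm : (m : 𝓞 K) ∈ P) : (q : ℤ) ∣ m := by
  by_contra h
  have hc : IsCoprime (q : ℤ) m := (Nat.prime_iff_prime_int.1 hq).coprime_iff_not_dvd.2 h
  obtain ⟨u, v, huv⟩ := hc
  have h1 : (1 : 𝓞 K) ∈ P := by
    have hqP := Ideal.absNorm_mem P
    rw [hP] at hqP
    have h2 : (1 : 𝓞 K) = (u : 𝓞 K) * q + v * m := by
      simpa using (congrArg (fun t : ℤ => (t : 𝓞 K)) huv).symm
    rw [h2]
    exact P.add_mem (P.mul_mem_left _ hqP) (P.mul_mem_left _ hm)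
  rw [(Ideal.eq_top_iff_one P).2 h1, Ideal.absNorm_top] at hP
  exact hq.one_lt.ne hP

set_option maxHeartbeats 1000000 in
theorem norm_surj [IsGalois ℚ K] : ∃ N0 : ℕ, ∀ Q : Finset ℕ, (∀ q ∈ Q, Good K q ∧ N0 < q) → ∀ a : ℤ,
    ∃ β : 𝓞 K, ((∏ q ∈ Q, q : ℕ) : ℤ) ∣ Algebra.norm ℤ β - a := by
  classical
  obtain ⟨act, hact, hactinj⟩ : ∃ act : Gal(K/ℚ) → (𝓞 K →+* 𝓞 K),
      (∀ σ (β : 𝓞 K), ((act σ β : 𝓞 K) : K) = σ (β : K)) ∧ Function.Injective act := by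
    refine ⟨fun σ => (galRestrict ℤ ℚ K (𝓞 K) σ : 𝓞 K →+* 𝓞 K), fun σ β => algebraMap_galRestrict_apply ℤ σ β, ?_⟩
    intro σ τ h
    apply (galRestrict ℤ ℚ K (𝓞 K)).injective
    ext x
    exact congrArg (fun t : 𝓞 K => (t : K)) (RingHom.congr_fun h x)
  have hx : ∀ σ τ : Gal(K/ℚ), ∃ x : 𝓞 K, σ ≠ τ → act σ x ≠ act τ x := by
    intro σ τ
    by_cases h : σ = τ
    · exact ⟨0, fun h' => absurd h h'⟩
    · have h1 : act σ ≠ act τ := fun h' => h (hactinj h')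
      by_contra hcon
      push Not at hcon
      exact h1 (RingHom.ext fun x => (hcon x).2)
  choose x hx using hx
  obtain ⟨D, hD, hDdvd⟩ : ∃ D : 𝓞 K, D ≠ 0 ∧ ∀ σ τ : Gal(K/ℚ), σ ≠ τ →
      (act σ (x σ τ) - act τ (x σ τ)) ∣ D := by
    refine ⟨∏ p ∈ (Finset.univ : Finset (Gal(K/ℚ) × Gal(K/ℚ))).filter (fun p => p.1 ≠ p.2),
      (act p.1 (x p.1 p.2) - act p.2 (x p.1 p.2)), ?_, ?_⟩
    · rw [Finset.prod_ne_zero_iff]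
      intro p hp
      exact sub_ne_zero.2 (hx _ _ (Finset.mem_filter.1 hp).2)
    · intro σ τ hst
      exact Finset.dvd_prod_of_mem (fun p : Gal(K/ℚ) × Gal(K/ℚ) => (act p.1 (x p.1 p.2) - act p.2 (x p.1 p.2)))
          (Finset.mem_filter.2 ⟨Finset.mem_univ (σ, τ), hst⟩)
  refine ⟨(Algebra.norm ℤ D).natAbs, ?_⟩
  intro Q hQ a
  have hP : ∀ q : ℕ, ∃ P : Ideal (𝓞 K), q ∈ Q → Ideal.absNorm P = q := by
    intro q
    by_cases h : q ∈ Q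
    · obtain ⟨P, hP⟩ := (hQ q h).1.2
      exact ⟨P, fun _ => hP⟩
    · exact ⟨⊥, fun h' => absurd h' h⟩
  choose P hP using hP
  have hprime : ∀ q ∈ Q, (P q).IsPrime := fun q hq =>
    Ideal.isPrime_of_irreducible_absNorm (by rw [hP q hq]; exact (hQ q hq).1.1)
  let I : ℕ × Gal(K/ℚ) → Ideal (𝓞 K) := fun p => (P p.1).comap (act p.2)
  have hqI : ∀ q ∈ Q, ∀ σ, (q : 𝓞 K) ∈ I (q, σ) := by
    intro q hq σ
    rw [Ideal.mem_comap, map_natCast]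
    have := Ideal.absNorm_mem (P q)
    rwa [hP q hq] at this
  have hmem : ∀ q σ y, y ∈ I (q, σ) ↔ act σ y ∈ P q := fun q σ y => Iff.rfl
  have hIprime : ∀ p ∈ Q ×ˢ (Finset.univ : Finset Gal(K/ℚ)), Prime (I p) := by
    rintro ⟨q, σ⟩ hp
    have hq := (Finset.mem_product.1 hp).1
    have := hprime q hq
    have h1 : (I (q, σ)).IsPrime := Ideal.comap_isPrime _ _
    apply Ideal.prime_of_isPrime _ h1
    intro hbot
    have := hqI q hq σ
    rw [hbot, Ideal.mem_bot] at this
    exact (hQ q hq).1.1.ne_zero (by exact_mod_cast this)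
  have hdist : ∀ p ∈ Q ×ˢ (Finset.univ : Finset Gal(K/ℚ)), ∀ p' ∈ Q ×ˢ (Finset.univ : Finset Gal(K/ℚ)),
      p ≠ p' → I p ≠ I p' := by
    rintro ⟨q, σ⟩ hp ⟨q', τ⟩ hp' hne heq
    have hq := (Finset.mem_product.1 hp).1
    have hq' := (Finset.mem_product.1 hp').1
    have hqq : q = q' := by
      have h1 := hqI q' hq' τ
      rw [← heq, hmem, map_natCast] at h1
      have h2 := good_dvd K (hQ q hq).1.1 (P q) (hP q hq) q' (by exact_mod_cast h1)
      exact (Nat.prime_dvd_prime_iff_eq (hQ q hq).1.1 (hQ q' hq').1.1).1 (by exact_mod_cast h2)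
    subst hqq
    have hst : σ ≠ τ := fun h => hne (by rw [h])
    obtain ⟨c, hc⟩ := good_int K (hQ q hq).1.1 (P q) (hP q hq) (act σ (x σ τ))
    have h1 : x σ τ - c ∈ I (q, σ) := by
      rw [hmem, map_sub, map_intCast]; exact hc
    rw [heq, hmem, map_sub, map_intCast] at h1
    have h2 : act σ (x σ τ) - act τ (x σ τ) ∈ P q := by
      have := (P q).sub_mem hc h1
      simpa using this
    have h3 : D ∈ P q := by
      exact (P q).mem_of_dvd (hDdvd σ τ hst) h2
    have h4 := Ideal.absNorm_dvd_norm_of_mem h3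
    rw [hP q hq] at h4
    have h5 := Nat.le_of_dvd (Int.natAbs_pos.2 (by rwa [Ne, Algebra.norm_eq_zero_iff])) (Int.natCast_dvd.1 h4)
    exact absurd (hQ q hq).2 (not_lt.2 h5)
  obtain ⟨β, hβ⟩ := IsDedekindDomain.exists_forall_sub_mem_ideal I (fun _ => 1) hIprime hdist
    (fun p => if p.1.2 = 1 then (a : 𝓞 K) else 1)
  refine ⟨β, ?_⟩
  have hnorm : ((Algebra.norm ℤ β : ℤ) : 𝓞 K) = ∏ σ : Gal(K/ℚ), act σ β := by
    apply RingOfIntegers.ext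
    have h1 := Algebra.norm_eq_prod_automorphisms ℚ (β : K)
    rw [← Algebra.coe_norm_int] at h1
    have h2 : ((∏ σ : Gal(K/ℚ), act σ β : 𝓞 K) : K) = ∏ σ : Gal(K/ℚ), ((act σ β : 𝓞 K) : K) :=
      map_prod (algebraMap (𝓞 K) K) _ _
    rw [h2]
    simp only [hact]
    rw [← h1]
    simp
  push_cast
  apply Finset.prod_dvd_of_coprime
  · intro q hq q' hq' hne
    have h := (Nat.coprime_primes (hQ q hq).1.1 (hQ q' hq').1.1).2 hne
    exact Nat.isCoprime_iff_coprime.2 h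
  · intro q hq
    apply good_dvd K (hQ q hq).1.1 (P q) (hP q hq)
    push_cast
    rw [hnorm, ← Ideal.Quotient.eq_zero_iff_mem, map_sub, map_prod]
    have hσ : ∀ σ : Gal(K/ℚ), Ideal.Quotient.mk (P q) (act σ β) =
        if σ = 1 then Ideal.Quotient.mk (P q) (a : 𝓞 K) else 1 := by
      intro σ
      have h1 := hβ (q, σ) (Finset.mem_product.2 ⟨hq, Finset.mem_univ _⟩)
      rw [pow_one, hmem, map_sub] at h1
      have h2 := Ideal.Quotient.eq.2 h1
      rw [h2]
      by_cases h : σ = 1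
      · simp [h]
      · simp [h]
    rw [Finset.prod_congr rfl (fun σ _ => hσ σ), Finset.prod_ite_eq' Finset.univ (1 : Gal(K/ℚ)), if_pos (Finset.mem_univ _), sub_self]
end CS

namespace CS
open Finset NumberField UniqueFactorizationMonoid

variable (K : Type*) [Field K] [NumberField K]

open scoped Classical in
/-- ideal von Mangoldt function -/
noncomputable def vM (A : Ideal (𝓞 K)) : ℝ :=
  if h : ∃ (P : Ideal (𝓞 K)), Prime P ∧ ∃ m : ℕ, 0 < m ∧ A = P ^ m then
    Real.log (Ideal.absNorm h.choose) else 0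

theorem prime_pow_inj {P Q : Ideal (𝓞 K)} (hP : Prime P) (hQ : Prime Q) {m k : ℕ} (hm : 0 < m)
    (h : P ^ m = Q ^ k) : P = Q := by
  have h1 : P ∣ Q ^ k := h ▸ dvd_pow_self P hm.ne'
  exact associated_iff_eq.1 (hP.associated_of_dvd hQ (hP.dvd_of_dvd_pow h1))

theorem absNorm_prime_ge {P : Ideal (𝓞 K)} (hP : Prime P) : 2 ≤ Ideal.absNorm P := by
  have h0 : Ideal.absNorm P ≠ 0 := by
    rw [Ne, Ideal.absNorm_eq_zero_iff]; exact hP.ne_zero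
  have h1 : Ideal.absNorm P ≠ 1 := by
    rw [Ne, Ideal.absNorm_eq_one_iff]
    rintro rfl
    exact hP.not_isUnit (by simp)
  omega

theorem vM_pow {P : Ideal (𝓞 K)} (hP : Prime P) {m : ℕ} (hm : 0 < m) :
    vM K (P ^ m) = Real.log (Ideal.absNorm P) := by
  have h : ∃ (P' : Ideal (𝓞 K)), Prime P' ∧ ∃ k : ℕ, 0 < k ∧ P ^ m = P' ^ k := ⟨P, hP, m, hm, rfl⟩
  rw [vM, dif_pos h]
  obtain ⟨k, hk, he⟩ := h.choose_spec.2
  rw [← prime_pow_inj K hP h.choose_spec.1 hm he]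

theorem vM_ne {A : Ideal (𝓞 K)} (h : vM K A ≠ 0) :
    ∃ P : Ideal (𝓞 K), Prime P ∧ ∃ m : ℕ, 0 < m ∧ A = P ^ m := by
  by_contra hc
  exact h (by rw [vM, dif_neg hc])

theorem vM_nonneg (A : Ideal (𝓞 K)) : 0 ≤ vM K A := by
  rw [vM]; split_ifs
  · exact Real.log_natCast_nonneg _
  · exact le_rfl

theorem vM_le (A : Ideal (𝓞 K)) : vM K A ≤ Real.log (Ideal.absNorm A) := by
  by_cases h : vM K A = 0
  · rw [h]; exact Real.log_natCast_nonneg _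
  · obtain ⟨P, hP, m, hm, rfl⟩ := vM_ne K h
    rw [vM_pow K hP hm]
    have h2 := absNorm_prime_ge K hP
    apply Real.log_le_log
    · exact_mod_cast (by omega)
    · rw [map_pow]
      exact_mod_cast Nat.le_self_pow hm.ne' _

open scoped Classical in
theorem sum_vM (n : ℕ) (I : Ideal (𝓞 K)) (hI : I ≠ ⊥) (hn : Ideal.absNorm I ≤ n) :
    ∑ A ∈ (idealsLE K n).filter (fun A => A ∣ I), vM K A = Real.log (Ideal.absNorm I) := by
  classical
  have hdvd : ∀ P : Ideal (𝓞 K), Prime P → ∀ m : ℕ, P ^ m ∣ I ↔ m ≤ (normalizedFactors I).count P := by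
    intro P hP m
    rw [pow_dvd_iff_le_emultiplicity, emultiplicity_eq_count_normalizedFactors hP.irreducible hI,
      normalize_eq]
    exact_mod_cast Iff.rfl
  let F : Finset (Σ _ : Ideal (𝓞 K), ℕ) := (normalizedFactors I).toFinset.sigma
    (fun P => Finset.Icc 1 ((normalizedFactors I).count P))
  have hF : ∀ x ∈ F, Prime x.1 ∧ 0 < x.2 ∧ x.1 ^ x.2 ∣ I := by
    rintro ⟨P, m⟩ hx
    rw [Finset.mem_sigma, Multiset.mem_toFinset, Finset.mem_Icc] at hx
    have hP := prime_of_normalized_factor P hx.1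
    exact ⟨hP, hx.2.1, (hdvd P hP m).2 hx.2.2⟩
  have hinj : Set.InjOn (fun x : (Σ _ : Ideal (𝓞 K), ℕ) => x.1 ^ x.2) (F : Set (Σ _ : Ideal (𝓞 K), ℕ)) := by
    rintro ⟨P, m⟩ hx ⟨Q, k⟩ hy h
    have hx' := hF _ hx
    have hy' := hF _ hy
    simp only at h hx' hy'
    have := prime_pow_inj K hx'.1 hy'.1 hx'.2.1 h
    subst this
    have := pow_injective_of_not_isUnit hx'.1.not_isUnit hx'.1.ne_zero h
    simp [this]
  have h1 : ∑ A ∈ F.image (fun x => x.1 ^ x.2), vM K A =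
      ∑ A ∈ (idealsLE K n).filter (fun A => A ∣ I), vM K A := by
    apply Finset.sum_subset
    · intro A hA
      obtain ⟨x, hx, rfl⟩ := Finset.mem_image.1 hA
      obtain ⟨hP, hm, hd⟩ := hF x hx
      rw [Finset.mem_filter, mem_idealsLE]
      refine ⟨⟨?_, pow_ne_zero _ hP.ne_zero⟩, hd⟩
      exact (Nat.le_of_dvd (Nat.pos_of_ne_zero (by rwa [Ne, Ideal.absNorm_eq_zero_iff])) (map_dvd _ hd)).trans hn
    · intro A hA hA'
      by_contra h
      obtain ⟨P, hP, m, hm, rfl⟩ := vM_ne K h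
      apply hA'
      rw [Finset.mem_image]
      refine ⟨⟨P, m⟩, ?_, rfl⟩
      have hd := (hdvd P hP m).1 (Finset.mem_filter.1 hA).2
      rw [Finset.mem_sigma, Multiset.mem_toFinset, Finset.mem_Icc]
      exact ⟨Multiset.count_pos.1 (lt_of_lt_of_le hm hd), hm, hd⟩
  rw [← h1, Finset.sum_image hinj]
  rw [Finset.sum_congr rfl (fun x hx => vM_pow K (hF x hx).1 (hF x hx).2.1), Finset.sum_sigma]
  have h2 : Ideal.absNorm I = ∏ P ∈ (normalizedFactors I).toFinset,
      Ideal.absNorm P ^ ((normalizedFactors I).count P) := by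
    conv_lhs => rw [← associated_iff_eq.1 (prod_normalizedFactors hI)]
    rw [Finset.prod_multiset_count, map_prod]
    simp
  rw [h2]
  push_cast
  rw [Real.log_prod]
  · apply Finset.sum_congr rfl
    intro P hP
    simp
  · intro P hP
    have := absNorm_prime_ge K (prime_of_normalized_factor P (Multiset.mem_toFinset.1 hP))
    positivity

/-- von Mangoldt function of the number field -/
noncomputable def lamK (n : ℕ) : ℝ := ∑ A ∈ (finite_norm_eq K n).toFinset, vM K A

theorem mem_fn {n : ℕ} {A : Ideal (𝓞 K)} : A ∈ (finite_norm_eq K n).toFinset ↔ Ideal.absNorm A = n := by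
  simp

theorem lamK_nonneg (n : ℕ) : 0 ≤ lamK K n := Finset.sum_nonneg fun _ _ => vM_nonneg K _

theorem lamK_le (n : ℕ) : lamK K n ≤ rK K n * Real.log n := by
  rw [lamK, rK_eq_card, ← nsmul_eq_mul]
  apply Finset.sum_le_card_nsmul
  intro A hA
  rw [mem_fn] at hA
  rw [← hA]; exact vM_le K A

theorem rK_one : rK K 1 = 1 := by
  rw [rK_eq_card, Finset.card_eq_one]
  refine ⟨⊤, ?_⟩
  ext A
  rw [mem_fn, Finset.mem_singleton, Ideal.absNorm_eq_one_iff]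

theorem conv_K (n : ℕ) (hn : n ≠ 0) :
    ∑ x ∈ n.divisorsAntidiagonal, (rK K x.1 : ℝ) * lamK K x.2 = rK K n * Real.log n := by
  classical
  have hR : (rK K n : ℝ) * Real.log n = ∑ I ∈ (finite_norm_eq K n).toFinset,
      ∑ A ∈ (idealsLE K n).filter (fun A => A ∣ I), vM K A := by
    rw [rK_eq_card, ← nsmul_eq_mul, ← Finset.sum_const]
    apply Finset.sum_congr rfl
    intro I hI
    rw [mem_fn] at hI
    rw [sum_vM K n I, hI]
    · rintro rfl
      simp at hI; exact hn hI.symm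
    · exact hI.le
  rw [hR]
  simp_rw [Finset.sum_filter]
  rw [Finset.sum_comm]
  have hc : ∀ A ∈ idealsLE K n, (∑ I ∈ (finite_norm_eq K n).toFinset, if A ∣ I then vM K A else 0)
      = if Ideal.absNorm A ∣ n then (rK K (n / Ideal.absNorm A) : ℝ) * vM K A else 0 := by
    intro A hA
    rw [mem_idealsLE] at hA
    have hA0 : Ideal.absNorm A ≠ 0 := by rw [Ne, Ideal.absNorm_eq_zero_iff]; exact hA.2
    rw [← Finset.sum_filter, Finset.sum_const, nsmul_eq_mul]
    split_ifs with hd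
    · congr 2
      rw [rK_eq_card]
      symm
      apply Finset.card_bij (fun J _ => A * J)
      · intro J hJ
        rw [mem_fn] at hJ
        rw [Finset.mem_filter, mem_fn, map_mul, hJ]
        exact ⟨Nat.mul_div_cancel' hd, dvd_mul_right _ _⟩
      · intro J _ J' _ h
        exact mul_left_cancel₀ hA.2 h
      · intro I hI
        rw [Finset.mem_filter, mem_fn] at hI
        obtain ⟨hI1, J, rfl⟩ := hI
        refine ⟨J, ?_, rfl⟩
        rw [mem_fn, ← hI1, map_mul, Nat.mul_div_cancel_left _ (Nat.pos_of_ne_zero hA0)]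
    · rw [Finset.filter_eq_empty_iff.2]
      · simp
      · intro I hI hdI
        rw [mem_fn] at hI
        exact hd (hI ▸ map_dvd _ hdI)
  rw [Finset.sum_congr rfl hc, ← Finset.sum_filter]
  rw [← Finset.sum_fiberwise_of_maps_to (t := n.divisors) (g := fun A => Ideal.absNorm A)]
  · rw [Nat.sum_divisorsAntidiagonal' (f := fun a b => (rK K a : ℝ) * lamK K b)]
    apply Finset.sum_congr rfl
    intro b hb
    have hbd := Nat.dvd_of_mem_divisors hb
    rw [lamK, Finset.mul_sum]
    apply Finset.sum_congr_of_eq_on_inter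
    · intro A hA hA'
      exfalso; apply hA'
      rw [mem_fn] at hA
      rw [Finset.mem_filter, Finset.mem_filter, mem_idealsLE, hA]
      refine ⟨⟨⟨Nat.le_of_dvd (Nat.pos_of_ne_zero hn) hbd, ?_⟩, hbd⟩, rfl⟩
      rintro rfl
      rw [Ideal.absNorm_bot] at hA
      rw [← hA] at hbd
      exact hn (Nat.eq_zero_of_zero_dvd hbd)
    · intro A hA hA'
      exfalso; apply hA'
      rw [mem_fn]; exact (Finset.mem_filter.1 hA).2
    · intro A hA _
      rw [mem_fn] at hA
      rw [hA]
  · intro A hA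
    rw [Nat.mem_divisors]
    exact ⟨(Finset.mem_filter.1 hA).2, hn⟩

theorem lamK_ne {n : ℕ} (h : lamK K n ≠ 0) :
    ∃ P : Ideal (𝓞 K), Prime P ∧ ∃ m : ℕ, 0 < m ∧ n = Ideal.absNorm P ^ m := by
  obtain ⟨A, hA, hA'⟩ := Finset.exists_ne_zero_of_sum_ne_zero h
  rw [mem_fn] at hA
  obtain ⟨P, hP, m, hm, rfl⟩ := vM_ne K hA'
  exact ⟨P, hP, m, hm, by rw [← hA, map_pow]⟩

theorem absNorm_prime_pow {P : Ideal (𝓞 K)} (hP : Prime P) :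
    ∃ p f : ℕ, p.Prime ∧ 0 < f ∧ Ideal.absNorm P = p ^ f ∧ (p : 𝓞 K) ∈ P := by
  have hPr := Ideal.isPrime_of_prime hP
  have h2 := absNorm_prime_ge K hP
  obtain ⟨p, hp, hpP⟩ : ∃ p : ℕ, p.Prime ∧ (p : 𝓞 K) ∈ P := by
    have h := Ideal.absNorm_mem P
    rw [← Nat.prod_primeFactorsList (n := Ideal.absNorm P) (by omega)] at h
    rw [Nat.cast_list_prod, ← Ideal.Quotient.eq_zero_iff_mem, map_list_prod, List.prod_eq_zero_iff,
      List.map_map] at h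
    obtain ⟨p, hp, hpP⟩ := List.mem_map.1 h
    exact ⟨p, Nat.prime_of_mem_primeFactorsList hp, Ideal.Quotient.eq_zero_iff_mem.1 hpP⟩
  have h3 : Ideal.absNorm P ∣ p ^ Module.finrank ℤ (𝓞 K) := by
    have h := Ideal.absNorm_dvd_norm_of_mem hpP
    have h4 : Algebra.norm ℤ (p : 𝓞 K) = (p : ℤ) ^ Module.finrank ℤ (𝓞 K) := by
      have := Algebra.norm_algebraMap (R := ℤ) (S := 𝓞 K) (p : ℤ)
      simpa using this
    rw [h4] at h
    exact_mod_cast h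
  obtain ⟨f, hf, hN⟩ := (Nat.dvd_prime_pow hp).1 h3
  refine ⟨p, f, hp, ?_, hN, hpP⟩
  rcases Nat.eq_zero_or_pos f with h | h
  · rw [h, pow_zero] at hN; omega
  · exact h

theorem lamK_supp {n : ℕ} (h : lamK K n ≠ 0) : IsPrimePow n := by
  obtain ⟨P, hP, m, hm, rfl⟩ := lamK_ne K h
  obtain ⟨p, f, hp, hf, hN, _⟩ := absNorm_prime_pow K hP
  rw [hN, ← pow_mul]
  exact hp.isPrimePow.pow (Nat.mul_pos hf hm).ne'

theorem lamK_good {p : ℕ} (hp : p.Prime) (h : lamK K p ≠ 0) : Good K p := by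
  obtain ⟨A, hA, hA'⟩ := Finset.exists_ne_zero_of_sum_ne_zero h
  rw [mem_fn] at hA
  exact ⟨hp, A, hA⟩

theorem lamK_dim (n : ℕ) : lamK K n ≤ Module.finrank ℤ (𝓞 K) * Real.log n := by
  classical
  by_cases h0 : lamK K n = 0
  · rw [h0]; exact mul_nonneg (Nat.cast_nonneg _) (Real.log_natCast_nonneg _)
  obtain ⟨p, k, hp, hk, hn⟩ := lamK_supp K h0
  have hp := hp.nat_prime
  let T := (finite_norm_eq K n).toFinset.filter (fun A => vM K A ≠ 0)
  have hT : lamK K n = ∑ A ∈ T, vM K A := by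
    rw [lamK, Finset.sum_filter_ne_zero]
  have hchoose : ∀ A : Ideal (𝓞 K), ∃ P : Ideal (𝓞 K), A ∈ T → Prime P ∧ ∃ m : ℕ, 0 < m ∧ A = P ^ m := by
    intro A
    by_cases h : A ∈ T
    · obtain ⟨P, hP⟩ := vM_ne K (Finset.mem_filter.1 h).2
      exact ⟨P, fun _ => hP⟩
    · exact ⟨⊥, fun h' => absurd h' h⟩
  choose P hP using hchoose
  have hPp : ∀ A ∈ T, (p : 𝓞 K) ∈ P A ∧ p ≤ Ideal.absNorm (P A) := by
    intro A hA
    obtain ⟨hPr, m, hm, hAm⟩ := hP A hA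
    obtain ⟨p', f, hp', hf, hN, hmem⟩ := absNorm_prime_pow K hPr
    have h1 := (mem_fn K).1 (Finset.mem_filter.1 hA).1
    rw [hAm, map_pow, hN, ← hn, ← pow_mul] at h1
    have : p' = p := by
      have : p' ∣ p ^ k := h1 ▸ dvd_pow_self _ (Nat.mul_pos hf hm).ne'
      exact (Nat.prime_dvd_prime_iff_eq hp' hp).1 (hp'.dvd_of_dvd_pow this)
    rw [this] at hmem hN
    exact ⟨hmem, hN ▸ Nat.le_self_pow hf.ne' _⟩
  have hinj : Set.InjOn P (T : Set (Ideal (𝓞 K))) := by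
    intro A hA B hB h
    obtain ⟨hPr, m, hm, hAm⟩ := hP A hA
    obtain ⟨hPr', m', hm', hBm⟩ := hP B hB
    have h1 := (mem_fn K).1 (Finset.mem_filter.1 hA).1
    have h2 := (mem_fn K).1 (Finset.mem_filter.1 hB).1
    rw [hAm, map_pow] at h1
    rw [hBm, ← h, map_pow, ← h1] at h2
    have := Nat.pow_right_injective (absNorm_prime_ge K hPr) h2
    rw [hAm, hBm, ← h, this]
  have hprod : ∏ Q ∈ T.image P, Q ∣ Ideal.span {(p : 𝓞 K)} := by
    apply Finset.prod_dvd_of_isRelPrime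
    · intro Q hQ Q' hQ' hne
      obtain ⟨A, hA, rfl⟩ := Finset.mem_image.1 hQ
      obtain ⟨A', hA', rfl⟩ := Finset.mem_image.1 hQ'
      rw [Function.onFun, (hP A hA).1.irreducible.isRelPrime_iff_not_dvd]
      exact fun hd => hne (associated_iff_eq.1 ((hP A hA).1.associated_of_dvd (hP A' hA').1 hd))
    · intro Q hQ
      obtain ⟨A, hA, rfl⟩ := Finset.mem_image.1 hQ
      rw [Ideal.dvd_span_singleton]
      exact (hPp A hA).1
  have hcard : T.card ≤ Module.finrank ℤ (𝓞 K) := by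
    have h1 := map_dvd Ideal.absNorm hprod
    rw [map_prod, Finset.prod_image hinj, Ideal.absNorm_span_singleton] at h1
    have h4 : Algebra.norm ℤ (p : 𝓞 K) = (p : ℤ) ^ Module.finrank ℤ (𝓞 K) := by
      have := Algebra.norm_algebraMap (R := ℤ) (S := 𝓞 K) (p : ℤ)
      simpa using this
    rw [h4, Int.natAbs_pow, Int.natAbs_natCast] at h1
    have h2 := Nat.le_of_dvd (pow_pos hp.pos _) h1
    have h3 : p ^ T.card ≤ ∏ A ∈ T, Ideal.absNorm (P A) := by
      rw [← Finset.prod_const]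
      exact Finset.prod_le_prod' fun A hA => (hPp A hA).2
    exact (Nat.pow_le_pow_iff_right hp.one_lt).1 (h3.trans h2)
  rw [hT]
  calc ∑ A ∈ T, vM K A ≤ T.card • Real.log n := by
        apply Finset.sum_le_card_nsmul
        intro A hA
        have := vM_le K A
        rwa [(mem_fn K).1 (Finset.mem_filter.1 hA).1] at this
    _ ≤ _ := by
        rw [nsmul_eq_mul]
        exact mul_le_mul_of_nonneg_right (by exact_mod_cast hcard) (Real.log_natCast_nonneg _)
end CS

namespace CS
open Finset NumberField Filter Topology

/-- the analytic data extracted from a number field -/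
structure AD where
  r : ℕ → ℕ
  lam : ℕ → ℝ
  good : ℕ → Prop
  deg : ℕ
  N0 : ℕ
  Cw : ℝ
  Cz : ℝ
  deg_pos : 0 < deg
  Cw_pos : 1 ≤ Cw
  Cz_pos : 1 ≤ Cz
  r1 : r 1 = 1
  lam_nonneg : ∀ m, 0 ≤ lam m
  lam_le : ∀ m, lam m ≤ r m * Real.log m
  conv : ∀ m, m ≠ 0 → ∑ x ∈ m.divisorsAntidiagonal, (r x.1 : ℝ) * lam x.2 = r m * Real.log m
  supp : ∀ m, lam m ≠ 0 → IsPrimePow m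
  supp1 : ∀ p, p.Prime → lam p ≠ 0 → good p
  dim : ∀ m, lam m ≤ deg * Real.log m
  good_prime : ∀ p, good p → p.Prime
  absc : LSeries.abscissaOfAbsConv (fun m => (r m : ℂ)) ≤ 1
  zlow : ∀ u : ℝ, 0 < u → u ≤ 1 → 1 / (Cz * u) ≤ ‖LSeries (fun m => (r m : ℂ)) ((1 + u : ℝ) : ℂ)‖
  zup : ∀ u : ℝ, 0 < u → u ≤ 1 → ‖LSeries (fun m => (r m : ℂ)) ((1 + u : ℝ) : ℂ)‖ ≤ Cz / u
  window : ∀ Q : Finset ℕ, (∀ q ∈ Q, good q ∧ N0 < q) → ∀ L : ℕ, L = ∏ q ∈ Q, q → ∀ χ : DirichletCharacter ℂ L,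
    χ ≠ 1 → ∀ s : ℂ, ‖s‖ ≤ 3 → ∀ i : ℕ, 1 ≤ i → L ^ deg ≤ 2 ^ i →
      ‖∑ m ∈ Finset.range (2 ^ (i + 1) + 1), (r m : ℂ) * (χ (m : ZMod L) *
        win s (Real.logb 2 m - i))‖ ≤
        Cw * L * (2 : ℝ) ^ i * ((2 : ℝ) ^ i) ^ (-(deg : ℝ)⁻¹)

variable (K : Type*) [Field K] [NumberField K]

theorem absc_rK : LSeries.abscissaOfAbsConv (fun m => (rK K m : ℂ)) ≤ 1 := by
  apply LSeries.abscissaOfAbsConv_le_of_forall_lt_LSeriesSummable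
  intro y hy
  have h := ((Ideal.tendsto_norm_le_div_atTop₀ K).comp tendsto_natCast_atTop_atTop)
  have hb : (fun n : ℕ => ∑ k ∈ Finset.Icc 1 n, ‖(rK K k : ℂ)‖) =O[atTop] fun n => (n : ℝ) ^ (1 : ℝ) := by
    have h1 := h.isBigO_one ℝ
    have h2 := h1.mul (Asymptotics.isBigO_refl (fun n : ℕ => (n : ℝ)) atTop)
    refine (h2.congr' ?_ ?_)
    · filter_upwards [eventually_gt_atTop 0] with n hn
      have hn' : (n : ℝ) ≠ 0 := by exact_mod_cast hn.ne'
      simp only [Function.comp_apply, Nat.cast_le, Complex.norm_natCast]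
      rw [div_mul_cancel₀ _ hn']
      rw [← Nat.cast_sum]
      congr 1
      rw [← add_left_inj 1, ← Ideal.card_norm_le_eq_card_norm_le_add_one,
        show Finset.Icc 1 n = Finset.Ioc 0 n from Finset.Icc_succ_left_eq_Ioc _ _,
        show 1 = rK K 0 by simp [rK, Ideal.absNorm_eq_zero_iff],
        Finset.sum_Ioc_add_eq_sum_Icc (n.zero_le)]
      simp only [rK]
      rw [← Finset.card_preimage_eq_sum_card_image_eq (fun k _ ↦ Ideal.finite_setOfPred_absNorm_eq k)]
      simp [Set.coe_eq_subtype]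
    · filter_upwards with n
      simp
  exact LSeriesSummable_of_sum_norm_bigO hb zero_le_one (by simpa using hy)

theorem zeta_bounds : ∃ C : ℝ, 1 ≤ C ∧ ∀ u : ℝ, 0 < u → u ≤ 1 →
    1 / (C * u) ≤ ‖LSeries (fun m => (rK K m : ℂ)) ((1 + u : ℝ) : ℂ)‖ ∧
    ‖LSeries (fun m => (rK K m : ℂ)) ((1 + u : ℝ) : ℂ)‖ ≤ C / u := by
  have hsum : ∀ u : ℝ, 0 < u → LSeriesSummable (fun m => (rK K m : ℂ)) ((1 + u : ℝ) : ℂ) := by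
    intro u hu
    apply LSeriesSummable_of_abscissaOfAbsConv_lt_re
    refine (absc_rK K).trans_lt ?_
    rw [Complex.ofReal_re]
    exact_mod_cast (by linarith : (1 : ℝ) < 1 + u)
  have hterm : ∀ (u : ℝ) (m : ℕ), ‖LSeries.term (fun m => (rK K m : ℂ)) ((1 + u : ℝ) : ℂ) m‖ =
      if m = 0 then 0 else (rK K m : ℝ) / (m : ℝ) ^ (1 + u) := by
    intro u m
    rw [LSeries.norm_term_eq]
    simp
  have heq : ∀ u : ℝ, 0 < u → ‖LSeries (fun m => (rK K m : ℂ)) ((1 + u : ℝ) : ℂ)‖ =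
      ∑' m, ‖LSeries.term (fun m => (rK K m : ℂ)) ((1 + u : ℝ) : ℂ) m‖ := by
    intro u hu
    have h1 : LSeries (fun m => (rK K m : ℂ)) ((1 + u : ℝ) : ℂ) =
      ((∑' m, ‖LSeries.term (fun m => (rK K m : ℂ)) ((1 + u : ℝ) : ℂ) m‖ : ℝ) : ℂ) := by
      rw [LSeries, Complex.ofReal_tsum]
      congr 1
      ext m
      rw [hterm, LSeries.term]
      split_ifs
      · simp
      · push_cast
        rw [Complex.ofReal_cpow (Nat.cast_nonneg m)]
        simp
    rw [h1, Complex.norm_real, Real.norm_of_nonneg (tsum_nonneg fun _ => norm_nonneg _)]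
  have hge1 : ∀ u : ℝ, 0 < u → 1 ≤ ‖LSeries (fun m => (rK K m : ℂ)) ((1 + u : ℝ) : ℂ)‖ := by
    intro u hu
    rw [heq u hu]
    have := (hsum u hu).norm.le_tsum 1 (fun _ _ => norm_nonneg _)
    rw [hterm] at this
    simpa [rK_one] using this
  have hanti : ∀ u v : ℝ, 0 < u → u ≤ v → ‖LSeries (fun m => (rK K m : ℂ)) ((1 + v : ℝ) : ℂ)‖ ≤
      ‖LSeries (fun m => (rK K m : ℂ)) ((1 + u : ℝ) : ℂ)‖ := by
    intro u v hu huv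
    rw [heq u hu, heq v (hu.trans_le huv)]
    apply (hsum v (hu.trans_le huv)).norm.tsum_le_tsum _ (hsum u hu).norm
    intro m
    rw [hterm, hterm]
    split_ifs with h
    · exact le_rfl
    · apply div_le_div_of_nonneg_left (Nat.cast_nonneg _)
      · positivity
      · apply Real.rpow_le_rpow_of_exponent_le
        · exact_mod_cast Nat.one_le_iff_ne_zero.2 h
        · linarith
  have hlim := (NumberField.tendsto_sub_one_mul_dedekindZeta_nhdsGT K).norm
  have hR := dedekindZeta_residue_pos K
  set R := dedekindZeta_residue K with hRdef
  have hR' : ‖((R : ℝ) : ℂ)‖ = R := by rw [Complex.norm_real, Real.norm_of_nonneg hR.le]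
  rw [hR'] at hlim
  have hev := hlim.eventually (Ioo_mem_nhds (show R / 2 < R by linarith) (show R < 2 * R by linarith))
  rw [eventually_nhdsWithin_iff, Metric.eventually_nhds_iff] at hev
  obtain ⟨ε, hε, hev⟩ := hev
  set u0 : ℝ := min (ε / 2) 1 with hu0
  have hu0pos : 0 < u0 := by rw [hu0]; positivity
  have hu01 : u0 ≤ 1 := min_le_right _ _
  have hu0e : u0 < ε := (min_le_left _ _).trans_lt (by linarith)
  have hsmall : ∀ u : ℝ, 0 < u → u ≤ u0 →
      R / 2 < u * ‖LSeries (fun m => (rK K m : ℂ)) ((1 + u : ℝ) : ℂ)‖ ∧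
      u * ‖LSeries (fun m => (rK K m : ℂ)) ((1 + u : ℝ) : ℂ)‖ < 2 * R := by
    intro u hu hu'
    have h := @hev (1 + u) (by rw [Real.dist_eq, add_sub_cancel_left, abs_of_pos hu]; linarith)
      (by simpa using hu)
    have h2 : ‖(((1 + u : ℝ) : ℂ) - 1) * dedekindZeta K ((1 + u : ℝ) : ℂ)‖ =
        u * ‖LSeries (fun m => (rK K m : ℂ)) ((1 + u : ℝ) : ℂ)‖ := by
      rw [norm_mul]
      congr 1
      rw [← Complex.ofReal_one, ← Complex.ofReal_sub, Complex.norm_real, add_sub_cancel_left,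
        Real.norm_of_nonneg hu.le]
    rw [h2] at h
    exact ⟨h.1, h.2⟩
  refine ⟨max 1 (max (2 / R) (max (1 / u0) (2 * R / u0))), le_max_left _ _, ?_⟩
  intro u hu hu1
  set C := max 1 (max (2 / R) (max (1 / u0) (2 * R / u0))) with hC
  have hC1 : (1 : ℝ) ≤ C := le_max_left _ _
  have hC2 : 2 / R ≤ C := (le_max_left _ _).trans (le_max_right _ _)
  have hC3 : 1 / u0 ≤ C := (le_max_left _ _).trans ((le_max_right _ _).trans (le_max_right _ _))
  have hC4 : 2 * R / u0 ≤ C := (le_max_right _ _).trans ((le_max_right _ _).trans (le_max_right _ _))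
  have hC5 : 2 * R ≤ C := by
    refine le_trans ?_ hC4
    rw [le_div_iff₀ hu0pos]
    nlinarith
  rw [div_le_iff₀ (by positivity), le_div_iff₀ hu]
  rcases le_or_gt u u0 with h | h
  · obtain ⟨h1, h2⟩ := hsmall u hu h
    constructor
    · rw [div_le_iff₀ hR] at hC2
      nlinarith
    · linarith
  · constructor
    · have h1 := hge1 u hu
      rw [div_le_iff₀ hu0pos] at hC3
      have : 1 ≤ C * u := hC3.trans (by nlinarith)
      nlinarith
    · have h1 := hanti u0 u hu0pos h.le
      have h2 := (hsmall u0 hu0pos le_rfl).2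
      rw [div_le_iff₀ hu0pos] at hC4
      have h3 : ‖LSeries (fun m => (rK K m : ℂ)) ((1 + u0 : ℝ) : ℂ)‖ ≤ 2 * R / u0 := by
        rw [le_div_iff₀ hu0pos]; linarith
      have h4 : ‖LSeries (fun m => (rK K m : ℂ)) ((1 + u : ℝ) : ℂ)‖ ≤ C :=
        h1.trans (h3.trans ((div_le_iff₀ hu0pos).2 hC4))
      nlinarith [norm_nonneg (LSeries (fun m => (rK K m : ℂ)) ((1 + u : ℝ) : ℂ))]

theorem exists_AD [IsGalois ℚ K] (hpos : ∀ x : 𝓞 K, 0 ≤ Algebra.norm ℤ x) :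
    ∃ D : AD, ∀ p, D.good p ↔ Good K p := by
  obtain ⟨Cz, hCz1, hz⟩ := zeta_bounds K
  obtain ⟨C, N1, hC, hN1, hw⟩ := window_all K hpos
  obtain ⟨N0, hN0⟩ := norm_surj K
  refine ⟨⟨rK K, lamK K, Good K, Module.finrank ℤ (𝓞 K), max N0 N1, max 1 C, Cz, Module.finrank_pos, le_max_left _ _,
    hCz1, rK_one K, lamK_nonneg K, lamK_le K, conv_K K, fun m h => lamK_supp K h, fun p hp h => lamK_good K hp h,
    lamK_dim K, fun p h => h.1, absc_rK K, fun u h h' => (hz u h h').1, fun u h h' => (hz u h h').2, ?_⟩, fun p => Iff.rfl⟩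
  intro Q hQ L hL χ hχ s hs i hi hLi
  have hfr : Module.finrank ℤ (𝓞 K) = Module.finrank ℚ K := RingOfIntegers.rank K
  rw [hfr] at hLi ⊢
  have hLpos : 0 < L := hL ▸ Finset.prod_pos fun q hq => (hQ q hq).1.1.pos
  have : NeZero L := ⟨hLpos.ne'⟩
  obtain ⟨a, ha⟩ : ∃ a : (ZMod L)ˣ, χ a ≠ 1 := by
    by_contra hcon
    push Not at hcon
    apply hχ
    ext a
    rw [hcon a]; simp
  obtain ⟨β, hβ⟩ := hN0 Q (fun q hq => ⟨(hQ q hq).1, (le_max_left _ _).trans_lt (hQ q hq).2⟩)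
    (((a : ZMod L).val : ℕ) : ℤ)
  rw [← hL] at hβ
  have hβ' : ((Algebra.norm ℤ β : ℤ) : ZMod L) = a := by
    have := (ZMod.intCast_zmod_eq_zero_iff_dvd _ L).2 hβ
    push_cast at this
    rw [sub_eq_zero] at this
    rw [this]; simp
  have hcop : Nat.Coprime N1 L := by
    rw [hL]
    apply Nat.Coprime.prod_right
    intro q hq
    rw [Nat.coprime_comm, (hQ q hq).1.1.coprime_iff_not_dvd]
    intro hd
    exact absurd (Nat.le_of_dvd hN1 hd) (not_le.2 ((le_max_right _ _).trans_lt (hQ q hq).2))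
  refine (hw L hLpos χ ⟨β, ?_, ?_⟩ hcop s hs i hi hLi).trans ?_
  · rw [isCoprime_comm, ← ZMod.coe_int_isUnit_iff_isCoprime, hβ']; exact a.isUnit
  · rw [hβ']; exact ha
  · gcongr
    exact le_max_right _ _
end CS

namespace CS
open Finset Filter Topology LSeries

/-- completely multiplicative, bounded by one -/
structure CM (f : ℕ → ℂ) : Prop where
  one : f 1 = 1
  mul : ∀ a b, f (a * b) = f a * f b
  le : ∀ a, ‖f a‖ ≤ 1

variable (D : AD)

noncomputable def AD.rt (f : ℕ → ℂ) (m : ℕ) : ℂ := f m * D.r m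
noncomputable def AD.lt (f : ℕ → ℂ) (m : ℕ) : ℂ := f m * D.lam m
noncomputable def AD.gt (f : ℕ → ℂ) (m : ℕ) : ℂ := f m * (D.lam m / Real.log m : ℝ)

theorem absc_of_le (f g : ℕ → ℂ) (h : ∀ m, m ≠ 0 → ‖f m‖ ≤ ‖g m‖) (hg : abscissaOfAbsConv g ≤ 1) :
    abscissaOfAbsConv f ≤ 1 := by
  apply abscissaOfAbsConv_le_of_forall_lt_LSeriesSummable
  intro y hy
  have h1 : LSeriesSummable g y := by
    apply LSeriesSummable_of_abscissaOfAbsConv_lt_re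
    refine hg.trans_lt ?_
    rw [Complex.ofReal_re]; exact_mod_cast hy
  refine h1.norm.of_norm_bounded (fun m => by
    by_cases hm : m = 0
    · simp [hm]
    · exact norm_term_le _ (h m hm))

theorem lam_zero_of {m : ℕ} (hm : m ≤ 1) : D.lam m = 0 := by
  apply le_antisymm _ (D.lam_nonneg m)
  refine (D.lam_le m).trans ?_
  interval_cases m <;> simp

theorem lam_div_le (m : ℕ) : D.lam m / Real.log m ≤ D.r m := by
  rcases Nat.lt_or_ge 1 m with h | h
  · rw [div_le_iff₀ (Real.log_pos (by exact_mod_cast h))]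
    exact D.lam_le m
  · rw [lam_zero_of D h, zero_div]; positivity


theorem absc_rt {f : ℕ → ℂ} (hf : CM f) : abscissaOfAbsConv (D.rt f) ≤ 1 := by
  apply absc_of_le _ (fun m => (D.r m : ℂ)) _ D.absc
  intro m _
  rw [AD.rt, norm_mul]
  exact mul_le_of_le_one_left (norm_nonneg _) (hf.le m)

theorem absc_lt {f : ℕ → ℂ} (hf : CM f) : abscissaOfAbsConv (D.lt f) ≤ 1 := by
  apply absc_of_le _ (logMul (fun m => (D.r m : ℂ))) _ (abscissaOfAbsConv_logMul.trans_le D.absc)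
  intro m _
  rw [AD.lt, norm_mul, logMul, norm_mul, ← Complex.natCast_log, Complex.norm_real, Complex.norm_real,
    Real.norm_of_nonneg (D.lam_nonneg m), Real.norm_of_nonneg (Real.log_natCast_nonneg m), Complex.norm_natCast]
  refine (mul_le_of_le_one_left (D.lam_nonneg m) (hf.le m)).trans ?_
  rw [mul_comm]; exact D.lam_le m

theorem absc_gt {f : ℕ → ℂ} (hf : CM f) : abscissaOfAbsConv (D.gt f) ≤ 1 := by
  apply absc_of_le _ (fun m => (D.r m : ℂ)) _ D.absc
  intro m _
  have h0 : 0 ≤ D.lam m / Real.log m := div_nonneg (D.lam_nonneg m) (Real.log_natCast_nonneg m)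
  rw [AD.gt, norm_mul, Complex.norm_real, Real.norm_of_nonneg h0, Complex.norm_natCast]
  exact (mul_le_of_le_one_left h0 (hf.le m)).trans (lam_div_le D m)

theorem one_lt_of {g : ℕ → ℂ} (hg : abscissaOfAbsConv g ≤ 1) {s : ℂ} (hs : 1 < s.re) :
    abscissaOfAbsConv g < s.re := hg.trans_lt (by exact_mod_cast hs)

theorem logMul_rt {f : ℕ → ℂ} (hf : CM f) (m : ℕ) (hm : m ≠ 0) : logMul (D.rt f) m = (LSeries.convolution (D.rt f) (D.lt f)) m := by
  rw [convolution_def]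
  beta_reduce
  have h := D.conv m hm
  have h2 : ∀ x ∈ m.divisorsAntidiagonal, D.rt f x.1 * D.lt f x.2 =
      f m * (((D.r x.1 : ℝ) * D.lam x.2 : ℝ) : ℂ) := by
    intro x hx
    rw [Nat.mem_divisorsAntidiagonal] at hx
    rw [AD.rt, AD.lt, ← hx.1, hf.mul]
    push_cast; ring
  rw [Finset.sum_congr rfl h2, ← Finset.mul_sum, ← Complex.ofReal_sum, h, logMul, AD.rt, ← Complex.natCast_log]
  push_cast; ring

theorem logMul_gt {f : ℕ → ℂ} (hf : CM f) (m : ℕ) : logMul (D.gt f) m = D.lt f m := by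
  rw [logMul, AD.gt, AD.lt, ← Complex.natCast_log]
  rcases Nat.lt_or_ge 1 m with h | h
  · have : (Real.log m : ℂ) ≠ 0 := by
      exact_mod_cast (Real.log_pos (by exact_mod_cast h)).ne'
    rw [Complex.ofReal_div]
    field_simp
  · rw [lam_zero_of D h]; simp

theorem hasDeriv_rt {f : ℕ → ℂ} (hf : CM f) {s : ℂ} (hs : 1 < s.re) :
    HasDerivAt (LSeries (D.rt f)) (-(LSeries (D.rt f) s * LSeries (D.lt f) s)) s := by
  have h := LSeries_hasDerivAt (one_lt_of (absc_rt D hf) hs)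
  rw [LSeries_congr (fun {m} hm => logMul_rt D hf m hm) s, LSeries_convolution
    (one_lt_of (absc_rt D hf) hs) (one_lt_of (absc_lt D hf) hs)] at h
  exact h

theorem hasDeriv_gt {f : ℕ → ℂ} (hf : CM f) {s : ℂ} (hs : 1 < s.re) :
    HasDerivAt (LSeries (D.gt f)) (-LSeries (D.lt f) s) s := by
  have h := LSeries_hasDerivAt (one_lt_of (absc_gt D hf) hs)
  rw [LSeries_congr (fun {m} _ => logMul_gt D hf m) s] at h
  exact h

theorem exp_formula {f : ℕ → ℂ} (hf : CM f) (x : ℝ) (hx : 1 < x) :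
    LSeries (D.rt f) x = Complex.exp (LSeries (D.gt f) x) := by
  let H : ℝ → ℂ := fun y => LSeries (D.rt f) y * Complex.exp (-LSeries (D.gt f) y)
  have hd : ∀ y : ℝ, 1 < y → HasDerivAt H 0 y := by
    intro y hy
    have h1 := (hasDeriv_rt D hf (s := (y : ℂ)) (by simpa using hy))
    have h2 := (hasDeriv_gt D hf (s := (y : ℂ)) (by simpa using hy))
    have h3 := (h1.mul h2.neg.cexp).comp_ofReal
    convert! h3 using 1
    simp only [Pi.neg_apply]
    ring
  have hconst : ∀ y : ℝ, 1 < y → H y = H x := by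
    intro y hy
    apply IsOpen.is_const_of_deriv_eq_zero (isOpen_Ioi (a := (1 : ℝ))) isPreconnected_Ioi
      (fun z hz => (hd z hz).differentiableAt.differentiableWithinAt) (fun z hz => (hd z hz).deriv) hy hx
  have hlt : ∀ g : ℕ → ℂ, abscissaOfAbsConv g ≤ 1 → abscissaOfAbsConv g < ⊤ :=
    fun g hg => hg.trans_lt (by exact_mod_cast EReal.coe_lt_top 1)
  have hl1 := LSeries.tendsto_atTop (hlt _ (absc_rt D hf))
  have hl2 := LSeries.tendsto_atTop (hlt _ (absc_gt D hf))
  have hl : Tendsto H atTop (𝓝 1) := by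
    have := hl1.mul (hl2.neg.cexp)
    simpa [AD.rt, AD.gt, hf.one, D.r1] using this
  have hl' : Tendsto H atTop (𝓝 (H x)) := by
    apply tendsto_const_nhds.congr'
    filter_upwards [eventually_gt_atTop (1 : ℝ)] with y hy
    exact (hconst y hy).symm
  have hH : H x = 1 := tendsto_nhds_unique hl' hl
  have : LSeries (D.rt f) x = H x * Complex.exp (LSeries (D.gt f) x) := by
    simp only [H]
    rw [mul_assoc, ← Complex.exp_add]; simp
  rw [this, hH, one_mul]

theorem rec_bound {f : ℕ → ℂ} (hf : CM f) {s : ℂ} (hs : 1 < s.re) (A : ℝ) (hA : 1 ≤ A)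
    (h0 : 1 / A ≤ ‖LSeries (D.rt f) s‖)
    (hj : ∀ j : ℕ, ‖iteratedDeriv j (LSeries (D.rt f)) s‖ ≤ j.factorial * A ^ (j + 1)) (j : ℕ) :
    ‖iteratedDeriv j (LSeries (D.lt f)) s‖ ≤ j.factorial * (4 * A ^ 4) ^ (j + 1) := by
  have han : ∀ g : ℕ → ℂ, abscissaOfAbsConv g ≤ 1 → ∀ n : WithTop ℕ∞, ContDiffAt ℂ n (LSeries g) s := by
    intro g hg n
    exact (LSeries_analyticOnNhd g s (one_lt_of hg hs)).contDiffAt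
  have hrec : ∀ j : ℕ, iteratedDeriv (j + 1) (LSeries (D.rt f)) s =
      -∑ i ∈ Finset.range (j + 1), (j.choose i : ℂ) * iteratedDeriv i (LSeries (D.lt f)) s *
        iteratedDeriv (j - i) (LSeries (D.rt f)) s := by
    intro j
    rw [iteratedDeriv_succ']
    have he : deriv (LSeries (D.rt f)) =ᶠ[𝓝 s] fun z => -((LSeries (D.lt f) * LSeries (D.rt f)) z) := by
      have hopen : IsOpen {z : ℂ | 1 < z.re} := isOpen_lt continuous_const Complex.continuous_re
      filter_upwards [hopen.mem_nhds hs] with z hz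
      rw [(hasDeriv_rt D hf hz).deriv, Pi.mul_apply, mul_comm]
    rw [he.iteratedDeriv_eq, iteratedDeriv_fun_neg, iteratedDeriv_mul (han _ (absc_lt D hf) _) (han _ (absc_rt D hf) _)]
  induction j using Nat.strong_induction_on with
  | _ j ih =>
  set l : ℕ → ℂ := fun j => iteratedDeriv j (LSeries (D.rt f)) s with hl
  set S : ℕ → ℂ := fun j => iteratedDeriv j (LSeries (D.lt f)) s with hS
  have hApos : 0 < A := by linarith
  have h1 := hrec j
  rw [Finset.sum_range_succ, Nat.choose_self, Nat.sub_self] at h1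
  have h2 : l 0 * S j = -(l (j + 1)) - ∑ i ∈ Finset.range j, (j.choose i : ℂ) * S i * l (j - i) := by
    simp only [hl, hS]
    rw [h1]; push_cast; ring
  have h3 : ‖l 0 * S j‖ ≤ (j + 1).factorial * A ^ (j + 2) +
      ∑ i ∈ Finset.range j, (j.choose i : ℝ) * (i.factorial * (4 * A ^ 4) ^ (i + 1)) *
        ((j - i).factorial * A ^ (j - i + 1)) := by
    rw [h2]
    refine (norm_sub_le _ _).trans ?_
    rw [norm_neg]
    refine add_le_add (hj (j + 1)) ((norm_sum_le _ _).trans (Finset.sum_le_sum ?_))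
    intro i hi
    rw [norm_mul, norm_mul, Complex.norm_natCast]
    have := ih i (Finset.mem_range.1 hi)
    have := hj (j - i)
    gcongr
  have h4 : ∀ i ∈ Finset.range j, (j.choose i : ℝ) * (i.factorial * (4 * A ^ 4) ^ (i + 1)) *
        ((j - i).factorial * A ^ (j - i + 1)) ≤ j.factorial * ((4 * A ^ 4) ^ (j + 1) / A) * (1 / 4) ^ (j - i) := by
    intro i hi
    have hij : i ≤ j := (Finset.mem_range.1 hi).le
    have hij' : 1 ≤ j - i := by have := Finset.mem_range.1 hi; omega
    have e1 : (j.choose i : ℝ) * i.factorial * (j - i).factorial = j.factorial := by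
      exact_mod_cast Nat.choose_mul_factorial_mul_factorial hij
    have e2 : (4 * A ^ 4) ^ (j + 1) = (4 * A ^ 4) ^ (i + 1) * (4 * A ^ 4) ^ (j - i) := by
      rw [← pow_add]; congr 1; omega
    calc (j.choose i : ℝ) * (i.factorial * (4 * A ^ 4) ^ (i + 1)) * ((j - i).factorial * A ^ (j - i + 1))
        = j.factorial * (4 * A ^ 4) ^ (i + 1) * A ^ (j - i + 1) := by rw [← e1]; ring
      _ ≤ j.factorial * (4 * A ^ 4) ^ (i + 1) * ((A ^ 4) ^ (j - i) / A) := by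
          gcongr
          rw [le_div_iff₀ hApos, ← pow_succ, ← pow_mul]
          exact pow_le_pow_right₀ hA (by omega)
      _ = _ := by
          rw [e2, mul_pow 4 (A ^ 4) (j - i)]
          have : (1 / 4 : ℝ) ^ (j - i) = 1 / 4 ^ (j - i) := by rw [one_div_pow]
          rw [this]
          field_simp
  have h5 : ∑ i ∈ Finset.range j, (1 / 4 : ℝ) ^ (j - i) ≤ 1 / 2 := by
    have : ∑ i ∈ Finset.range j, (1 / 4 : ℝ) ^ (j - i) = ∑ i ∈ Finset.range j, (1 / 4 : ℝ) ^ (i + 1) := by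
      rw [← Finset.sum_range_reflect]
      apply Finset.sum_congr rfl
      intro i hi
      congr 1
      have := Finset.mem_range.1 hi; omega
    rw [this]
    have : ∀ n : ℕ, ∑ i ∈ Finset.range n, (1 / 4 : ℝ) ^ (i + 1) ≤ 1 / 2 - (1 / 2) * (1 / 4) ^ n := by
      intro n
      induction n with
      | zero => simp
      | succ n ihn =>
        rw [Finset.sum_range_succ]
        have : (0 : ℝ) < (1 / 4) ^ n := by positivity
        rw [pow_succ (1 / 4 : ℝ) n]
        linarith
    refine (this j).trans ?_
    have : (0 : ℝ) < (1 / 4) ^ j := by positivity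
    linarith
  have h6 : ((j + 1).factorial : ℝ) * A ^ (j + 2) ≤ j.factorial * ((4 * A ^ 4) ^ (j + 1) / A) * (1 / 4) := by
    have e : (j + 1 : ℝ) ≤ 4 ^ j := by
      have : j + 1 ≤ 4 ^ j := Nat.lt_pow_self (by norm_num)
      exact_mod_cast this
    rw [Nat.factorial_succ]
    push_cast
    calc (j + 1 : ℝ) * j.factorial * A ^ (j + 2) ≤ 4 ^ j * j.factorial * ((A ^ 4) ^ (j + 1) / A) := by
          gcongr
          rw [le_div_iff₀ hApos, ← pow_succ, ← pow_mul]
          exact pow_le_pow_right₀ hA (by omega)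
      _ = _ := by rw [mul_pow 4 (A ^ 4) (j + 1), pow_succ (4 : ℝ) j]; ring
  have h7 : ‖l 0 * S j‖ ≤ j.factorial * ((4 * A ^ 4) ^ (j + 1) / A) := by
    refine h3.trans ((add_le_add h6 (Finset.sum_le_sum h4)).trans ?_)
    rw [← Finset.mul_sum]
    have : (0 : ℝ) ≤ j.factorial * ((4 * A ^ 4) ^ (j + 1) / A) := by positivity
    nlinarith
  rw [norm_mul] at h7
  have h8 : 1 / A ≤ ‖l 0‖ := by simpa [hl] using h0
  have h9 : (1 / A) * ‖S j‖ ≤ j.factorial * ((4 * A ^ 4) ^ (j + 1) / A) :=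
    (mul_le_mul_of_nonneg_right h8 (norm_nonneg _)).trans h7
  have h10 : (1 / A) * ‖S j‖ = ‖S j‖ / A := by ring
  rw [h10, ← mul_div_assoc] at h9
  exact (div_le_div_iff_of_pos_right hApos).1 h9
end CS

namespace CS
open Finset Filter Topology LSeries

/-- the function of a Dirichlet character -/
noncomputable def chf {L : ℕ} (χ : DirichletCharacter ℂ L) (m : ℕ) : ℂ := χ (m : ZMod L)

theorem chf_CM {L : ℕ} (χ : DirichletCharacter ℂ L) : CM (chf χ) := by
  refine ⟨by simp [chf], fun a b => by simp [chf], fun a => ?_⟩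
  exact χ.norm_le_one _

theorem hasSum_hat_nat {m : ℕ} (hm : m ≠ 0) : HasSum (fun i : ℕ => hat (Real.logb 2 m - i)) 1 := by
  have h := hasSum_hat (-Real.logb 2 m)
  have hinj : Function.Injective (fun i : ℕ => (i : ℤ)) := Nat.cast_injective
  rw [← hinj.hasSum_iff] at h
  · refine h.congr_fun ?_ |> fun h' => h'
    intro i
    simp only [Function.comp, hat]
    push_cast
    rw [show Real.logb 2 m - i = -(-Real.logb 2 m + i) by ring, abs_neg]
  · intro x hx
    have hx0 : x < 0 := by
      by_contra hc
      push Not at hc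
      exact hx ⟨x.toNat, by simp [hc]⟩
    have h1 : (x : ℝ) ≤ -1 := by exact_mod_cast (by omega : x ≤ -1)
    have h2 : 0 ≤ Real.logb 2 m := Real.logb_nonneg (by norm_num) (by exact_mod_cast Nat.one_le_iff_ne_zero.2 hm)
    apply hat_eq_zero
    rw [abs_of_nonpos (by linarith)]; linarith

variable (D : AD)

noncomputable def AD.Phi (f : ℕ → ℂ) (i : ℕ) (s : ℂ) : ℂ :=
  ∑ m ∈ range (2 ^ (i + 1) + 1), (hat (Real.logb 2 m - i) : ℂ) * term (D.rt f) s m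

theorem hat_big {m i : ℕ} (h : m ∉ range (2 ^ (i + 1) + 1)) : hat (Real.logb 2 m - i) = 0 := by
  simp only [mem_range, not_lt] at h
  have h1 : (2:ℝ) ^ ((i:ℝ) + 1) ≤ m := by
    rw [← Nat.cast_succ, Real.rpow_natCast]; exact_mod_cast (by omega : 2 ^ (i+1) ≤ m)
  have h2 : (i : ℝ) + 1 ≤ Real.logb 2 m := by
    rw [Real.le_logb_iff_rpow_le (by norm_num) (lt_of_lt_of_le (by positivity) h1)]
    exact h1
  apply hat_eq_zero
  rw [abs_of_nonneg (by linarith)]; linarith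

theorem Phi_hasSum {f : ℕ → ℂ} (i : ℕ) (s : ℂ) :
    HasSum (fun m : ℕ => (hat (Real.logb 2 m - i) : ℂ) * term (D.rt f) s m) (D.Phi f i s) := by
  apply hasSum_sum_of_ne_finset_zero
  intro m hm
  rw [hat_big hm]; simp

theorem LSeries_eq_Phi {f : ℕ → ℂ} (hf : CM f) {s : ℂ} (hs : 1 < s.re) :
    LSeries (D.rt f) s = ∑' i, D.Phi f i s := by
  have hsum : LSeriesSummable (D.rt f) s := LSeriesSummable_of_abscissaOfAbsConv_lt_re (one_lt_of (absc_rt D hf) hs)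
  have e1 : ∀ i, D.Phi f i s = ∑' m : ℕ, (hat (Real.logb 2 m - i) : ℂ) * term (D.rt f) s m :=
    fun i => (Phi_hasSum D i s).tsum_eq.symm
  have key : ∀ m : ℕ, HasSum (fun i : ℕ => (hat (Real.logb 2 m - i) : ℂ) * term (D.rt f) s m) (term (D.rt f) s m) := by
    intro m
    rcases eq_or_ne m 0 with rfl | hm
    · simp [hasSum_zero]
    · have h1 : HasSum (fun i : ℕ => (hat (Real.logb 2 m - i) : ℂ)) 1 := by
        have := Complex.hasSum_ofReal.2 (hasSum_hat_nat hm)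
        rwa [Complex.ofReal_one] at this
      simpa using h1.mul_right (term (D.rt f) s m)
  have key2 : ∀ m : ℕ, HasSum (fun i : ℕ => ‖(hat (Real.logb 2 m - i) : ℂ) * term (D.rt f) s m‖) ‖term (D.rt f) s m‖ := by
    intro m
    rcases eq_or_ne m 0 with rfl | hm
    · simp [hasSum_zero]
    · have h1 := (hasSum_hat_nat hm).mul_right ‖term (D.rt f) s m‖
      simpa [abs_of_nonneg (hat_nonneg _)] using h1
  simp_rw [e1]
  rw [LSeries]
  have hS : Summable (Function.uncurry fun (m i : ℕ) => (hat (Real.logb 2 m - i) : ℂ) * term (D.rt f) s m) := by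
    apply Summable.of_norm
    rw [summable_prod_of_nonneg (fun _ => norm_nonneg _)]
    refine ⟨fun m => (key2 m).summable, ?_⟩
    refine hsum.norm.congr (fun m => ?_)
    exact (key2 m).tsum_eq.symm
  rw [Summable.tsum_comm hS]
  exact tsum_congr (fun m => (key m).tsum_eq.symm)

theorem Phi_diff (f : ℕ → ℂ) (i : ℕ) : Differentiable ℂ (D.Phi f i) := by
  unfold AD.Phi
  apply Differentiable.fun_sum
  intro m _
  apply Differentiable.const_mul
  rcases eq_or_ne m 0 with rfl | hm
  · simp
  · simp_rw [term_of_ne_zero hm, div_eq_mul_inv]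
    apply Differentiable.const_mul
    have : ∀ s : ℂ, ((m:ℂ) ^ s)⁻¹ = (m:ℂ) ^ (-s) := fun s => (Complex.cpow_neg _ _).symm
    simp_rw [this]
    intro s
    exact (differentiableAt_id.neg).const_cpow (Or.inl (by exact_mod_cast hm))

theorem Phi_head {f : ℕ → ℂ} (hf : CM f) {i i0 : ℕ} (hi : i < i0) {s : ℂ} (hs : 1 - 1 / (i0 : ℝ) ≤ s.re) :
    ‖D.Phi f i s‖ ≤ 4 * D.Cz * i0 := by
  have hi0 : (0:ℝ) < i0 := by exact_mod_cast (by omega : 0 < i0)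
  have hi1 : (1:ℝ) ≤ i0 := by exact_mod_cast (by omega : 1 ≤ i0)
  have hr : 0 < 1 / (i0:ℝ) := by positivity
  have hr1 : 1 / (i0:ℝ) ≤ 1 := by rw [div_le_one hi0]; exact hi1
  set ρ := 1 / (i0 : ℝ) with hρ
  have hsum : LSeriesSummable (fun m => (D.r m : ℂ)) ((1 + ρ : ℝ) : ℂ) :=
    LSeriesSummable_of_abscissaOfAbsConv_lt_re (one_lt_of D.absc (by simpa using hr))
  have hterm : ∀ m ∈ range (2 ^ (i + 1) + 1), ‖(hat (Real.logb 2 m - i) : ℂ) * term (D.rt f) s m‖ ≤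
      4 * ‖term (fun m => (D.r m : ℂ)) ((1 + ρ : ℝ) : ℂ) m‖ := by
    intro m hm
    rcases eq_or_ne m 0 with rfl | hm0
    · simp
    have hmp : (0:ℝ) < m := by exact_mod_cast Nat.pos_of_ne_zero hm0
    have hm1 : (1:ℝ) ≤ m := by exact_mod_cast Nat.pos_of_ne_zero hm0
    have hml : (m:ℝ) ≤ 2 ^ i0 := by
      have h1 : m ≤ 2 ^ (i+1) := by simp at hm; omega
      have h2 : (2:ℕ) ^ (i+1) ≤ 2 ^ i0 := Nat.pow_le_pow_right (by norm_num) (by omega)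
      exact_mod_cast h1.trans h2
    rw [norm_mul, Complex.norm_real, Real.norm_of_nonneg (hat_nonneg _), norm_term_eq, norm_term_eq,
      if_neg hm0, if_neg hm0, AD.rt, norm_mul, Complex.ofReal_re]
    have hp : (m:ℝ) ^ (2 * ρ) ≤ 4 := by
      calc (m:ℝ) ^ (2 * ρ) ≤ ((2:ℝ) ^ i0) ^ (2 * ρ) := Real.rpow_le_rpow hmp.le hml (by positivity)
        _ = 4 := by
          rw [← Real.rpow_natCast, ← Real.rpow_mul (by norm_num), show (i0:ℝ) * (2 * ρ) = 2 by rw [hρ]; field_simp]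
          norm_num
    have hq : (m:ℝ) ^ (1 + ρ) ≤ 4 * (m:ℝ) ^ s.re := by
      calc (m:ℝ) ^ (1 + ρ) ≤ (m:ℝ) ^ (2 * ρ + s.re) := Real.rpow_le_rpow_of_exponent_le hm1 (by linarith)
        _ = (m:ℝ) ^ (2 * ρ) * (m:ℝ) ^ s.re := Real.rpow_add hmp _ _
        _ ≤ _ := by gcongr
    have h1 : hat (Real.logb 2 m - i) ≤ 1 := hat_le_one _
    have h2 := hf.le m
    have h3 : 0 ≤ hat (Real.logb 2 m - i) := hat_nonneg _
    calc hat (Real.logb 2 m - i) * (‖f m‖ * ‖(D.r m : ℂ)‖ / (m:ℝ) ^ s.re)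
        ≤ 1 * (1 * ‖(D.r m : ℂ)‖ / (m:ℝ) ^ s.re) := by gcongr
      _ = ‖(D.r m : ℂ)‖ / (m:ℝ) ^ s.re := by ring
      _ ≤ 4 * (‖(D.r m : ℂ)‖ / (m:ℝ) ^ (1 + ρ)) := by
        rw [← mul_div_assoc, div_le_div_iff₀ (by positivity) (by positivity)]
        nlinarith [norm_nonneg (D.r m : ℂ)]
  have hreal : ∀ m, term (fun m => (D.r m : ℂ)) ((1 + ρ : ℝ) : ℂ) m = (‖term (fun m => (D.r m : ℂ)) ((1 + ρ : ℝ) : ℂ) m‖ : ℂ) := by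
    intro m
    rw [norm_term_eq]
    rcases eq_or_ne m 0 with rfl | hm0
    · simp
    rw [if_neg hm0, term_of_ne_zero hm0, Complex.norm_natCast, Complex.ofReal_re, Complex.ofReal_div,
      Complex.ofReal_cpow (by positivity)]
    simp
  have hnorm : ‖LSeries (fun m => (D.r m : ℂ)) ((1 + ρ : ℝ) : ℂ)‖ = ∑' m, ‖term (fun m => (D.r m : ℂ)) ((1 + ρ : ℝ) : ℂ) m‖ := by
    rw [LSeries, tsum_congr hreal, ← Complex.ofReal_tsum, Complex.norm_real, Real.norm_of_nonneg]
    exact tsum_nonneg (fun _ => norm_nonneg _)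
  calc ‖D.Phi f i s‖ ≤ ∑ m ∈ range (2 ^ (i + 1) + 1), 4 * ‖term (fun m => (D.r m : ℂ)) ((1 + ρ : ℝ) : ℂ) m‖ :=
        (norm_sum_le _ _).trans (sum_le_sum hterm)
    _ ≤ 4 * ‖LSeries (fun m => (D.r m : ℂ)) ((1 + ρ : ℝ) : ℂ)‖ := by
        rw [← mul_sum, hnorm]
        gcongr
        exact hsum.norm.sum_le_tsum _ (fun _ _ => norm_nonneg _)
    _ ≤ 4 * (D.Cz / ρ) := by gcongr; exact D.zup ρ hr hr1
    _ = _ := by rw [hρ]; field_simp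

theorem Phi_tail {Q : Finset ℕ} (hQ : ∀ q ∈ Q, D.good q ∧ D.N0 < q) {L : ℕ} (hL : L = ∏ q ∈ Q, q)
    {χ : DirichletCharacter ℂ L} (hχ : χ ≠ 1) {s : ℂ} (hs : ‖s‖ ≤ 3) (hre : 1 - 1 / (2 * (D.deg : ℝ)) ≤ s.re)
    {i : ℕ} (hi : 1 ≤ i) (hLi : L ^ D.deg ≤ 2 ^ i) :
    ‖D.Phi (chf χ) i s‖ ≤ D.Cw * L * ((2 : ℝ) ^ (-(1 / (2 * (D.deg : ℝ))))) ^ i := by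
  have h := D.window Q hQ L hL χ hχ s hs i hi hLi
  have hdeg : (0:ℝ) < D.deg := by exact_mod_cast D.deg_pos
  have e : D.Phi (chf χ) i s = (2:ℂ) ^ (-(i * s)) * ∑ m ∈ Finset.range (2 ^ (i + 1) + 1), (D.r m : ℂ) * (χ (m : ZMod L) *
        win s (Real.logb 2 m - i)) := by
    rw [AD.Phi, mul_sum]
    apply sum_congr rfl
    intro m _
    rcases eq_or_ne m 0 with rfl | hm0
    · rw [win_zero]
      · simp
      · simp; exact_mod_cast hi
    rw [term_of_ne_zero hm0, AD.rt, chf, win]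
    have h1 : ((m:ℂ) ^ s)⁻¹ = (2:ℂ) ^ (-(i * s)) * Complex.exp (-s * ((Real.logb 2 m - i) * Real.log 2 : ℝ)) := by
      rw [← Complex.cpow_neg, Complex.cpow_def_of_ne_zero (by exact_mod_cast hm0),
        Complex.cpow_def_of_ne_zero (by norm_num), ← Complex.exp_add]
      congr 1
      rw [← Complex.natCast_log, show Complex.log 2 = (Real.log 2 : ℂ) by
        rw [Complex.ofReal_log (by norm_num)]; simp]
      have : Real.log m = Real.logb 2 m * Real.log 2 := by
        rw [Real.logb]; field_simp
      rw [this]; push_cast; ring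
    rw [div_eq_mul_inv, h1]; ring
  have hn : ‖(2:ℂ) ^ (-((i:ℂ) * s))‖ = (2:ℝ) ^ (-((i:ℝ) * s.re)) := by
    rw [show (2:ℂ) = ((2:ℝ):ℂ) by simp, Complex.norm_cpow_eq_rpow_re_of_pos (by norm_num)]
    simp
  rw [e, norm_mul, hn]
  calc _ ≤ (2:ℝ) ^ (-((i:ℝ) * s.re)) * (D.Cw * L * (2 : ℝ) ^ i * ((2 : ℝ) ^ i) ^ (-(D.deg : ℝ)⁻¹)) := by gcongr
    _ = D.Cw * L * (2 : ℝ) ^ (-((i:ℝ) * s.re) + i + i * (-(D.deg : ℝ)⁻¹)) := by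
        rw [Real.rpow_add (by norm_num), Real.rpow_add (by norm_num), ← Real.rpow_natCast 2 i,
          ← Real.rpow_mul (by norm_num)]; ring
    _ ≤ D.Cw * L * (2 : ℝ) ^ (-(1 / (2 * (D.deg : ℝ))) * i) := by
        have := D.Cw_pos
        gcongr
        · norm_num
        have h3 : (D.deg:ℝ)⁻¹ = 2 * (1 / (2 * (D.deg : ℝ))) := by field_simp
        rw [h3]
        have : (0:ℝ) ≤ i := by positivity
        nlinarith
    _ = _ := by rw [Real.rpow_mul (by norm_num), Real.rpow_natCast]

end CS

namespace CS
open Finset Filter Topology LSeries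
variable (D : AD)

set_option maxHeartbeats 1000000 in
theorem deriv_bound : ∃ C : ℝ, 1 ≤ C ∧ ∀ Q : Finset ℕ, (∀ q ∈ Q, D.good q ∧ D.N0 < q) → ∀ L : ℕ, L = ∏ q ∈ Q, q →
    ∀ χ : DirichletCharacter ℂ L, χ ≠ 1 → ∀ u : ℝ, 0 < u → u ≤ 1 → ∀ j : ℕ,
    ‖iteratedDeriv j (LSeries (D.rt (chf χ))) ((1 + u : ℝ) : ℂ)‖ ≤ j.factorial * (C * (1 + Real.log L) ^ 2) ^ (j + 1) := by
  have hdeg : (0:ℝ) < D.deg := by exact_mod_cast D.deg_pos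
  have hdeg1 : (1:ℝ) ≤ D.deg := by exact_mod_cast D.deg_pos
  have hCw := D.Cw_pos
  have hCz := D.Cz_pos
  set β : ℝ := 1 / (2 * (D.deg : ℝ)) with hβ
  have hβ0 : 0 < β := by positivity
  set q : ℝ := (2:ℝ) ^ (-β) with hq
  have hq0 : 0 < q := by positivity
  have hq1 : q < 1 := Real.rpow_lt_one_of_one_lt_of_neg (by norm_num) (by linarith)
  have h1q : 0 < 1 - q := by linarith
  have hcq : 0 < D.Cw / (1 - q) := by positivity
  refine ⟨64 * D.Cz * D.deg ^ 2 + D.Cw / (1 - q) + 8 * D.deg, by nlinarith [sq_nonneg (D.deg:ℝ)], ?_⟩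
  intro Q hQ L hL χ hχ u hu0 hu1 j
  have hLpos : 0 < L := by
    rw [hL]; exact Finset.prod_pos (fun p hp => (D.good_prime p (hQ p hp).1).pos)
  have hL1 : (1:ℝ) ≤ L := by exact_mod_cast hLpos
  set Λ : ℝ := 1 + Real.log L with hΛ
  have hΛ1 : 1 ≤ Λ := by have := Real.log_nonneg hL1; linarith
  set i0 : ℕ := 2 * D.deg * (Nat.clog 2 L + 1) with hi0
  have hclog : (Nat.clog 2 L : ℝ) ≤ 1 + 2 * Real.log L := by
    rcases Nat.lt_or_ge 1 L with h | h
    · have h1 := Nat.pow_pred_clog_lt_self (b := 2) (by norm_num) h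
      have h2 : ((2:ℝ) ^ (Nat.clog 2 L).pred) ≤ L := by exact_mod_cast h1.le
      have h3 := Real.log_le_log (by positivity) h2
      rw [Real.log_pow] at h3
      have h4 : (Nat.clog 2 L : ℝ) ≤ (Nat.clog 2 L).pred + 1 := by
        exact_mod_cast (by rw [Nat.pred_eq_sub_one]; omega : Nat.clog 2 L ≤ (Nat.clog 2 L).pred + 1)
      have h5 := Real.log_two_gt_d9
      have h6 : (0:ℝ) ≤ (Nat.clog 2 L).pred := by positivity
      nlinarith
    · have : L = 1 := by omega
      simp [this]
  have hi0le : (i0 : ℝ) ≤ 4 * D.deg * Λ := by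
    rw [hi0, hΛ]; push_cast
    nlinarith
  have hi0pos : 0 < i0 := by rw [hi0]; have := D.deg_pos; positivity
  have hi0r : (0:ℝ) < i0 := by exact_mod_cast hi0pos
  have hi0ge : 2 * (D.deg : ℝ) ≤ i0 := by
    have : 2 * D.deg ≤ i0 := by rw [hi0]; exact Nat.le_mul_of_pos_right _ (by omega)
    exact_mod_cast this
  have hLc : L ≤ 2 ^ Nat.clog 2 L := Nat.le_pow_clog (by norm_num) L
  have hLi : ∀ i, i0 ≤ i → L ^ D.deg ≤ 2 ^ i := by
    intro i hi
    calc L ^ D.deg ≤ (2 ^ Nat.clog 2 L) ^ D.deg := Nat.pow_le_pow_left hLc _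
      _ = 2 ^ (Nat.clog 2 L * D.deg) := by rw [← pow_mul]
      _ ≤ 2 ^ i := Nat.pow_le_pow_right (by norm_num) (by
          refine le_trans ?_ hi
          rw [hi0]; nlinarith [Nat.zero_le D.deg, Nat.zero_le (Nat.clog 2 L * D.deg)])
  have hLq : L * q ^ i0 ≤ 1 := by
    have h1 : q ^ i0 = (2:ℝ) ^ (-((Nat.clog 2 L : ℝ) + 1)) := by
      rw [hq, ← Real.rpow_natCast, ← Real.rpow_mul (by norm_num)]
      congr 1
      rw [hi0, hβ]; push_cast; field_simp
    have h2 : (L:ℝ) ≤ (2:ℝ) ^ ((Nat.clog 2 L : ℝ) + 1) := by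
      rw [← Nat.cast_succ, Real.rpow_natCast]
      exact_mod_cast hLc.trans (Nat.pow_le_pow_right (by norm_num) (by omega))
    rw [h1, Real.rpow_neg (by norm_num), ← div_eq_mul_inv, div_le_one (by positivity)]
    exact h2
  set R : ℝ := 1 / (i0:ℝ) with hR
  have hR0 : 0 < R := by positivity
  have hRβ : R ≤ β := by rw [hR, hβ]; gcongr
  have hR2 : R ≤ 1 / 2 := by
    refine hRβ.trans ?_
    rw [hβ]; apply one_div_le_one_div_of_le <;> linarith
  set c : ℂ := ((1 + u : ℝ) : ℂ) with hc
  let b : ℕ → ℝ := fun i => if i < i0 then 4 * D.Cz * i0 else D.Cw * L * q ^ i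
  have hball : ∀ s ∈ Metric.ball c R, 1 - R ≤ s.re ∧ ‖s‖ ≤ 3 := by
    intro s hs
    rw [Metric.mem_ball, dist_eq_norm] at hs
    constructor
    · have h1 := (Complex.abs_re_le_norm (s - c)).trans hs.le
      rw [abs_le] at h1
      have h2 : (s - c).re = s.re - (1 + u) := by rw [hc]; simp
      rw [h2] at h1
      linarith [h1.1]
    · have h1 : ‖s‖ ≤ ‖s - c‖ + ‖c‖ := by simpa using norm_add_le (s - c) c
      have h2 : ‖c‖ = 1 + u := by rw [hc, Complex.norm_real, Real.norm_of_nonneg (by linarith)]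
      linarith
  have hb : ∀ i, ∀ s ∈ Metric.ball c R, ‖D.Phi (chf χ) i s‖ ≤ b i := by
    intro i s hs
    obtain ⟨h1, h2⟩ := hball s hs
    simp only [b]
    split_ifs with h
    · exact Phi_head D (chf_CM χ) h h1
    · exact Phi_tail D hQ hL hχ h2 (by linarith) (by omega) (hLi i (by omega))
  have hbsum : HasSum b (i0 * (4 * D.Cz * i0) + D.Cw * L * q ^ i0 / (1 - q)) := by
    rw [← hasSum_nat_add_iff' i0]
    have e1 : ∑ i ∈ range i0, b i = i0 * (4 * D.Cz * i0) := by
      rw [Finset.sum_congr rfl (g := fun _ => 4 * D.Cz * (i0:ℝ))]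
      · simp
      · intro i hi; simp only [b]; rw [if_pos (Finset.mem_range.1 hi)]
    rw [e1, add_sub_cancel_left]
    have h1 := (hasSum_geometric_of_lt_one hq0.le hq1).mul_left (D.Cw * L * q ^ i0)
    rw [← div_eq_mul_inv] at h1
    refine h1.congr_fun ?_ |> fun h' => h'
    intro i
    simp only [b]
    rw [if_neg (by omega), pow_add]; ring
  have hM : (i0 * (4 * D.Cz * i0) + D.Cw * L * q ^ i0 / (1 - q) : ℝ) ≤ 64 * D.Cz * D.deg ^ 2 * Λ ^ 2 + D.Cw / (1 - q) := by
    have h1 : (i0:ℝ) ^ 2 ≤ (4 * D.deg * Λ) ^ 2 := by gcongr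
    have h2 : D.Cw * L * q ^ i0 / (1 - q) ≤ D.Cw / (1 - q) := by
      gcongr
      rw [mul_assoc]
      exact mul_le_of_le_one_right (by linarith) hLq
    nlinarith
  set G : ℂ → ℂ := fun s => ∑' i, D.Phi (chf χ) i s with hG
  have hGd : DifferentiableOn ℂ G (Metric.ball c R) :=
    Complex.differentiableOn_tsum_of_summable_norm hbsum.summable (fun i => (Phi_diff D _ i).differentiableOn)
      Metric.isOpen_ball hb
  have hGb : ∀ s ∈ Metric.ball c R, ‖G s‖ ≤ 64 * D.Cz * D.deg ^ 2 * Λ ^ 2 + D.Cw / (1 - q) := fun s hs =>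
    (tsum_of_norm_bounded hbsum (fun i => hb i s hs)).trans hM
  have heq : LSeries (D.rt (chf χ)) =ᶠ[𝓝 c] G := by
    have hopen : IsOpen {z : ℂ | 1 < z.re} := isOpen_lt continuous_const Complex.continuous_re
    filter_upwards [hopen.mem_nhds (show c ∈ {z : ℂ | 1 < z.re} by simp [hc]; exact hu0)] with z hz
    exact LSeries_eq_Phi D (chf_CM χ) hz
  rw [heq.iteratedDeriv_eq]
  have hsub : Metric.closedBall c (R/2) ⊆ Metric.ball c R := Metric.closedBall_subset_ball (by linarith)
  have hcau := Complex.norm_iteratedDeriv_le_of_forall_mem_sphere_norm_le (n := j) (c := c) (R := R/2) (f := G)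
    (C := 64 * D.Cz * D.deg ^ 2 * Λ ^ 2 + D.Cw / (1 - q)) (by linarith)
    ((hGd.mono hsub).diffContOnCl_ball (subset_refl _)) (fun z hz => hGb z (hsub (Metric.sphere_subset_closedBall hz)))
  refine hcau.trans ?_
  rw [mul_div_assoc]
  gcongr
  have e : (64 * D.Cz * D.deg ^ 2 * Λ ^ 2 + D.Cw / (1 - q)) / (R / 2) ^ j =
      (64 * D.Cz * D.deg ^ 2 * Λ ^ 2 + D.Cw / (1 - q)) * (2 * i0) ^ j := by
    rw [div_eq_mul_inv, ← inv_pow]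
    congr 2
    rw [hR]; field_simp
  rw [e, pow_succ' _ j]
  have hΛ2 : 1 ≤ Λ ^ 2 := one_le_pow₀ hΛ1
  have hΛ3 : Λ ≤ Λ ^ 2 := by nlinarith
  have hz : 0 ≤ D.Cz * D.deg ^ 2 := by positivity
  have hz2 : 0 ≤ D.Cz * D.deg ^ 2 * Λ ^ 2 := by positivity
  have i1 : 64 * D.Cz * D.deg ^ 2 * Λ ^ 2 + D.Cw / (1 - q) ≤
      (64 * D.Cz * D.deg ^ 2 + D.Cw / (1 - q) + 8 * D.deg) * Λ ^ 2 := by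
    have a1 : D.Cw / (1 - q) * 1 ≤ D.Cw / (1 - q) * Λ ^ 2 := by gcongr
    have a2 : 0 ≤ 8 * D.deg * Λ ^ 2 := by positivity
    linarith
  have i2 : 2 * (i0:ℝ) ≤ (64 * D.Cz * D.deg ^ 2 + D.Cw / (1 - q) + 8 * D.deg) * Λ ^ 2 := by
    have : 2 * (i0:ℝ) ≤ 8 * D.deg * Λ ^ 2 := by nlinarith
    have a1 : 0 ≤ D.Cw / (1 - q) * Λ ^ 2 := by positivity
    linarith
  exact mul_le_mul i1 (pow_le_pow_left₀ (by positivity) i2 j) (by positivity) (by positivity)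

end CS

namespace CS
open Finset Filter Topology LSeries
variable (D : AD)

theorem re_ineq (z w : ℂ) (hz : ‖z‖ ≤ 1) (hw : ‖w‖ ≤ 1) :
    0 ≤ 6 + 4 * z.re + 4 * w.re + 2 * (z * star w).re := by
  have h1 : z.re ^ 2 + z.im ^ 2 ≤ 1 := by
    have := Complex.sq_norm z; rw [Complex.normSq_apply] at this
    nlinarith [norm_nonneg z]
  have h2 : w.re ^ 2 + w.im ^ 2 ≤ 1 := by
    have := Complex.sq_norm w; rw [Complex.normSq_apply] at this
    nlinarith [norm_nonneg w]
  have : (z * star w).re = z.re * w.re + z.im * w.im := by simp [Complex.mul_re]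
  rw [this]
  nlinarith [sq_nonneg (2 + z.re + w.re), sq_nonneg (z.im + w.im)]

theorem rt_one : D.rt (fun _ => 1) = fun m => (D.r m : ℂ) := by
  ext m; simp [AD.rt]

theorem CM_one : CM (fun _ => 1) := ⟨rfl, by simp, by simp⟩

theorem CM.mul' {f g : ℕ → ℂ} (hf : CM f) (hg : CM g) : CM (fun m => f m * g m) :=
  ⟨by simp [hf.one, hg.one], fun a b => by simp only [hf.mul, hg.mul]; ring, fun a => by
    rw [norm_mul]; exact mul_le_one₀ (hf.le a) (norm_nonneg _) (hg.le a)⟩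

theorem CM.star {f : ℕ → ℂ} (hf : CM f) : CM (fun m => star (f m)) :=
  ⟨by simp [hf.one], fun a b => by simp only [hf.mul, star_mul'], fun a => by
    rw [norm_star]; exact hf.le a⟩

theorem gt_hasSum {f : ℕ → ℂ} (hf : CM f) (x : ℝ) (hx : 1 < x) :
    HasSum (fun m : ℕ => D.lam m / Real.log m / (m : ℝ) ^ x * (f m).re) (LSeries (D.gt f) x).re := by
  have h := (LSeriesSummable_of_abscissaOfAbsConv_lt_re (one_lt_of (absc_gt D hf) (s := (x : ℂ)) (by simpa using hx))).hasSum
  have h2 := Complex.hasSum_re h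
  refine h2.congr_fun ?_ |> fun h' => h'
  intro m
  rcases eq_or_ne m 0 with rfl | hm
  · simp
  · rw [term_of_ne_zero hm, AD.gt, ← Complex.ofReal_natCast, ← Complex.ofReal_cpow (by positivity), mul_div_assoc,
      ← Complex.ofReal_div, Complex.re_mul_ofReal]
    rw [mul_comm]

theorem norm_rt {f : ℕ → ℂ} (hf : CM f) (x : ℝ) (hx : 1 < x) :
    ‖LSeries (D.rt f) x‖ = Real.exp (LSeries (D.gt f) x).re := by
  rw [exp_formula D hf x hx, Complex.norm_exp]

theorem prod_ineq {f g : ℕ → ℂ} (hf : CM f) (hg : CM g) (x : ℝ) (hx : 1 < x) :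
    1 ≤ ‖LSeries (fun m => (D.r m : ℂ)) x‖ ^ 6 * ‖LSeries (D.rt f) x‖ ^ 4 * ‖LSeries (D.rt g) x‖ ^ 4 *
      ‖LSeries (D.rt (fun m => f m * star (g m))) x‖ ^ 2 := by
  have hfg := hf.mul' hg.star
  rw [← rt_one, norm_rt D CM_one x hx, norm_rt D hf x hx, norm_rt D hg x hx, norm_rt D hfg x hx,
    ← Real.exp_nat_mul, ← Real.exp_nat_mul, ← Real.exp_nat_mul, ← Real.exp_nat_mul, ← Real.exp_add, ← Real.exp_add, ← Real.exp_add]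
  rw [Real.one_le_exp_iff]
  have h := ((((gt_hasSum D CM_one x hx).mul_left 6).add ((gt_hasSum D hf x hx).mul_left 4)).add
    ((gt_hasSum D hg x hx).mul_left 4)).add ((gt_hasSum D hfg x hx).mul_left 2)
  push_cast
  refine h.nonneg (fun m => ?_)
  have h0 : 0 ≤ D.lam m / Real.log m / (m : ℝ) ^ x :=
    div_nonneg (div_nonneg (D.lam_nonneg m) (Real.log_natCast_nonneg m)) (by positivity)
  have h1 := mul_nonneg h0 (re_ineq (f m) (g m) (hf.le m) (hg.le m))
  simp only [Complex.one_re]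
  linarith

theorem chf_mul_star {L : ℕ} [NeZero L] (χ ψ : DirichletCharacter ℂ L) :
    (fun m => chf χ m * star (chf ψ m)) = chf (χ * ψ⁻¹) := by
  ext m
  simp only [chf, MulChar.mul_apply]
  rw [← MulChar.star_apply' ψ]

theorem zero_free : ∃ C : ℝ, 1 ≤ C ∧ ∀ Q : Finset ℕ, (∀ q ∈ Q, D.good q ∧ D.N0 < q) → ∀ L : ℕ, L = ∏ q ∈ Q, q →
    ∀ Z : ℝ, Z = C * (1 + Real.log L) ^ 2 → ∃ χ0 : DirichletCharacter ℂ L,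
    ∀ χ : DirichletCharacter ℂ L, χ ≠ 1 → χ ≠ χ0 → ∀ u : ℝ, 0 < u → u ≤ 1 / Z ^ 16 → ∀ J : ℕ,
    ‖iteratedDeriv J (LSeries (D.lt (chf χ))) ((1 + u : ℝ) : ℂ)‖ ≤ J.factorial * (4 * Z ^ 56) ^ (J + 1) := by
  obtain ⟨C, hC, hder⟩ := deriv_bound D
  have hCz := D.Cz_pos
  refine ⟨C + 2 * D.Cz, by linarith, ?_⟩
  intro Q hQ L hL Z hZ
  have hLpos : 0 < L := by
    rw [hL]; exact Finset.prod_pos (fun p hp => (D.good_prime p (hQ p hp).1).pos)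
  have : NeZero L := ⟨hLpos.ne'⟩
  have hL1 : (1:ℝ) ≤ L := by exact_mod_cast hLpos
  have hΛ1 : 1 ≤ (1 + Real.log L) ^ 2 := by
    apply one_le_pow₀; have := Real.log_nonneg hL1; linarith
  have hZ2 : 2 * D.Cz ≤ Z := by rw [hZ]; nlinarith
  have hZ2' : 2 ≤ Z := by linarith
  have hZ1 : 1 ≤ Z := by linarith
  have hZ0 : 0 < Z := by linarith
  have hder' : ∀ χ : DirichletCharacter ℂ L, χ ≠ 1 → ∀ u : ℝ, 0 < u → u ≤ 1 → ∀ j : ℕ,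
      ‖iteratedDeriv j (LSeries (D.rt (chf χ))) ((1 + u : ℝ) : ℂ)‖ ≤ j.factorial * Z ^ (j + 1) := by
    intro χ hχ u hu0 hu1 j
    refine (hder Q hQ L hL χ hχ u hu0 hu1 j).trans ?_
    gcongr
    rw [hZ]; gcongr; linarith
  set v : ℝ := 1 / Z ^ 16 with hv
  have hv0 : 0 < v := by positivity
  have hv1 : v ≤ 1 := by rw [hv, div_le_one (by positivity)]; exact one_le_pow₀ hZ1
  have hb : ∀ χ : DirichletCharacter ℂ L, χ ≠ 1 → ‖LSeries (D.rt (chf χ)) ((1 + v : ℝ) : ℂ)‖ ≤ Z := by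
    intro χ hχ
    simpa using hder' χ hχ v hv0 hv1 0
  -- at most one bad character
  have hpair : ∀ χ ψ : DirichletCharacter ℂ L, χ ≠ ψ →
      ‖LSeries (D.rt (chf χ)) ((1 + v : ℝ) : ℂ)‖ < 1 / Z ^ 13 →
      ‖LSeries (D.rt (chf ψ)) ((1 + v : ℝ) : ℂ)‖ < 1 / Z ^ 13 → False := by
    intro χ ψ hne h1 h2
    have h := prod_ineq D (chf_CM χ) (chf_CM ψ) (1 + v) (by linarith)
    rw [chf_mul_star] at h
    have hne' : χ * ψ⁻¹ ≠ 1 := by rwa [ne_eq, mul_inv_eq_one]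
    have h3 := hb _ hne'
    have h4 := D.zup v hv0 hv1
    have h5 : D.Cz / v = D.Cz * Z ^ 16 := by rw [hv]; field_simp
    rw [h5] at h4
    have h6 : D.Cz * Z ^ 16 ≤ Z ^ 17 / 2 := by
      have : Z ^ 17 = Z * Z ^ 16 := by ring
      rw [this]
      have : 0 < Z ^ 16 := by positivity
      nlinarith
    have : ‖LSeries (fun m => (D.r m : ℂ)) ((1 + v : ℝ) : ℂ)‖ ^ 6 * ‖LSeries (D.rt (chf χ)) ((1 + v : ℝ) : ℂ)‖ ^ 4 *
        ‖LSeries (D.rt (chf ψ)) ((1 + v : ℝ) : ℂ)‖ ^ 4 * ‖LSeries (D.rt (chf (χ * ψ⁻¹))) ((1 + v : ℝ) : ℂ)‖ ^ 2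
        ≤ (Z ^ 17 / 2) ^ 6 * (1 / Z ^ 13) ^ 4 * (1 / Z ^ 13) ^ 4 * Z ^ 2 := by
      have := h4.trans h6
      gcongr
    have h7 := h.trans this
    have h8 : (Z ^ 17 / 2) ^ 6 * (1 / Z ^ 13) ^ 4 * (1 / Z ^ 13) ^ 4 * Z ^ 2 = 1 / 64 := by
      field_simp; norm_num
    rw [h8] at h7
    norm_num at h7
  -- good characters
  have hgood : ∀ χ : DirichletCharacter ℂ L, χ ≠ 1 → 1 / Z ^ 13 ≤ ‖LSeries (D.rt (chf χ)) ((1 + v : ℝ) : ℂ)‖ →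
      ∀ u : ℝ, 0 < u → u ≤ v → ∀ J : ℕ,
      ‖iteratedDeriv J (LSeries (D.lt (chf χ))) ((1 + u : ℝ) : ℂ)‖ ≤ J.factorial * (4 * Z ^ 56) ^ (J + 1) := by
    intro χ hχ hlow u hu0 huv J
    have hs : 1 < ((1 + u : ℝ) : ℂ).re := by rw [Complex.ofReal_re]; linarith
    have hmv : ‖LSeries (D.rt (chf χ)) ((1 + v : ℝ) : ℂ) - LSeries (D.rt (chf χ)) ((1 + u : ℝ) : ℂ)‖ ≤ Z ^ 2 * (v - u) := by
      have hdd : ∀ y ∈ Set.Icc u v, HasDerivWithinAt (fun y : ℝ => LSeries (D.rt (chf χ)) ((1 + y : ℝ) : ℂ))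
          (deriv (LSeries (D.rt (chf χ))) ((1 + y : ℝ) : ℂ)) (Set.Icc u v) y := by
        intro y hy
        have hd1 := (hasDeriv_rt D (chf_CM χ) (s := ((1 + y : ℝ) : ℂ)) (by
          rw [Complex.ofReal_re]; linarith [hy.1])).differentiableAt.hasDerivAt
        have hd2 := hd1.comp_ofReal
        have hd3 := hd2.scomp y ((hasDerivAt_id y).const_add 1)
        simpa [Function.comp_def] using hd3.hasDerivWithinAt
      have := norm_image_sub_le_of_norm_deriv_le_segment' hdd (C := Z ^ 2) (fun y hy => by
        have := hder' χ hχ y (by linarith [hy.1]) (by linarith [hy.2]) 1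
        simpa using this) v ⟨huv, le_refl _⟩
      exact this
    have h3 : Z ^ 2 * (v - u) ≤ 1 / Z ^ 14 := by
      have : Z ^ 2 * v = 1 / Z ^ 14 := by rw [hv]; field_simp
      nlinarith [mul_pos (by positivity : 0 < Z ^ 2) hu0]
    have h4 : 1 / Z ^ 13 - 1 / Z ^ 14 ≥ 1 / Z ^ 14 := by
      have : 1 / Z ^ 13 = Z * (1 / Z ^ 14) := by field_simp
      rw [this]
      have : 0 < 1 / Z ^ 14 := by positivity
      nlinarith
    have h5 : 1 / Z ^ 14 ≤ ‖LSeries (D.rt (chf χ)) ((1 + u : ℝ) : ℂ)‖ := by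
      have := norm_sub_norm_le (LSeries (D.rt (chf χ)) ((1 + v : ℝ) : ℂ)) (LSeries (D.rt (chf χ)) ((1 + u : ℝ) : ℂ))
      linarith
    have := rec_bound D (chf_CM χ) hs (Z ^ 14) (one_le_pow₀ hZ1) h5 (fun j => by
      refine (hder' χ hχ u hu0 (by linarith) j).trans ?_
      gcongr
      exact le_self_pow₀ hZ1 (by norm_num)) J
    rwa [← pow_mul] at this
  by_cases hex : ∃ χ0 : DirichletCharacter ℂ L, ‖LSeries (D.rt (chf χ0)) ((1 + v : ℝ) : ℂ)‖ < 1 / Z ^ 13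
  · obtain ⟨χ0, h0⟩ := hex
    refine ⟨χ0, fun χ hχ hne => hgood χ hχ ?_⟩
    by_contra hc
    push Not at hc
    exact hpair χ χ0 hne hc h0
  · push Not at hex
    exact ⟨1, fun χ hχ _ => hgood χ hχ (hex χ)⟩

theorem zero_free' : ∃ C : ℝ, 1 ≤ C ∧ ∀ Q : Finset ℕ, (∀ q ∈ Q, D.good q ∧ D.N0 < q) → ∀ L : ℕ, L = ∏ q ∈ Q, q →
    ∀ Z : ℝ, Z = C * (1 + Real.log L) ^ 2 → ∃ q0 : ℕ, ∀ d, ∀ hd : d ∣ L, (q0 ∉ d.primeFactors) →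
    ∀ χ : DirichletCharacter ℂ d, χ ≠ 1 → ∀ u : ℝ, 0 < u → u ≤ 1 / Z ^ 16 → ∀ J : ℕ,
    ‖iteratedDeriv J (LSeries (D.lt (chf (χ.changeLevel hd)))) ((1 + u : ℝ) : ℂ)‖ ≤ J.factorial * (4 * Z ^ 56) ^ (J + 1) := by
  obtain ⟨C, hC, h⟩ := zero_free D
  refine ⟨C, hC, ?_⟩
  intro Q hQ L hL Z hZ
  obtain ⟨χ0, h0⟩ := h Q hQ L hL Z hZ
  have hLpos : 0 < L := by
    rw [hL]; exact Finset.prod_pos (fun p hp => (D.good_prime p (hQ p hp).1).pos)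
  have : NeZero L := ⟨hLpos.ne'⟩
  have hne : ∀ d, ∀ hd : d ∣ L, ∀ χ : DirichletCharacter ℂ d, χ ≠ 1 → χ.changeLevel hd ≠ 1 := by
    intro d hd χ hχ hc
    rw [DirichletCharacter.changeLevel_eq_one_iff] at hc
    exact hχ hc
  by_cases hc : χ0 = 1
  · refine ⟨0, fun d hd _ χ hχ => h0 _ (hne d hd χ hχ) ?_⟩
    rw [hc]; exact hne d hd χ hχ
  · have hcond : χ0.conductor ≠ 1 := by
      rw [ne_eq, ← DirichletCharacter.eq_one_iff_conductor_eq_one]; exact hc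
    refine ⟨χ0.conductor.minFac, fun d hd hq χ hχ => h0 _ (hne d hd χ hχ) ?_⟩
    intro he
    apply hq
    have hdpos : d ≠ 0 := fun hz => by rw [hz, zero_dvd_iff] at hd; omega
    have h1 : χ0.FactorsThrough d := ⟨hd, χ, he.symm⟩
    have h2 : χ0.conductor ∣ d := by
      exact χ0.conductor_dvd_of_mem_conductorSet h1
    rw [Nat.mem_primeFactors]
    exact ⟨Nat.minFac_prime hcond, (Nat.minFac_dvd _).trans h2, hdpos⟩

end CS

namespace CS
open Finset Filter Topology LSeries
variable (D : AD)

theorem log_pow_le {m : ℕ} (hm : m ≠ 0) (k : ℕ) {a : ℝ} (ha : 0 < a) :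
    (Real.log m) ^ k ≤ k.factorial * (1 / a) ^ k * (m : ℝ) ^ a := by
  have hmp : (0:ℝ) < m := by exact_mod_cast Nat.pos_of_ne_zero hm
  have h := Real.pow_div_factorial_le_exp (a * Real.log m) (mul_nonneg ha.le (Real.log_natCast_nonneg m)) k
  rw [div_le_iff₀ (by positivity), mul_pow] at h
  rw [Real.rpow_def_of_pos hmp, one_div_pow, mul_comm (Real.log m) a]
  have : 0 < a ^ k := by positivity
  rw [mul_one_div, div_mul_eq_mul_div, le_div_iff₀ this]
  linarith

noncomputable def AD.w (J : ℕ) (u : ℝ) (m : ℕ) : ℝ := D.lam m * Real.log m ^ J * (m : ℝ) ^ (-(1 + u))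

theorem w_nonneg (J : ℕ) (u : ℝ) (m : ℕ) : 0 ≤ D.w J u m := by
  have := D.lam_nonneg m
  have := Real.log_natCast_nonneg m
  rw [AD.w]; positivity

theorem w_le (J : ℕ) {u a : ℝ} (ha : 0 < a) (m : ℕ) : D.w J u m ≤ J.factorial * (1 / a) ^ J * D.w 0 (u - a) m := by
  rcases eq_or_ne m 0 with rfl | hm
  · simp [AD.w, lam_zero_of D (zero_le_one)]
  have hmp : (0:ℝ) < m := by exact_mod_cast Nat.pos_of_ne_zero hm
  have h := log_pow_le hm J ha
  have h1 := D.lam_nonneg m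
  rw [AD.w, AD.w]
  have e : (m:ℝ) ^ (-(1 + (u - a))) = (m:ℝ) ^ a * (m:ℝ) ^ (-(1 + u)) := by
    rw [← Real.rpow_add hmp]; congr 1; ring
  rw [e, pow_zero, mul_one]
  calc _ ≤ D.lam m * (J.factorial * (1 / a) ^ J * (m : ℝ) ^ a) * (m:ℝ) ^ (-(1 + u)) := by gcongr
    _ = _ := by ring

theorem summable_r {u : ℝ} (hu : 0 < u) : Summable (fun m : ℕ => (D.r m : ℝ) * (m : ℝ) ^ (-(1 + u))) := by
  have hsum : LSeriesSummable (fun m => (D.r m : ℂ)) ((1 + u : ℝ) : ℂ) :=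
    LSeriesSummable_of_abscissaOfAbsConv_lt_re (one_lt_of D.absc (by simpa using hu))
  refine hsum.norm.congr (fun m => ?_)
  rw [norm_term_eq]
  rcases eq_or_ne m 0 with rfl | hm0
  · rw [Nat.cast_zero, Real.zero_rpow (by linarith : (-(1+u)) ≠ 0)]; simp
  rw [if_neg hm0, Complex.norm_natCast, Complex.ofReal_re, Real.rpow_neg (by positivity), div_eq_mul_inv]

theorem w_summable (J : ℕ) {u : ℝ} (hu : 0 < u) : Summable (D.w J u) := by
  have h1 : ∀ u : ℝ, 0 < u → Summable (D.w 0 u) := by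
    intro u hu
    refine Summable.of_nonneg_of_le (w_nonneg D 0 u) (fun m => ?_) ((summable_r D (half_pos hu)).mul_left (1 / (u/2)))
    rcases eq_or_ne m 0 with rfl | hm
    · rw [AD.w, lam_zero_of D (zero_le_one), zero_mul, zero_mul]; positivity
    have hmp : (0:ℝ) < m := by exact_mod_cast Nat.pos_of_ne_zero hm
    have h := log_pow_le hm 1 (half_pos hu)
    simp only [pow_one, Nat.factorial_one, Nat.cast_one, one_mul] at h
    have h2 := D.lam_le m
    rw [AD.w, pow_zero, mul_one]
    have e : (m:ℝ) ^ (-(1 + u/2)) = (m:ℝ) ^ (u/2) * (m:ℝ) ^ (-(1 + u)) := by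
      rw [← Real.rpow_add hmp]; congr 1; ring
    rw [e]
    calc D.lam m * (m:ℝ) ^ (-(1 + u)) ≤ (D.r m * (1 / (u/2) * (m:ℝ) ^ (u/2))) * (m:ℝ) ^ (-(1 + u)) := by
          gcongr; exact h2.trans (by gcongr)
      _ = _ := by ring
  refine Summable.of_nonneg_of_le (w_nonneg D J u) (fun m => w_le D J (half_pos hu) m) ?_
  exact (h1 _ (by linarith)).mul_left _

/-- log of the zeta function -/
noncomputable def AD.G (u : ℝ) : ℝ := ∑' m : ℕ, D.lam m / Real.log m * (m : ℝ) ^ (-(1 + u))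

theorem G_hasSum {u : ℝ} (hu : 0 < u) :
    HasSum (fun m : ℕ => D.lam m / Real.log m * (m : ℝ) ^ (-(1 + u))) (LSeries (D.gt (fun _ => 1)) ((1 + u : ℝ) : ℂ)).re := by
  refine (gt_hasSum D CM_one (1 + u) (by linarith)).congr_fun ?_ |> fun h' => h'
  intro m
  rw [Complex.one_re, mul_one, Real.rpow_neg (by positivity)]; rfl

theorem G_low {u : ℝ} (hu : 0 < u) (hu1 : u ≤ 1) : Real.log (1 / (D.Cz * u)) ≤ D.G u := by
  have h := D.zlow u hu hu1
  have hCz := D.Cz_pos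
  rw [← rt_one, norm_rt D CM_one (1 + u) (by linarith), ← (G_hasSum D hu).tsum_eq] at h
  rw [Real.log_le_iff_le_exp (by positivity)]
  exact h

theorem G_up {u : ℝ} (hu : 0 < u) (hu1 : u ≤ 1) : D.G u ≤ Real.log (D.Cz / u) := by
  have h := D.zup u hu hu1
  have hCz := D.Cz_pos
  rw [← rt_one, norm_rt D CM_one (1 + u) (by linarith), ← (G_hasSum D hu).tsum_eq] at h
  rw [Real.le_log_iff_exp_le (by positivity)]
  exact h

theorem gterm (m : ℕ) (u v : ℝ) :
    D.lam m / Real.log m * (m : ℝ) ^ (-(1 + u)) - D.lam m / Real.log m * (m : ℝ) ^ (-(1 + v)) ≤ (v - u) * D.w 0 u m ∧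
    (v - u) * D.w 0 v m ≤ D.lam m / Real.log m * (m : ℝ) ^ (-(1 + u)) - D.lam m / Real.log m * (m : ℝ) ^ (-(1 + v)) := by
  rcases Nat.lt_or_ge 1 m with hm | hm
  · have hmp : (0:ℝ) < m := by exact_mod_cast (by omega : 0 < m)
    have hl : 0 < Real.log m := Real.log_pos (by exact_mod_cast hm)
    have h0 : 0 ≤ D.lam m / Real.log m := div_nonneg (D.lam_nonneg m) hl.le
    have e : D.lam m = D.lam m / Real.log m * Real.log m := by field_simp
    set g := D.lam m / Real.log m with hg
    have key : ∀ s t : ℝ, (m:ℝ) ^ (-(1 + t)) * (1 + (t - s) * Real.log m) ≤ (m:ℝ) ^ (-(1 + s)) := by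
      intro s t
      have : (m:ℝ) ^ (-(1 + s)) = (m:ℝ) ^ (-(1 + t)) * (m:ℝ) ^ (t - s) := by
        rw [← Real.rpow_add hmp]; congr 1; ring
      rw [this]
      gcongr
      rw [Real.rpow_def_of_pos hmp]
      have := Real.add_one_le_exp (Real.log m * (t - s))
      linarith
    simp only [AD.w, pow_zero, mul_one]
    rw [e]
    constructor
    · have := mul_le_mul_of_nonneg_left (key v u) h0
      linarith
    · have := mul_le_mul_of_nonneg_left (key u v) h0
      linarith
  · simp [AD.w, lam_zero_of D hm]

theorem G_diff {u v : ℝ} (hu : 0 < u) (huv : u ≤ v) : D.G u - D.G v ≤ (v - u) * ∑' m, D.w 0 u m ∧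
    (v - u) * ∑' m, D.w 0 v m ≤ D.G u - D.G v := by
  have hv : 0 < v := by linarith
  have h1 := (G_hasSum D hu).summable
  have h2 := (G_hasSum D hv).summable
  rw [AD.G, AD.G, ← h1.tsum_sub h2, ← tsum_mul_left, ← tsum_mul_left]
  exact ⟨(h1.sub h2).tsum_le_tsum (fun m => (gterm D m u v).1) ((w_summable D 0 hu).mul_left _),
    ((w_summable D 0 hv).mul_left _).tsum_le_tsum (fun m => (gterm D m u v).2) (h1.sub h2)⟩

theorem S0_up : ∃ C : ℝ, 1 ≤ C ∧ ∀ u : ℝ, 0 < u → u ≤ 1 → ∑' m, D.w 0 u m ≤ C / u := by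
  have hCz := D.Cz_pos
  refine ⟨2 * |Real.log (2 * D.Cz ^ 2)| + 1, by linarith [abs_nonneg (Real.log (2 * D.Cz ^ 2))], ?_⟩
  intro u hu hu1
  have h := (G_diff D (half_pos hu) (by linarith : u / 2 ≤ u)).2
  have h1 := G_up D (half_pos hu) (by linarith)
  have h2 := G_low D hu hu1
  have e : Real.log (D.Cz / (u / 2)) - Real.log (1 / (D.Cz * u)) = Real.log (2 * D.Cz ^ 2) := by
    rw [← Real.log_div (by positivity) (by positivity)]
    congr 1; field_simp
  have h3 := le_abs_self (Real.log (2 * D.Cz ^ 2))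
  rw [le_div_iff₀ hu]
  linarith

theorem S0_low : ∃ M : ℝ, 1 ≤ M ∧ ∀ u : ℝ, 0 < u → M * u ≤ 1 → 1 / (M * u) ≤ ∑' m, D.w 0 u m := by
  have hCz := D.Cz_pos
  refine ⟨3 * D.Cz ^ 2, by nlinarith, ?_⟩
  intro u hu hu1
  have hM : 1 ≤ 3 * D.Cz ^ 2 := by nlinarith
  have huM : u ≤ 3 * D.Cz ^ 2 * u := by nlinarith
  have h := (G_diff D hu huM).1
  have h1 := G_low D hu (by linarith)
  have h2 := G_up D (by positivity : 0 < 3 * D.Cz ^ 2 * u) hu1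
  have e : Real.log (1 / (D.Cz * u)) - Real.log (D.Cz / (3 * D.Cz ^ 2 * u)) = Real.log 3 := by
    rw [← Real.log_div (by positivity) (by positivity)]
    congr 1; field_simp
  have h3 : 1 ≤ Real.log 3 := by
    rw [Real.le_log_iff_exp_le (by norm_num)]
    linarith [Real.exp_one_lt_d9]
  have h4 : 0 ≤ ∑' m, D.w 0 u m := tsum_nonneg (w_nonneg D 0 u)
  rw [div_le_iff₀ (by positivity)]
  nlinarith

theorem SJ_low : ∃ c : ℝ, 0 < c ∧ c ≤ 1 ∧ ∀ u : ℝ, 0 < u → u ≤ c → ∀ J : ℕ, (c / u) ^ (J + 1) ≤ ∑' m, D.w J u m := by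
  obtain ⟨C, hC, hup⟩ := S0_up D
  obtain ⟨M, hM, hlow⟩ := S0_low D
  set η : ℝ := 1 / (6 * C * M) with hη
  have hη0 : 0 < η := by positivity
  have hη1 : η ≤ 1 / (2 * M) := by
    rw [hη]; apply one_div_le_one_div_of_le (by positivity); nlinarith
  have hη2 : 1 / (2 * M) ≤ 1 := by rw [div_le_one (by positivity)]; linarith
  refine ⟨η, hη0, hη1.trans hη2, ?_⟩
  intro u hu huη J
  have hMu : M * u ≤ 1 := by
    have : M * u ≤ M * (1 / (2 * M)) := by gcongr; linarith
    have h2 : M * (1 / (2 * M)) = 1 / 2 := by field_simp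
    linarith
  have hl := hlow u hu hMu
  set v := u / η with hv
  have hv0 : 0 < v := by positivity
  have hv1 : v ≤ 1 := by rw [hv, div_le_one hη0]; exact huη
  have hu2 := hup v hv0 hv1
  have hterm : ∀ m, D.w 0 u m - 3 * D.w 0 v m ≤ (u / η) ^ J * D.w J u m := by
    intro m
    rcases eq_or_ne m 0 with rfl | hm
    · simp [AD.w, lam_zero_of D (zero_le_one)]
    have hmp : (0:ℝ) < m := by exact_mod_cast Nat.pos_of_ne_zero hm
    have hlm := Real.log_natCast_nonneg m
    rcases le_or_gt 1 (v * Real.log m) with h | h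
    · have h1 : D.w 0 u m ≤ (u / η) ^ J * D.w J u m := by
        have e : (u / η) ^ J * D.w J u m = (v * Real.log m) ^ J * D.w 0 u m := by
          rw [AD.w, AD.w, mul_pow]; ring
        rw [e]
        exact le_mul_of_one_le_left (w_nonneg D 0 u m) (one_le_pow₀ h)
      linarith [w_nonneg D 0 v m]
    · have h1 : D.w 0 u m ≤ 3 * D.w 0 v m := by
        rw [AD.w, AD.w]
        have e : (m:ℝ) ^ (-(1 + u)) ≤ 3 * (m:ℝ) ^ (-(1 + v)) := by
          have e1 : (m:ℝ) ^ (-(1 + u)) = (m:ℝ) ^ (v - u) * (m:ℝ) ^ (-(1 + v)) := by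
            rw [← Real.rpow_add hmp]; congr 1; ring
          rw [e1]
          gcongr
          rw [Real.rpow_def_of_pos hmp]
          have : Real.exp (Real.log m * (v - u)) ≤ Real.exp 1 := by
            apply Real.exp_le_exp.2; nlinarith
          linarith [Real.exp_one_lt_d9]
        have := D.lam_nonneg m
        calc _ ≤ D.lam m * Real.log m ^ 0 * (3 * (m:ℝ) ^ (-(1 + v))) := by gcongr
          _ = _ := by ring
      have h2 : 0 ≤ (u / η) ^ J * D.w J u m := mul_nonneg (by positivity) (w_nonneg D J u m)
      linarith
  have hs := Summable.tsum_le_tsum hterm ((w_summable D 0 hu).sub ((w_summable D 0 hv0).mul_left 3))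
    ((w_summable D J hu).mul_left _)
  rw [(w_summable D 0 hu).tsum_sub ((w_summable D 0 hv0).mul_left 3), tsum_mul_left, tsum_mul_left] at hs
  have e1 : 3 * (C / v) = 1 / (2 * M * u) := by rw [hv, hη]; field_simp; norm_num
  have e2 : 1 / (M * u) - 1 / (2 * M * u) = 1 / (2 * M * u) := by field_simp; norm_num
  have h5 : η / u ≤ 1 / (2 * M * u) := by
    rw [← div_div (1:ℝ) (2 * M) u]; gcongr
  have h6 : η / u ≤ (u / η) ^ J * ∑' m, D.w J u m := by linarith
  have e3 : (η / u) ^ J * (u / η) ^ J = 1 := by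
    rw [← mul_pow]; field_simp; simp
  calc (η / u) ^ (J + 1) = (η / u) ^ J * (η / u) := pow_succ _ _
    _ ≤ (η / u) ^ J * ((u / η) ^ J * ∑' m, D.w J u m) := by gcongr
    _ = _ := by rw [← mul_assoc, e3, one_mul]

end CS

namespace CS
open Finset Filter Topology LSeries
variable (D : AD)

/-- exceptional set -/
def Exc (L : ℕ) : Set ℕ := {m | IsPrimePow m ∧ (¬ m.Prime ∨ ¬ m.Coprime L)}

theorem pp_form {m : ℕ} (h : IsPrimePow m) (hn : ¬ m.Prime) : ∃ x : ℕ × ℕ, m = x.1 ^ 2 * x.2 ^ 3 := by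
  rw [isPrimePow_nat_iff] at h
  obtain ⟨p, k, hp, hk, rfl⟩ := h
  have hk1 : k ≠ 1 := by rintro rfl; exact hn (by simpa using hp)
  rcases Nat.even_or_odd k with he | ho
  · obtain ⟨t, rfl⟩ := he
    exact ⟨(p ^ t, 1), by simp; ring⟩
  · obtain ⟨t, rfl⟩ := ho
    obtain ⟨s, rfl⟩ : ∃ s, t = s + 1 := ⟨t - 1, by omega⟩
    exact ⟨(p ^ s, p), by simp; ring⟩

theorem exc_sum : ∃ C : ℝ, 1 ≤ C ∧ ∀ Q : Finset ℕ, (∀ q ∈ Q, q.Prime) → ∀ F : Finset ℕ, (∀ m ∈ F, m ∈ Exc (∏ q ∈ Q, q)) →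
    ∑ m ∈ F, (m : ℝ) ^ (-(3 / 4) : ℝ) ≤ C * (1 + Q.card) := by
  classical
  have hs1 : Summable (fun a : ℕ => (a:ℝ) ^ (-(3 / 2) : ℝ)) := Real.summable_nat_rpow.2 (by norm_num)
  have hs2 : Summable (fun a : ℕ => (a:ℝ) ^ (-(9 / 4) : ℝ)) := Real.summable_nat_rpow.2 (by norm_num)
  have hs := hs1.mul_of_nonneg hs2 (fun a => by positivity) (fun a => by positivity)
  set K := ∑' x : ℕ × ℕ, (x.1:ℝ) ^ (-(3 / 2) : ℝ) * (x.2:ℝ) ^ (-(9 / 4) : ℝ) with hK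
  have hK0 : 0 ≤ K := tsum_nonneg (fun x => by positivity)
  refine ⟨1 + K, by linarith, ?_⟩
  intro Q hQ F hF
  rw [← Finset.sum_filter_add_sum_filter_not F (fun m => ¬ m.Prime)]
  have h1 : ∑ m ∈ F with ¬ m.Prime, (m : ℝ) ^ (-(3 / 4) : ℝ) ≤ K := by
    have hx : ∀ m : ℕ, ∃ x : ℕ × ℕ, IsPrimePow m → ¬ m.Prime → m = x.1 ^ 2 * x.2 ^ 3 := by
      intro m
      by_cases h : IsPrimePow m ∧ ¬ m.Prime
      · obtain ⟨x, hx⟩ := pp_form h.1 h.2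
        exact ⟨x, fun _ _ => hx⟩
      · exact ⟨0, fun h1 h2 => absurd ⟨h1, h2⟩ h⟩
    choose x hx using hx
    have hx' : ∀ m ∈ F.filter (fun m => ¬ m.Prime), m = (x m).1 ^ 2 * (x m).2 ^ 3 := by
      intro m hm
      rw [Finset.mem_filter] at hm
      exact hx m (hF m hm.1).1 hm.2
    have hinj : Set.InjOn x (F.filter (fun m => ¬ m.Prime)) := by
      intro a ha b hb hab
      rw [hx' a ha, hx' b hb, hab]
    calc ∑ m ∈ F with ¬ m.Prime, (m : ℝ) ^ (-(3 / 4) : ℝ)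
        = ∑ m ∈ F with ¬ m.Prime, ((x m).1:ℝ) ^ (-(3 / 2) : ℝ) * ((x m).2:ℝ) ^ (-(9 / 4) : ℝ) := by
          apply Finset.sum_congr rfl
          intro m hm
          have : (m:ℝ) = ((x m).1:ℝ) ^ 2 * ((x m).2:ℝ) ^ 3 := by exact_mod_cast hx' m hm
          rw [this, Real.mul_rpow (by positivity) (by positivity), ← Real.rpow_natCast, ← Real.rpow_natCast,
            ← Real.rpow_mul (by positivity), ← Real.rpow_mul (by positivity)]
          norm_num
      _ = ∑ y ∈ (F.filter (fun m => ¬ m.Prime)).image x, (y.1:ℝ) ^ (-(3 / 2) : ℝ) * (y.2:ℝ) ^ (-(9 / 4) : ℝ) := by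
          rw [Finset.sum_image hinj]
      _ ≤ K := hs.sum_le_tsum _ (fun y _ => by positivity)
  have h2 : ∑ m ∈ F with ¬ ¬ m.Prime, (m : ℝ) ^ (-(3 / 4) : ℝ) ≤ Q.card := by
    calc ∑ m ∈ F with ¬ ¬ m.Prime, (m : ℝ) ^ (-(3 / 4) : ℝ) ≤ ∑ m ∈ F with ¬ ¬ m.Prime, (1:ℝ) := by
          apply Finset.sum_le_sum
          intro m hm
          simp only [not_not, Finset.mem_filter] at hm
          exact Real.rpow_le_one_of_one_le_of_nonpos (by exact_mod_cast hm.2.one_lt.le) (by norm_num)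
      _ = ((F.filter (fun m => ¬ ¬ m.Prime)).card : ℝ) := by simp
      _ ≤ _ := by
          exact_mod_cast Finset.card_le_card (fun m hm => by
            simp only [not_not, Finset.mem_filter] at hm
            have h3 := (hF m hm.1).2
            rcases h3 with h3 | h3
            · exact absurd hm.2 h3
            · rw [hm.2.coprime_iff_not_dvd, not_not, Prime.dvd_finsetProd_iff hm.2.prime] at h3
              obtain ⟨q, hq, hqd⟩ := h3
              rw [(Nat.prime_dvd_prime_iff_eq hm.2 (hQ q hq)).1 hqd]; exact hq)
  have h3 : (0:ℝ) ≤ Q.card := by positivity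
  nlinarith

open Classical in
theorem exc_w : ∃ C : ℝ, 1 ≤ C ∧ ∀ Q : Finset ℕ, (∀ q ∈ Q, q.Prime) → ∀ J : ℕ, ∀ u : ℝ, 0 < u →
    ∑' m, (if m ∈ Exc (∏ q ∈ Q, q) then D.w J u m else 0) ≤ C * (1 + Q.card) * ((J + 1).factorial * 4 ^ (J + 1)) := by
  obtain ⟨C, hC, h⟩ := exc_sum
  have hdeg1 : (1:ℝ) ≤ D.deg := by exact_mod_cast D.deg_pos
  refine ⟨D.deg * C, by nlinarith, ?_⟩
  intro Q hQ J u hu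
  apply Real.tsum_le_of_sum_le (fun m => by split_ifs; exacts [w_nonneg D J u m, le_refl _])
  intro F
  rw [← Finset.sum_filter]
  have hw : ∀ m : ℕ, D.w J u m ≤ D.deg * ((J + 1).factorial * 4 ^ (J + 1)) * (m:ℝ) ^ (-(3 / 4) : ℝ) := by
    intro m
    rcases eq_or_ne m 0 with rfl | hm
    · rw [AD.w, lam_zero_of D (zero_le_one), zero_mul, zero_mul]; positivity
    have hmp : (0:ℝ) < m := by exact_mod_cast Nat.pos_of_ne_zero hm
    have hm1 : (1:ℝ) ≤ m := by exact_mod_cast Nat.pos_of_ne_zero hm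
    have hl := Real.log_natCast_nonneg m
    have h1 := log_pow_le hm (J+1) (by norm_num : (0:ℝ) < 1/4)
    rw [one_div_one_div] at h1
    have h2 := D.dim m
    calc D.w J u m ≤ (D.deg * Real.log m) * Real.log m ^ J * (m:ℝ) ^ (-1 : ℝ) := by
          rw [AD.w]
          gcongr
          linarith
      _ = D.deg * Real.log m ^ (J + 1) * (m:ℝ) ^ (-1 : ℝ) := by ring
      _ ≤ D.deg * ((J + 1).factorial * 4 ^ (J + 1) * (m:ℝ) ^ (1 / 4 : ℝ)) * (m:ℝ) ^ (-1 : ℝ) := by gcongr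
      _ = D.deg * ((J + 1).factorial * 4 ^ (J + 1)) * ((m:ℝ) ^ (1 / 4 : ℝ) * (m:ℝ) ^ (-1 : ℝ)) := by ring
      _ = _ := by rw [← Real.rpow_add hmp]; norm_num
  calc _ ≤ ∑ m ∈ F with m ∈ Exc (∏ q ∈ Q, q), D.deg * ((J + 1).factorial * 4 ^ (J + 1)) * (m:ℝ) ^ (-(3 / 4) : ℝ) :=
        Finset.sum_le_sum (fun m _ => hw m)
    _ ≤ D.deg * ((J + 1).factorial * 4 ^ (J + 1)) * (C * (1 + Q.card)) := by
        rw [← Finset.mul_sum]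
        gcongr
        exact h Q hQ _ (fun m hm => (Finset.mem_filter.1 hm).2)
    _ = _ := by ring

open Classical in
theorem tail_w : ∃ C : ℝ, 1 ≤ C ∧ ∀ J : ℕ, ∀ u X : ℝ, 0 < u → u ≤ 1 →
    ∑' m : ℕ, (if X < Real.log m then D.w J u m else 0) ≤ Real.exp (-(u * X / 2)) * (J.factorial * (C / u) ^ (J + 1)) := by
  obtain ⟨C, hC, h⟩ := S0_up D
  refine ⟨4 * C, by linarith, ?_⟩
  intro J u X hu hu1
  have hterm : ∀ m : ℕ, (if X < Real.log m then D.w J u m else 0) ≤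
      Real.exp (-(u * X / 2)) * (J.factorial * (4 / u) ^ J) * D.w 0 (u / 4) m := by
    intro m
    have hr : 0 ≤ Real.exp (-(u * X / 2)) * (J.factorial * (4 / u) ^ J) * D.w 0 (u / 4) m :=
      mul_nonneg (by positivity) (w_nonneg D 0 _ m)
    split_ifs with hX
    swap
    · exact hr
    rcases eq_or_ne m 0 with rfl | hm
    · rw [AD.w, lam_zero_of D (zero_le_one), zero_mul, zero_mul]; exact hr
    have hmp : (0:ℝ) < m := by exact_mod_cast Nat.pos_of_ne_zero hm
    have h1 : D.w J u m ≤ Real.exp (-(u * X / 2)) * D.w J (u/2) m := by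
      have e : (m:ℝ) ^ (-(1 + u)) ≤ Real.exp (-(u * X / 2)) * (m:ℝ) ^ (-(1 + u / 2)) := by
        have e1 : (m:ℝ) ^ (-(1 + u)) = (m:ℝ) ^ (-(u / 2)) * (m:ℝ) ^ (-(1 + u/2)) := by
          rw [← Real.rpow_add hmp]; congr 1; ring
        rw [e1]
        gcongr
        rw [Real.rpow_def_of_pos hmp]
        apply Real.exp_le_exp.2
        nlinarith
      have h2 := D.lam_nonneg m
      have h3 := Real.log_natCast_nonneg m
      rw [AD.w, AD.w]
      calc _ ≤ D.lam m * Real.log m ^ J * (Real.exp (-(u * X / 2)) * (m:ℝ) ^ (-(1 + u / 2))) := by gcongr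
        _ = _ := by ring
    have h2 := w_le D J (u := u/2) (a := u/4) (by linarith) m
    rw [show u / 2 - u / 4 = u / 4 by ring, show 1 / (u / 4) = 4 / u by field_simp] at h2
    calc _ ≤ _ := h1
      _ ≤ Real.exp (-(u * X / 2)) * (J.factorial * (4 / u) ^ J * D.w 0 (u / 4) m) := by gcongr
      _ = _ := by ring
  have hS := (w_summable D 0 (by linarith : 0 < u / 4)).mul_left (Real.exp (-(u * X / 2)) * (J.factorial * (4 / u) ^ J))
  have hS' : Summable (fun m : ℕ => if X < Real.log m then D.w J u m else 0) :=
    Summable.of_nonneg_of_le (fun m => by split_ifs; exacts [w_nonneg D J u m, le_refl _]) hterm hS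
  have h4 := hS'.tsum_le_tsum hterm hS
  rw [tsum_mul_left] at h4
  have h5 := h (u/4) (by linarith) (by linarith)
  refine h4.trans ?_
  have h6 : 0 ≤ ∑' m, D.w 0 (u / 4) m := tsum_nonneg (w_nonneg D 0 _)
  rw [mul_assoc, mul_assoc]
  apply mul_le_mul_of_nonneg_left _ (Real.exp_nonneg _)
  apply mul_le_mul_of_nonneg_left _ (by positivity)
  calc (4 / u) ^ J * ∑' m, D.w 0 (u / 4) m ≤ (4 * C / u) ^ J * (C / (u / 4)) := by
        gcongr; nlinarith
    _ = _ := by rw [pow_succ]; congr 1; field_simp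

theorem logMul_iter (f : ℕ → ℂ) (J m : ℕ) : logMul^[J] f m = (Real.log m : ℂ) ^ J * f m := by
  induction J generalizing f with
  | zero => simp
  | succ J ih => rw [Function.iterate_succ_apply, ih, logMul, ← Complex.natCast_log]; ring

theorem E_hasSum {f : ℕ → ℂ} (hf : CM f) (J : ℕ) {u : ℝ} (hu : 0 < u) :
    HasSum (fun m => f m * (D.w J u m : ℂ)) ((-1) ^ J * iteratedDeriv J (LSeries (D.lt f)) ((1 + u : ℝ) : ℂ)) := by
  have ha := one_lt_of (absc_lt D hf) (s := ((1 + u : ℝ) : ℂ)) (by rw [Complex.ofReal_re]; linarith)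
  rw [LSeries_iteratedDeriv J ha, ← mul_assoc, ← mul_pow]
  have h2 : LSeriesSummable (logMul^[J] (D.lt f)) ((1 + u : ℝ) : ℂ) := by
    apply LSeriesSummable_of_abscissaOfAbsConv_lt_re
    rw [absicssaOfAbsConv_logPowMul]; exact ha
  have h3 := h2.hasSum
  simp only [mul_neg, mul_one, neg_neg, one_pow, one_mul]
  refine h3.congr_fun ?_ |> fun h' => h'
  intro m
  rcases eq_or_ne m 0 with rfl | hm
  · simp [AD.w, lam_zero_of D (zero_le_one)]
  rw [term_of_ne_zero hm, logMul_iter, AD.lt, AD.w, Real.rpow_neg (by positivity)]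
  push_cast [Complex.ofReal_cpow (Nat.cast_nonneg m)]
  field_simp

theorem sum_changeLevel {d L : ℕ} [NeZero L] [NeZero d] (hd : d ∣ L) (m : ℕ) :
    ∑ χ : DirichletCharacter ℂ d, chf (χ.changeLevel hd) m =
      if (m : ZMod d) = 1 ∧ m.Coprime L then (d.totient : ℂ) else 0 := by
  by_cases hc : m.Coprime L
  · have h1 : ∀ χ : DirichletCharacter ℂ d, chf (χ.changeLevel hd) m = χ (m : ZMod d) := by
      intro χ
      have := DirichletCharacter.changeLevel_eq_cast_of_dvd' (χ := χ) hd (a := (m:ℤ)) (Nat.isCoprime_iff_coprime.2 hc)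
      simpa [chf] using this
    rw [Finset.sum_congr rfl (fun χ _ => h1 χ), DirichletCharacter.sum_characters_eq]
    by_cases h2 : (m : ZMod d) = 1
    · rw [if_pos h2, if_pos ⟨h2, hc⟩]
    · rw [if_neg h2, if_neg (fun h => h2 h.1)]
  · have h1 : ∀ χ : DirichletCharacter ℂ d, chf (χ.changeLevel hd) m = 0 := by
      intro χ
      rw [chf]
      apply MulChar.map_nonunit
      rwa [ZMod.isUnit_iff_coprime]
    rw [Finset.sum_congr rfl (fun χ _ => h1 χ), if_neg (fun h => hc h.2), Finset.sum_const_zero]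

end CS

namespace CS
open Finset Filter Topology LSeries
variable (D : AD)

/-- restricted weighted sum -/
noncomputable def AD.S (J : ℕ) (u : ℝ) (p : Set ℕ) : ℝ := ∑' m, p.indicator (D.w J u) m

theorem S_hasSum (J : ℕ) {u : ℝ} (hu : 0 < u) (p : Set ℕ) : HasSum (p.indicator (D.w J u)) (D.S J u p) :=
  ((w_summable D J hu).indicator p).hasSum

theorem S_nonneg (J : ℕ) (u : ℝ) (p : Set ℕ) : 0 ≤ D.S J u p :=
  tsum_nonneg (fun m => Set.indicator_nonneg (fun m _ => w_nonneg D J u m) m)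

theorem S_mono (J : ℕ) {u : ℝ} (hu : 0 < u) {p q : Set ℕ} (h : ∀ m ∈ p, IsPrimePow m → m ∈ q) :
    D.S J u p ≤ D.S J u q := by
  refine hasSum_le ?_ (S_hasSum D J hu p) (S_hasSum D J hu q)
  intro m
  have hwm := w_nonneg D J u m
  by_cases hz : D.w J u m = 0
  · rw [Set.indicator_apply_eq_zero.2 (fun _ => hz), Set.indicator_apply_eq_zero.2 (fun _ => hz)]
  have hpp : IsPrimePow m := D.supp m (fun h => hz (by rw [AD.w, h]; ring))
  by_cases hm : m ∈ p
  · rw [Set.indicator_of_mem hm, Set.indicator_of_mem (h m hm hpp)]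
  · rw [Set.indicator_of_notMem hm]
    exact Set.indicator_nonneg (fun m _ => w_nonneg D J u m) m

theorem S_union (J : ℕ) {u : ℝ} (hu : 0 < u) (p q : Set ℕ) :
    D.S J u (p ∪ q) ≤ D.S J u p + D.S J u q := by
  refine hasSum_le ?_ (S_hasSum D J hu _) ((S_hasSum D J hu p).add (S_hasSum D J hu q))
  intro m
  have h0 : ∀ s : Set ℕ, 0 ≤ s.indicator (D.w J u) m :=
    fun s => Set.indicator_nonneg (fun m _ => w_nonneg D J u m) m
  by_cases hp : m ∈ p
  · rw [Set.indicator_of_mem (s := p ∪ q) (Or.inl hp), Set.indicator_of_mem hp]; linarith [h0 q]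
  by_cases hq : m ∈ q
  · rw [Set.indicator_of_mem (s := p ∪ q) (Or.inr hq), Set.indicator_of_mem hq]; linarith [h0 p]
  · rw [Set.indicator_of_notMem (fun h => h.elim hp hq)]; linarith [h0 p, h0 q]

theorem S_finset (J : ℕ) (u : ℝ) (P : Finset ℕ) : D.S J u (P : Set ℕ) = ∑ m ∈ P, D.w J u m := by
  classical
  rw [AD.S, tsum_eq_sum (s := P) (fun m hm => Set.indicator_of_notMem (by simpa using hm) _)]
  exact Finset.sum_congr rfl (fun m hm => Set.indicator_of_mem (by simpa using hm) _)

theorem S_exc : ∃ C : ℝ, 1 ≤ C ∧ ∀ Q : Finset ℕ, (∀ q ∈ Q, q.Prime) → ∀ L : ℕ, L = ∏ q ∈ Q, q →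
    ∀ J : ℕ, ∀ u : ℝ, 0 < u →
    D.S J u (Exc L) ≤ C * (1 + Q.card) * ((J + 1).factorial * 4 ^ (J + 1)) := by
  obtain ⟨C, hC, h⟩ := exc_w D
  refine ⟨C, hC, ?_⟩
  intro Q hQ L hL J u hu
  have := h Q hQ J u hu
  rw [← hL] at this
  exact this

theorem S_tail : ∃ C : ℝ, 1 ≤ C ∧ ∀ J : ℕ, ∀ u X : ℝ, 0 < u → u ≤ 1 →
    D.S J u {m | X < Real.log m} ≤ Real.exp (-(u * X / 2)) * (J.factorial * (C / u) ^ (J + 1)) := by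
  obtain ⟨C, hC, h⟩ := tail_w D
  refine ⟨C, hC, ?_⟩
  intro J u X hu hu1
  have := h J u X hu hu1
  exact this

theorem S_char {d L : ℕ} [NeZero L] [NeZero d] (hd : d ∣ L) (J : ℕ) {u : ℝ} (hu : 0 < u) :
    ∑ χ : DirichletCharacter ℂ d,
      ((-1) ^ J * iteratedDeriv J (LSeries (D.lt (chf (χ.changeLevel hd)))) ((1 + u : ℝ) : ℂ)) =
    (d.totient : ℂ) * (D.S J u {m | (m : ZMod d) = 1 ∧ m.Coprime L} : ℂ) := by
  have h1 : HasSum (fun m => ∑ χ : DirichletCharacter ℂ d, chf (χ.changeLevel hd) m * (D.w J u m : ℂ))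
      (∑ χ : DirichletCharacter ℂ d,
      ((-1) ^ J * iteratedDeriv J (LSeries (D.lt (chf (χ.changeLevel hd)))) ((1 + u : ℝ) : ℂ))) :=
    hasSum_sum (fun χ _ => E_hasSum D (chf_CM _) J hu)
  have h2 := (Complex.hasSum_ofReal.2 (S_hasSum D J hu {m | (m : ZMod d) = 1 ∧ m.Coprime L})).mul_left (d.totient : ℂ)
  refine h1.unique ?_
  have hfun : (fun m => ∑ χ : DirichletCharacter ℂ d, chf (χ.changeLevel hd) m * (D.w J u m : ℂ)) =
      fun m => (d.totient : ℂ) * ((Set.indicator {m : ℕ | (m : ZMod d) = 1 ∧ m.Coprime L} (D.w J u) m : ℝ) : ℂ) := by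
    funext m
    rw [← Finset.sum_mul, sum_changeLevel hd]
    by_cases hm : (m : ZMod d) = 1 ∧ m.Coprime L
    · rw [if_pos hm, Set.indicator_of_mem (s := {m : ℕ | (m : ZMod d) = 1 ∧ m.Coprime L}) hm]
    · rw [if_neg hm, Set.indicator_of_notMem (s := {m : ℕ | (m : ZMod d) = 1 ∧ m.Coprime L}) hm]; simp
  rw [hfun]
  exact h2

theorem S_triv {L : ℕ} [NeZero L] (J : ℕ) {u : ℝ} (hu : 0 < u) :
    ((-1) ^ J * iteratedDeriv J (LSeries (D.lt (chf (1 : DirichletCharacter ℂ L)))) ((1 + u : ℝ) : ℂ)) =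
    (D.S J u {m | m.Coprime L} : ℂ) := by
  refine (E_hasSum D (chf_CM _) J hu).unique ?_
  have hfun : (fun m => chf (1 : DirichletCharacter ℂ L) m * (D.w J u m : ℂ)) =
      fun m => ((Set.indicator {m : ℕ | m.Coprime L} (D.w J u) m : ℝ) : ℂ) := by
    funext m
    rw [chf]
    by_cases hm : m.Coprime L
    · rw [MulChar.one_apply ((ZMod.isUnit_iff_coprime m L).2 hm), one_mul,
        Set.indicator_of_mem (s := {m : ℕ | m.Coprime L}) hm]
    · rw [MulChar.map_nonunit _ (fun h => hm ((ZMod.isUnit_iff_coprime m L).1 h)),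
        Set.indicator_of_notMem (s := {m : ℕ | m.Coprime L}) hm]; simp
  rw [hfun]
  exact Complex.hasSum_ofReal.2 (S_hasSum D J hu {m | m.Coprime L})

/-- orthogonality step -/
theorem orth_step {d L : ℕ} [NeZero L] [NeZero d] (hd : d ∣ L) (J : ℕ) {u B : ℝ} (hu : 0 < u) (hB0 : 0 ≤ B)
    (hB : ∀ χ : DirichletCharacter ℂ d, χ ≠ 1 →
      ‖iteratedDeriv J (LSeries (D.lt (chf (χ.changeLevel hd)))) ((1 + u : ℝ) : ℂ)‖ ≤ B) :
    D.S J u {m | m.Coprime L} / d - B ≤ D.S J u {m | (m : ZMod d) = 1 ∧ m.Coprime L} := by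
  classical
  have hsum := S_char D hd J hu
  have hone := S_triv D (L := L) J hu
  have hE0 := S_nonneg D J u {m | m.Coprime L}
  generalize D.S J u {m | (m : ZMod d) = 1 ∧ m.Coprime L} = T at *
  generalize D.S J u {m | m.Coprime L} = E1 at *
  have hcard : (Finset.univ : Finset (DirichletCharacter ℂ d)).card = d.totient := by
    rw [Finset.card_univ, ← Nat.card_eq_fintype_card]
    exact DirichletCharacter.card_eq_totient_of_hasEnoughRootsOfUnity ℂ d
  have htot : 0 < d.totient := Nat.totient_pos.2 (Nat.pos_of_ne_zero (NeZero.ne d))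
  obtain ⟨E, hE⟩ : ∃ E : DirichletCharacter ℂ d → ℂ, E = fun χ =>
    (-1) ^ J * iteratedDeriv J (LSeries (D.lt (chf (χ.changeLevel hd)))) ((1 + u : ℝ) : ℂ) := ⟨_, rfl⟩
  have hsum' : ∑ χ, E χ = (d.totient : ℂ) * (T : ℂ) := by rw [hE]; exact hsum
  have hone' : E 1 = (E1 : ℂ) := by rw [hE]; simp only [map_one]; exact hone
  have hB' : ∀ χ : DirichletCharacter ℂ d, χ ≠ 1 → ‖E χ‖ ≤ B := by
    intro χ hχ
    have := hB χ hχ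
    rw [hE]
    simpa using this
  clear hE hsum hone hB
  have h3 : ‖∑ χ ∈ Finset.univ.erase 1, E χ‖ ≤ d.totient * B := by
    refine (norm_sum_le _ _).trans ?_
    calc _ ≤ ∑ χ ∈ (Finset.univ : Finset (DirichletCharacter ℂ d)).erase 1, B :=
          Finset.sum_le_sum (fun χ hχ => hB' χ (Finset.ne_of_mem_erase hχ))
      _ = ((Finset.univ : Finset (DirichletCharacter ℂ d)).erase 1).card * B := by
          rw [Finset.sum_const, nsmul_eq_mul]
      _ ≤ d.totient * B := by
          rw [← hcard]
          gcongr
          exact Finset.erase_subset _ _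
  rw [← Finset.add_sum_erase _ _ (Finset.mem_univ 1), hone'] at hsum'
  have h4 : E1 - d.totient * B ≤ d.totient * T := by
    have h5 : (∑ χ ∈ Finset.univ.erase 1, E χ) = ((d.totient * T - E1 : ℝ) : ℂ) := by
      push_cast; rw [← hsum']; ring
    rw [h5, Complex.norm_real, Real.norm_eq_abs, abs_le] at h3
    linarith [h3.1]
  have htot' : (0:ℝ) < d.totient := by exact_mod_cast htot
  have h6 : E1 / d ≤ E1 / d.totient := by
    gcongr
    exact Nat.totient_le d
  have h7 : E1 / d.totient - B ≤ T := by
    have : E1 / d.totient - B = (E1 - d.totient * B) / d.totient := by field_simp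
    rw [this, div_le_iff₀ htot']; linarith
  linarith

end CS

namespace CS
open Finset Filter Topology LSeries
variable (D : AD)

theorem fact_le (N : ℕ) : (N.factorial : ℝ) ≤ (N:ℝ) ^ N := by exact_mod_cast Nat.factorial_le_pow N

theorem fact_le1 (J : ℕ) : ((J + 1).factorial : ℝ) ≤ ((J:ℝ) + 1) ^ (J + 1) := by
  have := fact_le (J + 1); exact_mod_cast this

theorem fact_le2 (J : ℕ) : (J.factorial : ℝ) ≤ ((J:ℝ) + 1) ^ (J + 1) := by
  refine le_trans ?_ (fact_le1 J)
  exact_mod_cast Nat.factorial_le (by omega)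

theorem eng_u {C A c C1 N Λ u d : ℝ} {J : ℕ} (hc0 : 0 < c) (hc1 : c ≤ 1) (hA1 : 1 ≤ A) (hCc : C * c = A)
    (hC : 1 ≤ C) (hN1 : 1 ≤ N) (hΛ1 : 1 ≤ Λ) (hd1 : 1 ≤ d) (hu : 0 < u) (hC1 : 1 ≤ C1) (hCA : C1 ^ 56 ≤ C)
    (hy1 : d * (C * N * Λ ^ 114) ^ (J + 1) ≤ (1 / u) ^ (J + 1)) :
    u ≤ c ∧ u ≤ 1 / (C1 * Λ ^ 2) ^ 16 := by
  have hubase : C * N * Λ ^ 114 ≤ 1 / u := by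
    have h1 : (C * N * Λ ^ 114) ^ (J + 1) ≤ (1 / u) ^ (J + 1) := by
      refine le_trans ?_ hy1
      exact le_mul_of_one_le_left (by positivity) hd1
    exact le_of_pow_le_pow_left₀ (by omega) (by positivity) h1
  have hCN : C ≤ C * N := le_mul_of_one_le_right (by linarith) hN1
  have hCle : C * Λ ^ 114 ≤ 1 / u := by
    refine le_trans ?_ hubase
    gcongr
  have hCu : C * u ≤ 1 := by
    have h1 : C ≤ 1 / u := le_trans (le_mul_of_one_le_right (by linarith) (one_le_pow₀ hΛ1)) hCle
    rw [le_div_iff₀ hu] at h1; exact h1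
  constructor
  · have h1 : A * u ≤ c := by
      have : C * u * c = A * u := by rw [← hCc]; ring
      rw [← this]; nlinarith
    nlinarith
  · rw [le_div_iff₀ (by positivity), mul_comm, ← le_div_iff₀ hu]
    refine le_trans ?_ hCle
    have h1 : C1 ^ 16 ≤ C1 ^ 56 := pow_le_pow_right₀ hC1 (by norm_num)
    have h2 : C1 ^ 16 ≤ C := h1.trans hCA
    have h3 : Λ ^ 32 ≤ Λ ^ 114 := pow_le_pow_right₀ hΛ1 (by norm_num)
    rw [mul_pow, ← pow_mul]
    exact mul_le_mul h2 h3 (by positivity) (by linarith)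

theorem eng_y {C A c N Λ u d : ℝ} {J : ℕ} (hc0 : 0 < c) (hCc : C * c = A) (hu : 0 < u)
    (hy1 : d * (C * N * Λ ^ 114) ^ (J + 1) ≤ (1 / u) ^ (J + 1)) :
    d * (A * N * Λ ^ 114) ^ (J + 1) ≤ (c / u) ^ (J + 1) := by
  generalize Λ ^ 114 = M at *
  have e1 : (A * N * M) = c * (C * N * M) := by rw [← hCc]; ring
  have e2 : (c / u) ^ (J + 1) = c ^ (J + 1) * (1 / u) ^ (J + 1) := by rw [← mul_pow]; congr 1; ring
  rw [e1, e2, mul_pow]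
  calc _ = c ^ (J + 1) * (d * (C * N * M) ^ (J + 1)) := by ring
    _ ≤ _ := by gcongr

theorem eng_B {A C1 Λ d y : ℝ} {J : ℕ} (hC1 : 1 ≤ C1) (hΛ1 : 1 ≤ Λ) (hd1 : 1 ≤ d)
    (hA : 64 * C1 ^ 56 ≤ A) (hy : d * (A * ((J:ℝ) + 1) * Λ ^ 114) ^ (J + 1) ≤ y) :
    8 * d * (J.factorial * (4 * (C1 * Λ ^ 2) ^ 56) ^ (J + 1)) ≤ y := by
  refine le_trans ?_ hy
  rw [mul_pow C1, ← pow_mul]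
  have h3 : Λ ^ (2 * 56) ≤ Λ ^ 114 := pow_le_pow_right₀ hΛ1 (by norm_num)
  have h4 : 0 ≤ C1 ^ 56 := by positivity
  have h5 : 0 ≤ Λ ^ (2 * 56) := by positivity
  generalize Λ ^ 114 = M at *
  generalize Λ ^ (2 * 56) = M' at *
  generalize C1 ^ 56 = K at *
  have h8 : (8:ℝ) ≤ 8 ^ (J + 1) := le_self_pow₀ (by norm_num) (by omega)
  have hf := fact_le2 J
  have h1 : 8 * (J.factorial * (4 * (K * M')) ^ (J + 1)) ≤ (A * ((J:ℝ) + 1) * M) ^ (J + 1) := by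
    calc 8 * (J.factorial * (4 * (K * M')) ^ (J + 1)) ≤
          8 ^ (J + 1) * (((J:ℝ) + 1) ^ (J + 1) * (4 * (K * M')) ^ (J + 1)) := by gcongr
      _ = (32 * K * ((J:ℝ) + 1) * M') ^ (J + 1) := by rw [← mul_pow, ← mul_pow]; congr 1; ring
      _ ≤ _ := by
          have : 32 * K ≤ A := by linarith
          have hA0 : 0 ≤ A := by linarith
          gcongr
  calc _ = d * (8 * (J.factorial * (4 * (K * M')) ^ (J + 1))) := by ring
    _ ≤ _ := by gcongr

theorem eng_X {A C2 Λ d y q X1 : ℝ} {J : ℕ} (hC2 : 1 ≤ C2) (hΛ1 : 1 ≤ Λ) (hd1 : 1 ≤ d)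
    (hA : 64 * C2 ≤ A) (hy : d * (A * ((J:ℝ) + 1) * Λ ^ 114) ^ (J + 1) ≤ y) (hq : 1 + q ≤ 2 * Λ)
    (hX : X1 ≤ C2 * (1 + q) * ((J + 1).factorial * 4 ^ (J + 1))) :
    8 * d * X1 ≤ y := by
  refine le_trans ?_ hy
  have h3 : Λ ≤ Λ ^ 114 := le_self_pow₀ hΛ1 (by norm_num)
  generalize Λ ^ 114 = M at *
  have hf := fact_le1 J
  have h8 : 16 * C2 * Λ ≤ (16 * C2 * Λ) ^ (J + 1) := le_self_pow₀ (by nlinarith) (by omega)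
  have h1 : 8 * X1 ≤ (A * ((J:ℝ) + 1) * M) ^ (J + 1) := by
    calc 8 * X1 ≤ 8 * (C2 * (2 * Λ) * (((J:ℝ) + 1) ^ (J + 1) * 4 ^ (J + 1))) := by
          refine mul_le_mul_of_nonneg_left (hX.trans ?_) (by norm_num)
          gcongr
      _ = (16 * C2 * Λ) * (((J:ℝ) + 1) ^ (J + 1) * 4 ^ (J + 1)) := by ring
      _ ≤ (16 * C2 * Λ) ^ (J + 1) * (((J:ℝ) + 1) ^ (J + 1) * 4 ^ (J + 1)) := by gcongr
      _ = (64 * C2 * ((J:ℝ) + 1) * Λ) ^ (J + 1) := by rw [← mul_pow, ← mul_pow]; congr 1; ring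
      _ ≤ _ := by
          have hA0 : 0 ≤ A := by linarith
          gcongr
  calc _ = d * (8 * X1) := by ring
    _ ≤ _ := by gcongr

theorem eng_T {A C C3 c d u e T1 : ℝ} {J : ℕ} (hC3 : 1 ≤ C3) (hd1 : 1 ≤ d) (hC : 1 ≤ C) (hc0 : 0 < c) (hu : 0 < u)
    (hCc : C * c = A) (hA : 64 * C3 ≤ A)
    (hy2 : d * (C * ((J:ℝ) + 1)) ^ (J + 1) ≤ Real.exp e)
    (hT : T1 ≤ Real.exp (-e) * (J.factorial * (C3 / u) ^ (J + 1))) :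
    8 * d * T1 ≤ (c / u) ^ (J + 1) := by
  have hf := fact_le2 J
  have hN : (0:ℝ) < (J:ℝ) + 1 := by positivity
  generalize ((J:ℝ) + 1) = N at *
  have hCN0 : 0 < (C * N) ^ (J + 1) := by positivity
  have h2 : d * Real.exp (-e) ≤ 1 / (C * N) ^ (J + 1) := by
    rw [le_div_iff₀ hCN0, Real.exp_neg, mul_right_comm, ← div_eq_mul_inv, div_le_one (Real.exp_pos _)]
    exact hy2
  have h8 : (8:ℝ) ≤ 8 ^ (J + 1) := le_self_pow₀ (by norm_num) (by omega)
  calc 8 * d * T1 ≤ 8 * d * (Real.exp (-e) * (J.factorial * (C3 / u) ^ (J + 1))) := by gcongr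
    _ = 8 * (d * Real.exp (-e)) * (J.factorial * (C3 / u) ^ (J + 1)) := by ring
    _ ≤ 8 ^ (J + 1) * (1 / (C * N) ^ (J + 1)) * (N ^ (J + 1) * (C3 / u) ^ (J + 1)) := by gcongr
    _ = (8 * C3 / (C * u)) ^ (J + 1) := by
        rw [← one_div_pow, ← mul_pow, ← mul_pow, ← mul_pow]; congr 1; field_simp
    _ ≤ _ := by
        gcongr ?_ ^ _
        rw [div_le_div_iff₀ (by positivity) hu]
        have h4 : 8 * C3 ≤ c * C := by rw [mul_comm c C, hCc]; linarith
        calc 8 * C3 * u ≤ c * C * u := by gcongr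
          _ = _ := by ring

theorem eng_card {Q : Finset ℕ} (hQp : ∀ q ∈ Q, q.Prime) {L : ℕ} (hL : L = ∏ q ∈ Q, q) :
    (1 + Q.card : ℝ) ≤ 2 * (1 + Real.log L) := by
  have h2 : 2 ^ Q.card ≤ L := by
    rw [hL, ← Finset.prod_const]
    exact Finset.prod_le_prod' (fun q hq => (hQp q hq).two_le)
  have h3 : (2:ℝ) ^ Q.card ≤ L := by exact_mod_cast h2
  have h4 := Real.log_le_log (by positivity) h3
  rw [Real.log_pow] at h4
  have h5 := Real.log_two_gt_d9
  have h6 : (0:ℝ) ≤ Q.card := by positivity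
  nlinarith

theorem eng_up (J : ℕ) {u : ℝ} (hu : 0 < u) (P : Finset ℕ) :
    ∑ m ∈ P, D.w J u m ≤ D.deg * (((J:ℝ) + 1) ^ (J + 1) * (1 / u) ^ (J + 1)) * ∑ p ∈ P, 1 / (p : ℝ) := by
  rw [Finset.mul_sum]
  apply Finset.sum_le_sum
  intro m _
  rcases eq_or_ne m 0 with rfl | hm
  · simp [AD.w, lam_zero_of D (zero_le_one)]
  have hmp : (0:ℝ) < m := by exact_mod_cast Nat.pos_of_ne_zero hm
  have hl := Real.log_natCast_nonneg m
  have h1 := log_pow_le hm (J+1) hu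
  have h2 := D.dim m
  have hf := fact_le1 J
  calc D.w J u m ≤ (D.deg * Real.log m) * Real.log m ^ J * (m:ℝ) ^ (-(1 + u)) := by
        rw [AD.w]
        gcongr
    _ = D.deg * Real.log m ^ (J + 1) * (m:ℝ) ^ (-(1 + u)) := by ring
    _ ≤ D.deg * (((J:ℝ) + 1) ^ (J + 1) * (1 / u) ^ (J + 1) * (m:ℝ) ^ u) * (m:ℝ) ^ (-(1 + u)) := by
        refine mul_le_mul_of_nonneg_right (mul_le_mul_of_nonneg_left (h1.trans ?_) (by positivity)) (by positivity)
        gcongr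
    _ = D.deg * (((J:ℝ) + 1) ^ (J + 1) * (1 / u) ^ (J + 1)) * ((m:ℝ) ^ u * (m:ℝ) ^ (-(1 + u))) := by ring
    _ = _ := by
        rw [← Real.rpow_add hmp, show u + -(1 + u) = -1 by ring, Real.rpow_neg_one, one_div (m:ℝ)]

theorem eng_cover {Q : Finset ℕ} {L d : ℕ} (hL : L = ∏ q ∈ Q, q) (J : ℕ) {u X : ℝ} (hu : 0 < u) (P : Finset ℕ)
    (hP : ∀ p, D.good p → (p : ZMod d) = 1 → p ∉ Q → (p : ℝ) ≤ Real.exp X → p ∈ P) :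
    D.S J u {m | (m : ZMod d) = 1 ∧ m.Coprime L} ≤
      ∑ m ∈ P, D.w J u m + D.S J u (Exc L) + D.S J u {m | X < Real.log m} := by
  have h0 : D.S J u {m | (m : ZMod d) = 1 ∧ m.Coprime L} ≤
      D.S J u (({m | m.Prime ∧ D.lam m = 0} ∪ (P : Set ℕ)) ∪ Exc L ∪ {m | X < Real.log m}) := by
    apply S_mono D J hu
    rintro m ⟨h1, h2⟩ hpp
    by_cases h3 : m ∈ Exc L
    · exact Or.inl (Or.inr h3)
    by_cases h4 : X < Real.log m
    · exact Or.inr h4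
    left; left
    have hprime : m.Prime := by
      by_contra hc; exact h3 ⟨hpp, Or.inl hc⟩
    by_cases hlam : D.lam m = 0
    · exact Or.inl ⟨hprime, hlam⟩
    right
    have hgood : D.good m := D.supp1 m hprime hlam
    have hnQ : m ∉ Q := by
      intro hmQ
      have h5 : m ∣ L := by rw [hL]; exact Finset.dvd_prod_of_mem _ hmQ
      exact (hprime.coprime_iff_not_dvd.1 h2) h5
    have hmX : (m:ℝ) ≤ Real.exp X := by
      rw [← Real.log_le_iff_le_exp (by exact_mod_cast hprime.pos)]
      push Not at h4; exact h4
    exact hP m hgood h1 hnQ hmX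
  have h1 := S_union D J hu ({m | m.Prime ∧ D.lam m = 0} ∪ (P : Set ℕ) ∪ Exc L) {m | X < Real.log m}
  have h2 := S_union D J hu ({m | m.Prime ∧ D.lam m = 0} ∪ (P : Set ℕ)) (Exc L)
  have h3 := S_union D J hu {m | m.Prime ∧ D.lam m = 0} (P : Set ℕ)
  have h4 : D.S J u {m | m.Prime ∧ D.lam m = 0} = 0 := by
    rw [AD.S]
    convert tsum_zero with m
    apply Set.indicator_apply_eq_zero.2
    rintro ⟨_, h⟩
    rw [AD.w, h]; ring
  rw [S_finset] at h3
  linarith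

theorem eng_total (L : ℕ) (J : ℕ) {u : ℝ} (hu : 0 < u) :
    ∑' m, D.w J u m ≤ D.S J u {m | m.Coprime L} + D.S J u (Exc L) := by
  have h0 : ∑' m, D.w J u m = D.S J u Set.univ := by rw [AD.S, Set.indicator_univ]
  rw [h0]
  refine le_trans (S_mono D J hu ?_) (S_union D J hu _ _)
  intro m _ hpp
  by_cases h1 : m.Coprime L
  · exact Or.inl h1
  · exact Or.inr ⟨hpp, Or.inr h1⟩

theorem eng_fin {A C c d u W R N deg : ℝ} {J : ℕ} (hc0 : 0 < c) (hu : 0 < u) (hd : 1 ≤ d) (hN : 1 ≤ N)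
    (hdeg : 1 ≤ deg) (hCc : C * c = A) (hA : 64 * deg ≤ A) (h1 : (c / u) ^ (J + 1) / (2 * d) ≤ W)
    (h2 : W ≤ deg * (N ^ (J + 1) * (1 / u) ^ (J + 1)) * R) :
    1 / (d * (C * N) ^ (J + 1)) ≤ R := by
  have h10 := h1.trans h2
  have hK0 : 0 < deg * (N ^ (J + 1) * (1 / u) ^ (J + 1)) := by positivity
  rw [← div_le_iff₀' hK0] at h10
  refine le_trans ?_ h10
  have e : (c / u) ^ (J + 1) / (2 * d) / (deg * (N ^ (J + 1) * (1 / u) ^ (J + 1))) = 1 / (d * (2 * deg * (N / c) ^ (J + 1))) := by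
    rw [div_pow c u, div_pow N c, one_div_pow]
    field_simp
  rw [e]
  apply one_div_le_one_div_of_le (by positivity)
  have hp : 2 * deg ≤ (2 * deg) ^ (J + 1) := le_self_pow₀ (by linarith) (by omega)
  refine mul_le_mul_of_nonneg_left ?_ (by linarith)
  calc 2 * deg * (N / c) ^ (J + 1) ≤ (2 * deg) ^ (J + 1) * (N / c) ^ (J + 1) := by gcongr
    _ = (2 * deg * (N / c)) ^ (J + 1) := by rw [← mul_pow]
    _ ≤ (C * N) ^ (J + 1) := by
        have h6 : 2 * deg * (N / c) ≤ C * N := by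
          rw [← mul_div_assoc, div_le_iff₀ hc0]
          calc 2 * deg * N ≤ A * N := by gcongr; linarith
            _ = C * N * c := by rw [← hCc]; ring
        gcongr

theorem engine : ∃ C : ℝ, 1 ≤ C ∧ ∀ Q : Finset ℕ, (∀ q ∈ Q, D.good q ∧ D.N0 < q) → ∀ L : ℕ, L = ∏ q ∈ Q, q →
    ∃ q0 : ℕ, ∀ d, d ∣ L → q0 ∉ d.primeFactors → ∀ J : ℕ, ∀ u X : ℝ, 0 < u →
    d * (C * (J + 1) * (1 + Real.log L) ^ 114) ^ (J + 1) ≤ (1 / u) ^ (J + 1) →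
    d * (C * (J + 1)) ^ (J + 1) ≤ Real.exp (u * X / 2) →
    ∀ P : Finset ℕ, (∀ p, D.good p → (p : ZMod d) = 1 → p ∉ Q → (p : ℝ) ≤ Real.exp X → p ∈ P) →
    1 / (d * (C * (J + 1)) ^ (J + 1)) ≤ ∑ p ∈ P, 1 / (p : ℝ) := by
  obtain ⟨C1, hC1, hzf⟩ := zero_free' D
  obtain ⟨C2, hC2, hexc⟩ := S_exc D
  obtain ⟨C3, hC3, htail⟩ := S_tail D
  obtain ⟨c, hc0, hc1, hlow⟩ := SJ_low D
  have hdeg1 : (1:ℝ) ≤ D.deg := by exact_mod_cast D.deg_pos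
  have hC1p : 1 ≤ C1 ^ 56 := one_le_pow₀ hC1
  obtain ⟨A, hA⟩ : ∃ A : ℝ, A = 64 * (C1 ^ 56 + C2 + C3 + D.deg) := ⟨_, rfl⟩
  have hA1 : 1 ≤ A := by rw [hA]; linarith
  obtain ⟨C, hC⟩ : ∃ C : ℝ, C = A / c := ⟨_, rfl⟩
  have hAC : A ≤ C := by rw [hC, le_div_iff₀ hc0]; nlinarith
  have hCc : C * c = A := by rw [hC]; field_simp
  have hC1' : 1 ≤ C := by linarith
  refine ⟨C, hC1', ?_⟩
  intro Q hQ L hL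
  obtain ⟨q0, hq0⟩ := hzf Q hQ L hL _ rfl
  refine ⟨q0, ?_⟩
  intro d hd hdq J u X hu hy1 hy2 P hP
  have hQp : ∀ q ∈ Q, q.Prime := fun q hq => D.good_prime q (hQ q hq).1
  have hLpos : 0 < L := by
    rw [hL]; exact Finset.prod_pos (fun p hp => (hQp p hp).pos)
  have hL1 : (1:ℝ) ≤ L := by exact_mod_cast hLpos
  have hLz : NeZero L := ⟨hLpos.ne'⟩
  have hdpos : 0 < d := Nat.pos_of_dvd_of_pos hd hLpos
  have hdz : NeZero d := ⟨hdpos.ne'⟩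
  have hd1 : (1:ℝ) ≤ d := by exact_mod_cast hdpos
  have hlogL := Real.log_nonneg hL1
  have hq := eng_card hQp hL
  have hN1 : 1 ≤ (J:ℝ) + 1 := by have : (0:ℝ) ≤ J := by positivity
                                 linarith
  have hcov := eng_cover D hL J hu P hP
  have htot := (hlow u hu · J)
  have hX := hexc Q hQp L hL J u hu
  have hT := htail J u X hu
  have hX0 := S_nonneg D J u (Exc L)
  have hcop := eng_total D L J hu
  have hΛ1 : 1 ≤ 1 + Real.log L := by linarith
  have horth := fun B hB0 h => orth_step D hd J (B := B) hu hB0 h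
  replace horth := horth _ (by positivity) (fun χ hχ => hq0 d hd hdq χ hχ u hu
      (eng_u hc0 hc1 hA1 hCc hC1' hN1 hΛ1 hd1 hu hC1 (by linarith) hy1).2 J)
  obtain ⟨huc, -⟩ := eng_u hc0 hc1 hA1 hCc hC1' hN1 hΛ1 hd1 hu hC1 (by linarith) hy1
  have hycmp := eng_y (A := A) hc0 hCc hu hy1
  have hB8 := eng_B hC1 hΛ1 hd1 (by linarith) hycmp
  have hX8 := eng_X hC2 hΛ1 hd1 (by linarith) hycmp hq hX
  have hT8 := eng_T hC3 hd1 hC1' hc0 hu hCc (by linarith) hy2 (hT (by linarith))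
  have hES := (htot huc).trans hcop
  refine eng_fin (A := A) (W := ∑ m ∈ P, D.w J u m) (deg := D.deg) hc0 hu hd1 hN1 hdeg1 hCc (by linarith) ?_ (eng_up D J hu P)
  clear hq0 hzf hexc htail hlow hycmp hy1 hy2 hcop htot hT hX hP
  generalize (J.factorial * (4 * (C1 * (1 + Real.log L) ^ 2) ^ 56) ^ (J + 1) : ℝ) = B at *
  generalize D.S J u (Exc L) = X1 at *
  generalize D.S J u {m | X < Real.log m} = T1 at *
  generalize D.S J u {m | m.Coprime L} = E1 at *
  generalize D.S J u {m | (m : ZMod d) = 1 ∧ m.Coprime L} = T at *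
  generalize (c / u) ^ (J + 1) = y at *
  generalize ∑ m ∈ P, D.w J u m = W at *
  have hd0 : (0:ℝ) < d := by linarith
  have a1 : (y - X1) / d ≤ E1 / d := by gcongr; linarith
  have a2 : B ≤ y / (8 * d) := by rw [le_div_iff₀ (by positivity)]; linarith
  have a3 : X1 ≤ y / (8 * d) := by rw [le_div_iff₀ (by positivity)]; linarith
  have a4 : T1 ≤ y / (8 * d) := by rw [le_div_iff₀ (by positivity)]; linarith
  have a5 : X1 / d ≤ X1 := div_le_self hX0 hd1
  have a6 : (y - X1) / d = y / d - X1 / d := by ring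
  have a7 : y / d = 8 * (y / (8 * d)) := by field_simp
  have a8 : y / (2 * d) = 4 * (y / (8 * d)) := by field_simp; ring
  linarith

end CS

namespace CS
open Finset NumberField Polynomial

theorem norm_nonneg_of_i (K : Type*) [Field K] [NumberField K] (i : K) (hi : i ^ 2 = -1) (x : 𝓞 K) :
    0 ≤ Algebra.norm ℤ x := by
  classical
  have h1 : (algebraMap ℚ ℂ) (Algebra.norm ℚ (x : K)) = ∏ σ : K →ₐ[ℚ] ℂ, σ (x : K) :=
    Algebra.norm_eq_prod_embeddings ℚ ℂ (x : K)
  have hσ : ∀ σ : K →ₐ[ℚ] ℂ, σ i = Complex.I ∨ σ i = -Complex.I := by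
    intro σ
    have : (σ i) ^ 2 = Complex.I ^ 2 := by rw [← map_pow, hi, Complex.I_sq]; simp
    exact sq_eq_sq_iff_eq_or_eq_neg.1 this
  let cj : (K →ₐ[ℚ] ℂ) → (K →ₐ[ℚ] ℂ) := fun σ => (Complex.conjAe.restrictScalars ℚ).toAlgHom.comp σ
  have hcj : ∀ σ y, cj σ y = (starRingEnd ℂ) (σ y) := fun σ y => rfl
  have hcc : ∀ σ, cj (cj σ) = σ := by
    intro σ; ext y; rw [hcj, hcj]; simp
  have hI : Complex.I ≠ -Complex.I := by
    intro h; have := congrArg Complex.im h; norm_num at this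
  have h2 : ∏ σ : K →ₐ[ℚ] ℂ with ¬ σ i = Complex.I, σ (x : K) =
      ∏ σ : K →ₐ[ℚ] ℂ with σ i = Complex.I, (starRingEnd ℂ) (σ (x : K)) := by
    refine Finset.prod_bij' (fun σ _ => cj σ) (fun σ _ => cj σ) ?_ ?_ ?_ ?_ ?_
    · intro σ hs
      simp only [Finset.mem_filter, Finset.mem_univ, true_and] at hs ⊢
      rw [hcj, (hσ σ).resolve_left hs]; simp
    · intro σ hs
      simp only [Finset.mem_filter, Finset.mem_univ, true_and] at hs ⊢
      rw [hcj, hs, Complex.conj_I]; exact hI.symm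
    · intro σ _; exact hcc σ
    · intro σ _; exact hcc σ
    · intro σ _; rw [hcj]; simp
  rw [← Finset.prod_filter_mul_prod_filter_not Finset.univ (fun σ : K →ₐ[ℚ] ℂ => σ i = Complex.I), h2,
    ← map_prod, Complex.mul_conj] at h1
  have h3 : ((Algebra.norm ℚ (x : K) : ℚ) : ℝ) =
      Complex.normSq (∏ σ : K →ₐ[ℚ] ℂ with σ i = Complex.I, σ (x : K)) := by
    have h3' : ((((Algebra.norm ℚ (x : K) : ℚ) : ℝ)) : ℂ) = (algebraMap ℚ ℂ) (Algebra.norm ℚ (x : K)) := by simp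
    rw [h1] at h3'
    exact_mod_cast h3'
  have h4 : 0 ≤ Algebra.norm ℚ (x : K) := by
    have : (0:ℝ) ≤ ((Algebra.norm ℚ (x : K) : ℚ) : ℝ) := by rw [h3]; exact Complex.normSq_nonneg _
    exact_mod_cast this
  have h5 : ((Algebra.norm ℤ x : ℤ) : ℚ) = Algebra.norm ℚ (x : K) := Algebra.coe_norm_int x
  rw [← h5] at h4
  exact_mod_cast h4

theorem lift_ms (K : Type*) [Field K] [NumberField K] (s : Multiset K) (h : ∀ a ∈ s, IsIntegral ℤ a) :
    ∃ t : Multiset (𝓞 K), t.map (algebraMap (𝓞 K) K) = s := by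
  induction s using Multiset.induction_on with
  | empty => exact ⟨0, rfl⟩
  | cons a s ih =>
    obtain ⟨t, ht⟩ := ih (fun b hb => h b (Multiset.mem_cons_of_mem hb))
    obtain ⟨b, hb⟩ := (IsIntegralClosure.isIntegral_iff (A := 𝓞 K)).1 (h a (Multiset.mem_cons_self a s))
    refine ⟨b ::ₘ t, ?_⟩
    rw [Multiset.map_cons, ht, hb]

theorem good_split (K : Type*) [Field K] [NumberField K] (f : ℤ[X]) (hf : f.Monic)
    (hs : (f.map (algebraMap ℤ K)).Splits) {p : ℕ} (hp : Good K p) : SplitsModLinear f p := by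
  obtain ⟨hpp, P, hP⟩ := hp
  have : Fact p.Prime := ⟨hpp⟩
  have hcard : Nat.card (𝓞 K ⧸ P) = p := by
    rw [← hP, Ideal.absNorm_apply, Submodule.cardQuot_apply]
  have hfin : Finite (𝓞 K ⧸ P) := Nat.finite_of_card_ne_zero (by rw [hcard]; exact hpp.ne_zero)
  have hft : Fintype (𝓞 K ⧸ P) := Fintype.ofFinite _
  rw [Nat.card_eq_fintype_card] at hcard
  let e := (ZMod.ringEquivOfPrime (𝓞 K ⧸ P) hpp hcard).symm
  let ψ : 𝓞 K →+* ZMod p := (e : (𝓞 K ⧸ P) →+* ZMod p).comp (Ideal.Quotient.mk P)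
  -- factor over the ring of integers
  obtain ⟨t, ht⟩ : ∃ t : Multiset (𝓞 K), f.map (algebraMap ℤ (𝓞 K)) = (t.map fun a => X - C a).prod := by
    have h1 := hs.eq_prod_roots_of_monic (hf.map _)
    have hroots_int : ∀ a ∈ (f.map (algebraMap ℤ K)).roots, IsIntegral ℤ a := by
      intro a ha
      refine ⟨f, hf, ?_⟩
      rw [Polynomial.mem_roots (hf.map _).ne_zero, IsRoot.def, eval_map] at ha
      exact ha
    obtain ⟨t, ht⟩ := lift_ms K _ hroots_int
    refine ⟨t, ?_⟩
    apply Polynomial.map_injective (algebraMap (𝓞 K) K) RingOfIntegers.coe_injective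
    rw [Polynomial.map_map, ← IsScalarTower.algebraMap_eq, Polynomial.map_multiset_prod, Multiset.map_map, h1, ← ht,
      Multiset.map_map]
    congr 1
    apply Multiset.map_congr rfl
    intro a _
    simp
  refine ⟨t.map ψ, ?_⟩
  have h2 : f.map (Int.castRingHom (ZMod p)) = (f.map (algebraMap ℤ (𝓞 K))).map ψ := by
    rw [Polynomial.map_map]; congr 1; exact RingHom.ext_int _ _
  rw [h2, ht, Polynomial.map_multiset_prod, Multiset.map_map, Multiset.map_map]
  congr 1
  apply Multiset.map_congr rfl
  intro a _
  simp

theorem AD_of (f : ℤ[X]) (hf : f.Monic) (K : Type) [Field K] [CharZero K]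
    [IsSplittingField ℚ K (f.map (algebraMap ℤ ℚ) * (X ^ 2 + 1))] : ∃ D : AD, ∀ p, D.good p → SplitsModLinear f p := by
  obtain ⟨g, hg⟩ : ∃ g : ℚ[X], g = f.map (algebraMap ℤ ℚ) * (X ^ 2 + 1) := ⟨_, rfl⟩
  have hsp : IsSplittingField ℚ K g := by rw [hg]; infer_instance
  have hg0 : g ≠ 0 := by
    rw [hg]
    refine mul_ne_zero (hf.map _).ne_zero ?_
    have : (X ^ 2 + 1 : ℚ[X]).Monic := by monicity!
    exact this.ne_zero
  have hnf : NumberField K :=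
    { to_charZero := inferInstance, to_finiteDimensional := IsSplittingField.finiteDimensional K g }
  have hn : Normal ℚ K := Normal.of_isSplittingField g
  have hgal : IsGalois ℚ K := { }
  have hsg : (g.map (algebraMap ℚ K)).Splits := IsSplittingField.splits K g
  have e : g.map (algebraMap ℚ K) = f.map (algebraMap ℤ K) * (X ^ 2 + 1) := by
    simp only [hg, Polynomial.map_mul, Polynomial.map_map, ← IsScalarTower.algebraMap_eq, Polynomial.map_add,
      Polynomial.map_pow, Polynomial.map_X, Polynomial.map_one]
  rw [e] at hsg
  have hne : f.map (algebraMap ℤ K) * (X ^ 2 + 1) ≠ 0 := by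
    rw [← e]; exact Polynomial.map_ne_zero hg0
  obtain ⟨i, hi⟩ : ∃ i : K, i ^ 2 = -1 := by
    have h1 : (X ^ 2 + 1 : K[X]).Splits := hsg.of_dvd hne (dvd_mul_left _ _)
    have hd : (X ^ 2 + 1 : K[X]).degree ≠ 0 := by
      have : (X ^ 2 + 1 : K[X]).degree = 2 := by compute_degree!
      rw [this]; norm_num
    obtain ⟨i, hi⟩ := h1.exists_eval_eq_zero hd
    refine ⟨i, ?_⟩
    simp at hi
    linear_combination hi
  have hsf : (f.map (algebraMap ℤ K)).Splits := hsg.of_dvd hne (dvd_mul_right _ _)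
  obtain ⟨D, hD⟩ := exists_AD K (norm_nonneg_of_i K i hi)
  exact ⟨D, fun p hp => good_split K f hf hsf ((hD p).1 hp)⟩

theorem exists_AD_f (f : ℤ[X]) (hf : f.Monic) : ∃ D : AD, ∀ p, D.good p → SplitsModLinear f p :=
by
  have h := IsSplittingField.splittingField (f.map (algebraMap ℤ ℚ) * (X ^ 2 + 1) : ℚ[X])
  refine @AD_of f hf (f.map (algebraMap ℤ ℚ) * (X ^ 2 + 1) : ℚ[X]).SplittingField _ _ ?_
  convert h
  exact Subsingleton.elim _ _

end CS

namespace CS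
open Finset
variable (D : AD)

theorem exc_summable : Summable ((Exc 1).indicator (fun m : ℕ => (m:ℝ) ^ (-(3 / 4) : ℝ))) := by
  classical
  obtain ⟨C, hC, h⟩ := exc_sum
  refine summable_of_sum_le (c := C * (1 + (∅ : Finset ℕ).card))
    (fun m => Set.indicator_nonneg (fun m _ => by positivity) m) ?_
  intro F
  rw [Finset.sum_indicator_eq_sum_filter]
  exact h ∅ (by simp) _ (fun m hm => by simpa using (Finset.mem_filter.1 hm).2)

theorem not_summable_good :
    ¬ Summable (Set.indicator {p | D.good p ∧ D.N0 < p} (fun p : ℕ => 1 / (p:ℝ))) := by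
  intro hs
  have h1 := exc_summable
  have h2 : Summable (Set.indicator {m : ℕ | m ≤ D.N0} (fun _ : ℕ => (1:ℝ))) := by
    apply summable_of_hasFiniteSupport
    exact (Set.finite_Iic D.N0).subset (fun m hm => by
      by_contra hc
      exact hm (Set.indicator_of_notMem hc _))
  have h3 := ((h1.add hs).add h2).mul_left (D.deg : ℝ)
  have hterm : ∀ u : ℝ, 0 < u → ∀ m : ℕ, D.lam m / Real.log m * (m : ℝ) ^ (-(1 + u)) ≤
      D.deg * (((Exc 1).indicator (fun m : ℕ => (m:ℝ) ^ (-(3 / 4) : ℝ)) m +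
        Set.indicator {p | D.good p ∧ D.N0 < p} (fun p : ℕ => 1 / (p:ℝ)) m) +
        Set.indicator {m : ℕ | m ≤ D.N0} (fun _ : ℕ => (1:ℝ)) m) := by
    intro u hu m
    have n1 : 0 ≤ (Exc 1).indicator (fun m : ℕ => (m:ℝ) ^ (-(3 / 4) : ℝ)) m :=
      Set.indicator_nonneg (fun m _ => by positivity) m
    have n2 : 0 ≤ Set.indicator {p | D.good p ∧ D.N0 < p} (fun p : ℕ => 1 / (p:ℝ)) m :=
      Set.indicator_nonneg (fun m _ => by positivity) m
    have n3 : 0 ≤ Set.indicator {m : ℕ | m ≤ D.N0} (fun _ : ℕ => (1:ℝ)) m :=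
      Set.indicator_nonneg (fun m _ => by positivity) m
    by_cases hl : D.lam m = 0
    · rw [hl, zero_div, zero_mul]; positivity
    have hpp := D.supp m hl
    have hm1 : 1 < m := hpp.one_lt
    have hm1' : (1:ℝ) ≤ m := by exact_mod_cast hm1.le
    have hmp : (0:ℝ) < m := by linarith
    have hlog : 0 < Real.log m := Real.log_pos (by exact_mod_cast hm1)
    have hg : D.lam m / Real.log m ≤ D.deg := by rw [div_le_iff₀ hlog]; exact D.dim m
    refine mul_le_mul hg ?_ (by positivity) (by positivity)
    by_cases hN : m ≤ D.N0
    · rw [Set.indicator_of_mem (s := {m : ℕ | m ≤ D.N0}) hN]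
      have : (m:ℝ) ^ (-(1 + u)) ≤ 1 := Real.rpow_le_one_of_one_le_of_nonpos hm1' (by linarith)
      linarith
    push Not at hN
    by_cases hE : m ∈ Exc 1
    · rw [Set.indicator_of_mem hE]
      have : (m:ℝ) ^ (-(1 + u)) ≤ (m:ℝ) ^ (-(3 / 4) : ℝ) := Real.rpow_le_rpow_of_exponent_le hm1' (by linarith)
      linarith
    have hprime : m.Prime := by
      by_contra hc; exact hE ⟨hpp, Or.inl hc⟩
    rw [Set.indicator_of_mem (s := {p | D.good p ∧ D.N0 < p}) ⟨D.supp1 m hprime hl, hN⟩]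
    have : (m:ℝ) ^ (-(1 + u)) ≤ (m:ℝ) ^ (-1 : ℝ) := Real.rpow_le_rpow_of_exponent_le hm1' (by linarith)
    rw [Real.rpow_neg_one, ← one_div] at this
    linarith
  obtain ⟨B, hB⟩ : ∃ B : ℝ, ∀ u : ℝ, 0 < u → D.G u ≤ B :=
    ⟨_, fun u hu => hasSum_le (hterm u hu) ((G_hasSum D hu).summable.hasSum) h3.hasSum⟩
  have hCz := D.Cz_pos
  have hu0 : 0 < Real.exp (-(|B| + 1)) / D.Cz := by positivity
  have hu1 : Real.exp (-(|B| + 1)) / D.Cz ≤ 1 := by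
    rw [div_le_one (by linarith)]
    refine le_trans ?_ hCz
    rw [Real.exp_le_one_iff]; linarith [abs_nonneg B]
  have h4 := G_low D hu0 hu1
  have e : 1 / (D.Cz * (Real.exp (-(|B| + 1)) / D.Cz)) = Real.exp (|B| + 1) := by
    rw [Real.exp_neg]; field_simp
  rw [e, Real.log_exp] at h4
  linarith [hB _ hu0, le_abs_self B]

theorem good_dense (j0 : ℕ) : ∃ j, j0 ≤ j ∧ ∃ Q : Finset ℕ, Q.card = j ∧
    ∀ q ∈ Q, D.good q ∧ D.N0 < q ∧ q ≤ j ^ 2 := by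
  classical
  by_contra hcon
  push Not at hcon
  apply not_summable_good D
  let A : Set ℕ := {p | D.good p ∧ D.N0 < p}
  let g : ℕ → ℕ := fun p => ((Finset.range (p + 1)).filter (· ∈ A)).card
  have hinj : Set.InjOn g A := by
    have key : ∀ p ∈ A, ∀ q ∈ A, p < q → g p < g q := by
      intro p hp q hq hpq
      apply Finset.card_lt_card
      rw [Finset.ssubset_iff_of_subset]
      · exact ⟨q, by simp [hq], by simp; intro h; omega⟩
      · intro x; simp; intro h1 h2; exact ⟨by omega, h2⟩
    intro p hp q hq h
    rcases lt_trichotomy p q with h1 | h1 | h1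
    · exact absurd h (key p hp q hq h1).ne
    · exact h1
    · exact absurd h (key q hq p hp h1).ne'
  let hf : ℕ → ℝ := fun j => (if j < j0 then 1 else 0) + 1 / (j:ℝ) ^ 2
  have hsum : Summable hf := by
    apply Summable.add
    · apply summable_of_hasFiniteSupport
      exact (Set.finite_Iio j0).subset (fun m hm => by
        by_contra hc
        exact hm (if_neg hc))
    · exact Real.summable_one_div_nat_pow.2 (by norm_num)
  have hnn : ∀ j, 0 ≤ hf j := fun j => by
    simp only [hf]; split_ifs <;> positivity
  refine summable_of_sum_le (c := ∑' j, hf j) (fun m => Set.indicator_nonneg (fun m _ => by positivity) m) ?_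
  intro F
  change ∑ x ∈ F, A.indicator (fun p : ℕ => 1 / (p:ℝ)) x ≤ _
  rw [Finset.sum_indicator_eq_sum_filter]
  calc ∑ p ∈ F with p ∈ A, 1 / (p:ℝ) ≤ ∑ p ∈ F with p ∈ A, hf (g p) := by
        apply Finset.sum_le_sum
        intro p hp
        have hpA := (Finset.mem_filter.1 hp).2
        have hpp := (D.good_prime p hpA.1).pos
        have hp1 : (1:ℝ) ≤ p := by exact_mod_cast hpp
        simp only [hf]
        by_cases hj : g p < j0
        · rw [if_pos hj]
          have : 1 / (p:ℝ) ≤ 1 := by rw [div_le_one (by linarith)]; exact hp1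
          have : (0:ℝ) ≤ 1 / (g p : ℝ) ^ 2 := by positivity
          linarith
        · push Not at hj
          obtain ⟨q, hq, hq2⟩ := hcon (g p) hj ((Finset.range (p + 1)).filter (· ∈ A)) rfl
          rw [Finset.mem_filter, Finset.mem_range] at hq
          have h5 := hq2 hq.2.1 hq.2.2
          have h6 : (g p) ^ 2 ≤ p := by omega
          have h7 : 0 < g p := by
            apply Finset.card_pos.2
            exact ⟨p, by simp [hpA]⟩
          have h8 : (0:ℝ) < g p := by exact_mod_cast h7
          rw [if_neg (not_lt.2 hj), zero_add]
          apply one_div_le_one_div_of_le (by positivity)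
          exact_mod_cast h6
    _ = ∑ j ∈ (F.filter (· ∈ A)).image g, hf j := by
        rw [Finset.sum_image]
        intro p hp q hq h
        exact hinj (Finset.mem_filter.1 hp).2 (Finset.mem_filter.1 hq).2 h
    _ ≤ _ := hsum.sum_le_tsum _ (fun j _ => hnn j)

end CS

namespace CS
open Finset

theorem harm_le {K : ℕ} {X : ℝ} (hX : 0 ≤ X) (hK : (K:ℝ) ≤ Real.exp X) : ∑ k ∈ Icc 1 K, 1 / (k:ℝ) ≤ 1 + X := by
  have h := harmonic_le_one_add_log K
  rw [harmonic_eq_sum_Icc] at h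
  push_cast at h
  simp only [one_div]
  refine h.trans ?_
  rcases Nat.eq_zero_or_pos K with rfl | hp
  · simp; linarith
  · have : Real.log K ≤ X := by
      rw [Real.log_le_iff_le_exp (by exact_mod_cast hp)]; exact hK
    linarith

theorem prod_card_le (Q : Finset ℕ) (hQ : ∀ q ∈ Q, 0 < q) : ∏ q ∈ Q, (1 + 1 / (q:ℝ)) ≤ Q.card + 1 := by
  induction Q using Finset.induction_on_max with
  | empty => simp
  | insert a s hmax ih =>
    have ha : a ∉ s := fun h => (hmax a h).ne rfl
    rw [Finset.prod_insert ha, Finset.card_insert_of_notMem ha]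
    have ih' := ih (fun q hq => hQ q (mem_insert_of_mem hq))
    have hc : s.card + 1 ≤ a := by
      have h1 : s ⊆ Icc 1 (a - 1) := by
        intro q hq
        have := hmax q hq
        have := hQ q (mem_insert_of_mem hq)
        rw [mem_Icc]; omega
      have := Finset.card_le_card h1
      have := hQ a (mem_insert_self a s)
      rw [Nat.card_Icc] at *; omega
    have hc' : (s.card : ℝ) + 1 ≤ a := by exact_mod_cast hc
    have hs0 : (0:ℝ) ≤ s.card := by positivity
    have ha0 : (0:ℝ) < a := by linarith
    calc (1 + 1 / (a:ℝ)) * ∏ q ∈ s, (1 + 1 / (q:ℝ)) ≤ (1 + 1 / (a:ℝ)) * (s.card + 1) := by gcongr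
      _ = s.card + 1 + (s.card + 1) / a := by ring
      _ ≤ s.card + 1 + 1 := by
          gcongr; rw [div_le_one ha0]; exact hc'
      _ = _ := by push_cast; ring

theorem mult_sum {K m : ℕ} (hm : 0 < m) : ∑ k ∈ (Icc 1 K).filter (m ∣ ·), 1 / (k:ℝ) ≤ 1 / (m:ℝ) * ∑ k ∈ Icc 1 K, 1 / (k:ℝ) := by
  have hsub : (Icc 1 K).filter (m ∣ ·) ⊆ (Icc 1 K).image (m * ·) := by
    intro k hk
    rw [mem_filter, mem_Icc] at hk
    obtain ⟨⟨h1, h2⟩, c, rfl⟩ := hk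
    rw [mem_image]
    refine ⟨c, ?_, rfl⟩
    rw [mem_Icc]
    constructor
    · exact Nat.pos_of_ne_zero (fun h => by subst h; simp at h1)
    · exact le_trans (Nat.le_mul_of_pos_left c hm) h2
  calc _ ≤ ∑ k ∈ (Icc 1 K).image (m * ·), 1 / (k:ℝ) :=
        Finset.sum_le_sum_of_subset_of_nonneg hsub (fun _ _ _ => by positivity)
    _ = ∑ k ∈ Icc 1 K, 1 / ((m * k : ℕ):ℝ) := by
        rw [Finset.sum_image]
        intro a _ b _ h
        exact Nat.eq_of_mul_eq_mul_left hm h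
    _ = _ := by
        rw [Finset.mul_sum]
        apply Finset.sum_congr rfl
        intro k _
        push_cast; rw [one_div_mul_one_div]

theorem rankin {Q : Finset ℕ} (hQ : ∀ q ∈ Q, q.Prime) {K : ℕ} {X : ℝ} (hX : 0 ≤ X) (hK : (K:ℝ) ≤ Real.exp X) :
    ∑ k ∈ Icc 1 K, (2:ℝ) ^ (Q.filter (· ∣ k)).card * (1 / (k:ℝ)) ≤ (Q.card + 1) * (1 + X) := by
  classical
  have h1 : ∀ k : ℕ, (2:ℝ) ^ (Q.filter (· ∣ k)).card ≤ ∑ S ∈ Q.powerset, if (∏ q ∈ S, q) ∣ k then (1:ℝ) else 0 := by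
    intro k
    rw [← Finset.sum_filter]
    simp only [Finset.sum_const, nsmul_eq_mul, mul_one]
    have : (2 : ℝ) ^ (Q.filter (· ∣ k)).card = ((Q.filter (· ∣ k)).powerset.card : ℝ) := by
      rw [Finset.card_powerset]; push_cast; rfl
    rw [this]
    gcongr
    intro S hS
    rw [mem_powerset] at hS
    rw [mem_filter, mem_powerset]
    refine ⟨hS.trans (filter_subset _ _), ?_⟩
    apply Finset.prod_primes_dvd
    · intro q hq; exact (hQ q (mem_filter.1 (hS hq)).1).prime
    · intro q hq; exact (mem_filter.1 (hS hq)).2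
  have hH := harm_le hX hK
  calc _ ≤ ∑ k ∈ Icc 1 K, (∑ S ∈ Q.powerset, if (∏ q ∈ S, q) ∣ k then (1:ℝ) else 0) * (1 / (k:ℝ)) := by
        apply Finset.sum_le_sum
        intro k _
        have := h1 k
        gcongr
    _ = ∑ S ∈ Q.powerset, ∑ k ∈ (Icc 1 K).filter ((∏ q ∈ S, q) ∣ ·), 1 / (k:ℝ) := by
        simp only [Finset.sum_mul]
        rw [Finset.sum_comm]
        apply Finset.sum_congr rfl
        intro S _
        rw [Finset.sum_filter]
        apply Finset.sum_congr rfl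
        intro k _
        split_ifs <;> simp
    _ ≤ ∑ S ∈ Q.powerset, (∏ q ∈ S, 1 / (q:ℝ)) * (1 + X) := by
        apply Finset.sum_le_sum
        intro S hS
        have hpos : 0 < ∏ q ∈ S, q := Finset.prod_pos (fun q hq => (hQ q (mem_powerset.1 hS hq)).pos)
        refine (mult_sum hpos).trans ?_
        have e : 1 / ((∏ q ∈ S, q : ℕ) : ℝ) = ∏ q ∈ S, 1 / (q:ℝ) := by
          push_cast; simp
        rw [e]
        gcongr
    _ = (∏ q ∈ Q, (1 + 1 / (q:ℝ))) * (1 + X) := by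
        rw [← Finset.sum_mul, Finset.prod_one_add]
    _ ≤ _ := by
        gcongr
        exact prod_card_le Q (fun q hq => (hQ q hq).pos)

/-- few k with many prime factors in Q -/
theorem bad_sum {Q : Finset ℕ} (hQ : ∀ q ∈ Q, q.Prime) {K s : ℕ} {X M : ℝ} (hX : 0 ≤ X) (hK : (K:ℝ) ≤ Real.exp X)
    (hM : 0 < M) (hs : 2 * M * ((Q.card + 1) * (1 + X)) ≤ 2 ^ s) :
    ∑ k ∈ (Icc 1 K).filter (fun k => s ≤ (Q.filter (· ∣ k)).card), 1 / (k:ℝ) ≤ 1 / (2 * M) := by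
  have h1 : (2:ℝ) ^ s * ∑ k ∈ (Icc 1 K).filter (fun k => s ≤ (Q.filter (· ∣ k)).card), 1 / (k:ℝ) ≤
      (Q.card + 1) * (1 + X) := by
    refine le_trans ?_ (rankin hQ hX hK)
    rw [Finset.mul_sum]
    calc _ ≤ ∑ k ∈ (Icc 1 K).filter (fun k => s ≤ (Q.filter (· ∣ k)).card),
            (2:ℝ) ^ (Q.filter (· ∣ k)).card * (1 / (k:ℝ)) := by
          apply Finset.sum_le_sum
          intro k hk
          have := (mem_filter.1 hk).2
          gcongr
          norm_num
      _ ≤ _ := Finset.sum_le_sum_of_subset_of_nonneg (filter_subset _ _) (fun _ _ _ => by positivity)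
  have hS0 : 0 ≤ ∑ k ∈ (Icc 1 K).filter (fun k => s ≤ (Q.filter (· ∣ k)).card), 1 / (k:ℝ) :=
    Finset.sum_nonneg (fun _ _ => by positivity)
  generalize ∑ k ∈ (Icc 1 K).filter (fun k => s ≤ (Q.filter (· ∣ k)).card), 1 / (k:ℝ) = S at *
  have hc : (0:ℝ) < (Q.card + 1) * (1 + X) := by positivity
  generalize ((Q.card:ℝ) + 1) * (1 + X) = T at *
  rw [le_div_iff₀ (by positivity)]
  have h2 : 2 * M * T * S ≤ T := le_trans (mul_le_mul_of_nonneg_right hs hS0) h1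
  by_contra hcon
  push Not at hcon
  nlinarith

/-- what the analytic engine gives, for one modulus -/
theorem one_mod {good : ℕ → Prop} {Q : Finset ℕ} {d K : ℕ} {M : ℝ} (hd : 0 < d)
    (hgp : ∀ p, good p → p.Prime)
    (P : Finset ℕ) (hP : ∀ p, p ∈ P ↔ p ≤ K ∧ good p ∧ (p : ZMod d) = 1 ∧ p ∉ Q)
    (hsum : 1 / (d * M) ≤ ∑ p ∈ P, 1 / (p:ℝ)) (R : ℕ → ℕ → Prop) [∀ k, DecidablePred (R k)]
    (hR : ∀ k d, R k d ↔ good (d * k + 1) ∧ d * k + 1 ∉ Q) :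
    1 / M ≤ ∑ k ∈ Icc 1 K, if R k d then 1 / (k:ℝ) else 0 := by
  classical
  have hd0 : (0:ℝ) < d := by exact_mod_cast hd
  have hsub : P ⊆ ((Icc 1 K).filter (R · d)).image (fun k => d * k + 1) := by
    intro p hp
    obtain ⟨h1, h2, h3, h4⟩ := (hP p).1 hp
    have hpr := hgp p h2
    have h5 : d ∣ p - 1 := by
      have : ((p - 1 : ℕ) : ZMod d) = 0 := by
        rw [Nat.cast_sub hpr.one_lt.le, h3]; simp
      exact (ZMod.natCast_eq_zero_iff _ _).1 this
    obtain ⟨k, hk⟩ := h5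
    have hpk : p = d * k + 1 := by have := hpr.one_lt; omega
    rw [mem_image]
    refine ⟨k, ?_, hpk.symm⟩
    rw [mem_filter, mem_Icc, hR, ← hpk]
    refine ⟨⟨?_, ?_⟩, h2, h4⟩
    · apply Nat.pos_of_ne_zero
      rintro rfl
      exact hpr.one_lt.ne' (by simpa using hpk)
    · have := Nat.le_mul_of_pos_left k hd
      omega
  have h6 : ∑ p ∈ P, 1 / (p:ℝ) ≤ 1 / d * ∑ k ∈ Icc 1 K, if R k d then 1 / (k:ℝ) else 0 := by
    calc _ ≤ ∑ p ∈ ((Icc 1 K).filter (R · d)).image (fun k => d * k + 1), 1 / (p:ℝ) :=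
          Finset.sum_le_sum_of_subset_of_nonneg hsub (fun _ _ _ => by positivity)
      _ = ∑ k ∈ (Icc 1 K).filter (R · d), 1 / ((d * k + 1 : ℕ):ℝ) := by
          rw [Finset.sum_image]
          intro a _ b _ h
          exact Nat.eq_of_mul_eq_mul_left hd (Nat.add_right_cancel h)
      _ ≤ ∑ k ∈ (Icc 1 K).filter (R · d), 1 / (d:ℝ) * (1 / (k:ℝ)) := by
          apply Finset.sum_le_sum
          intro k hk
          have hk1 := (mem_Icc.1 (mem_filter.1 hk).1).1
          have : (0:ℝ) < k := by exact_mod_cast hk1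
          rw [one_div_mul_one_div]
          apply one_div_le_one_div_of_le (by positivity)
          push_cast; linarith
      _ = _ := by rw [← Finset.mul_sum, Finset.sum_filter]
  have h7 := hsum.trans h6
  rw [← one_div_mul_one_div] at h7
  exact le_of_mul_le_mul_left h7 (by positivity)

theorem pigeon {Q DD : Finset ℕ} (hQ : ∀ q ∈ Q, q.Prime) (hDD : DD.Nonempty) {K s : ℕ} {X M : ℝ} (hX : 0 ≤ X)
    (hK : (K:ℝ) ≤ Real.exp X) (hM : 0 < M) (hs : 2 * M * ((Q.card + 1) * (1 + X)) ≤ 2 ^ s)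
    (R : ℕ → ℕ → Prop) [∀ k, DecidablePred (R k)]
    (h : ∀ d ∈ DD, 1 / M ≤ ∑ k ∈ Icc 1 K, if R k d then 1 / (k:ℝ) else 0) :
    ∃ k, 0 < k ∧ k ≤ K ∧ (Q.filter (· ∣ k)).card < s ∧ (DD.card : ℝ) ≤ 2 * M * (1 + X) * (DD.filter (R k)).card := by
  classical
  have hbad := bad_sum hQ hX hK hM hs
  have hH := harm_le hX hK
  let G := (Icc 1 K).filter (fun k => ¬ s ≤ (Q.filter (· ∣ k)).card)
  have h1 : ∀ d ∈ DD, 1 / (2 * M) ≤ ∑ k ∈ G, if R k d then 1 / (k:ℝ) else 0 := by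
    intro d hd
    have h2 := h d hd
    rw [← Finset.sum_filter_add_sum_filter_not (Icc 1 K) (fun k => s ≤ (Q.filter (· ∣ k)).card)] at h2
    have h3 : ∑ k ∈ (Icc 1 K).filter (fun k => s ≤ (Q.filter (· ∣ k)).card), (if R k d then 1 / (k:ℝ) else 0) ≤ 1 / (2 * M) := by
      refine le_trans (Finset.sum_le_sum (fun k _ => ?_)) hbad
      split_ifs
      · exact le_refl _
      · positivity
    have e : 1 / M = 1 / (2 * M) + 1 / (2 * M) := by field_simp; norm_num
    simp only [G]
    linarith
  have hGsum : ∑ k ∈ G, 1 / (k:ℝ) ≤ 1 + X :=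
    le_trans (Finset.sum_le_sum_of_subset_of_nonneg (filter_subset _ _) (fun _ _ _ => by positivity)) hH
  have h4 : (DD.card : ℝ) / (2 * M) ≤ ∑ k ∈ G, ((DD.filter (R k)).card : ℝ) * (1 / (k:ℝ)) := by
    calc (DD.card : ℝ) / (2 * M) = ∑ d ∈ DD, 1 / (2 * M) := by simp; ring
      _ ≤ ∑ d ∈ DD, ∑ k ∈ G, (if R k d then 1 / (k:ℝ) else 0) := Finset.sum_le_sum h1
      _ = ∑ k ∈ G, ∑ d ∈ DD, (if R k d then 1 / (k:ℝ) else 0) := Finset.sum_comm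
      _ = _ := by
          apply Finset.sum_congr rfl
          intro k _
          rw [← Finset.sum_filter, Finset.sum_const, nsmul_eq_mul]
  have hDc : (0:ℝ) < DD.card := by exact_mod_cast hDD.card_pos
  have hGne : G.Nonempty := by
    rw [Finset.nonempty_iff_ne_empty]
    intro he
    rw [he, Finset.sum_empty] at h4
    have : 0 < (DD.card : ℝ) / (2 * M) := by positivity
    linarith
  have hX1 : 0 < 1 + X := by linarith
  have h5 : ∑ k ∈ G, (DD.card : ℝ) / (2 * M * (1 + X)) * (1 / (k:ℝ)) ≤ ∑ k ∈ G, ((DD.filter (R k)).card : ℝ) * (1 / (k:ℝ)) := by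
    refine le_trans ?_ h4
    rw [← Finset.mul_sum]
    calc _ ≤ (DD.card : ℝ) / (2 * M * (1 + X)) * (1 + X) := by gcongr
      _ = _ := by field_simp
  obtain ⟨k, hk, hk2⟩ := Finset.exists_le_of_sum_le hGne h5
  simp only [G, mem_filter, mem_Icc, not_le] at hk
  refine ⟨k, hk.1.1, hk.1.2, hk.2, ?_⟩
  have hk0 : (0:ℝ) < k := by exact_mod_cast hk.1.1
  have h6 := le_of_mul_le_mul_right hk2 (by positivity)
  rw [div_le_iff₀ (by positivity)] at h6
  linarith

end CS

namespace CS
open Finset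

theorem prod_inj_primes {Q : Finset ℕ} (hQ : ∀ q ∈ Q, q.Prime) {S T : Finset ℕ} (hS : S ⊆ Q) (hT : T ⊆ Q)
    (h : ∏ q ∈ S, q = ∏ q ∈ T, q) : S = T := by
  rw [← Nat.primeFactors_prod (fun p hp => hQ p (hS hp)), ← Nat.primeFactors_prod (fun p hp => hQ p (hT hp)), h]

/-- subproducts with r factors avoiding q0 -/
theorem subprods {Q : Finset ℕ} (hQ : ∀ q ∈ Q, q.Prime) {N0 : ℕ} (hN : ∀ q ∈ Q, N0 < q) (q0 : ℕ) {r w : ℕ} (hr : 0 < r)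
    (hw : r * w + r ≤ Q.card) (hw1 : 0 < w) {h : ℝ} (hh : ∀ q ∈ Q, (q:ℝ) ≤ Real.exp h) :
    ∃ DD : Finset ℕ, w ^ r ≤ DD.card ∧ ∀ d ∈ DD, d ∣ ∏ q ∈ Q, q ∧ d < ∏ q ∈ Q, q ∧ q0 ∉ d.primeFactors ∧
      2 ^ r ≤ d ∧ N0 < d ∧ (d:ℝ) ≤ Real.exp (h * r) := by
  classical
  refine ⟨(powersetCard r (Q.erase q0)).image (fun S => ∏ q ∈ S, q), ?_, ?_⟩
  · rw [Finset.card_image_of_injOn, Finset.card_powersetCard]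
    · have h1 : Q.card - 1 ≤ (Q.erase q0).card := Finset.pred_card_le_card_erase
      have h2 := Nat.choose_le_choose r h1
      refine le_trans ?_ h2
      have h3 : ((Q.card - 1 + 1 - r) ^ r) ≤ r.factorial * (Q.card - 1).choose r := by
        rw [← Nat.descFactorial_eq_factorial_mul_choose]
        exact Nat.pow_sub_le_descFactorial _ _
      have h4 : (r * w) ^ r ≤ r ^ r * (Q.card - 1).choose r := by
        calc (r * w) ^ r ≤ (Q.card - 1 + 1 - r) ^ r := by
              apply Nat.pow_le_pow_left; omega
          _ ≤ _ := h3
          _ ≤ _ := Nat.mul_le_mul_right _ (Nat.factorial_le_pow r)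
      rw [mul_pow] at h4
      exact Nat.le_of_mul_le_mul_left h4 (by positivity)
    · intro S hS T hT he
      rw [mem_coe, mem_powersetCard] at hS hT
      exact prod_inj_primes hQ (hS.1.trans (erase_subset _ _)) (hT.1.trans (erase_subset _ _)) he
  · intro d hd
    rw [mem_image] at hd
    obtain ⟨S, hS, rfl⟩ := hd
    rw [mem_powersetCard] at hS
    obtain ⟨hS1, hS2⟩ := hS
    have hSQ : S ⊆ Q := hS1.trans (erase_subset _ _)
    have hSp : ∀ q ∈ S, q.Prime := fun q hq => hQ q (hSQ hq)
    have hdpos : 0 < ∏ q ∈ S, q := Finset.prod_pos (fun q hq => (hSp q hq).pos)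
    have hdvd : ∏ q ∈ S, q ∣ ∏ q ∈ Q, q := Finset.prod_dvd_prod_of_subset _ _ _ hSQ
    have hLpos : 0 < ∏ q ∈ Q, q := Finset.prod_pos (fun q hq => (hQ q hq).pos)
    refine ⟨hdvd, ?_, ?_, ?_, ?_, ?_⟩
    · refine lt_of_le_of_ne (Nat.le_of_dvd hLpos hdvd) ?_
      intro he
      have := prod_inj_primes hQ hSQ (subset_refl Q) he
      rw [this] at hS2
      have : 0 < r * w := by positivity
      omega
    · rw [Nat.primeFactors_prod hSp]
      intro hq
      exact (mem_erase.1 (hS1 hq)).1 rfl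
    · rw [← hS2]
      exact Finset.pow_card_le_prod S _ 2 (fun q hq => (hSp q hq).two_le)
    · obtain ⟨q, hq⟩ : S.Nonempty := by rw [← Finset.card_pos]; omega
      exact lt_of_lt_of_le (hN q (hSQ hq)) (Nat.le_of_dvd hdpos (Finset.dvd_prod_of_mem _ hq))
    · push_cast
      calc ∏ q ∈ S, (q:ℝ) ≤ ∏ q ∈ S, Real.exp h :=
            Finset.prod_le_prod (fun _ _ => by positivity) (fun q hq => hh q (hSQ hq))
        _ = _ := by rw [Finset.prod_const, hS2, ← Real.exp_nat_mul, mul_comm]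

theorem comb (D : AD) : ∃ C : ℝ, 1 ≤ C ∧ ∀ Q : Finset ℕ, (∀ q ∈ Q, D.good q ∧ D.N0 < q) →
    ∀ r w N s : ℕ, 0 < r → 0 < w → 0 < N → r * w + r ≤ Q.card → ∀ h a V X M : ℝ, 0 ≤ h → 0 ≤ a →
    (∀ q ∈ Q, (q:ℝ) ≤ Real.exp h) → h * r ≤ N * a → V = Real.exp a * (C * N * (1 + h * Q.card) ^ 114) →
    X = 2 * V * (N * (a + C * N)) → M = (C * N) ^ N → 2 * M * ((Q.card + 1) * (1 + X)) ≤ 2 ^ s →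
    ∃ k : ℕ, 0 < k ∧ (k:ℝ) ≤ Real.exp X ∧ (Q.filter (· ∣ k)).card < s ∧
    ∃ T : Finset ℕ, (w:ℝ) ^ r ≤ 2 * M * (1 + X) * T.card ∧
      ∀ d ∈ T, d ∣ ∏ q ∈ Q, q ∧ d < ∏ q ∈ Q, q ∧ 2 ^ r ≤ d ∧ D.N0 < d ∧ (d:ℝ) ≤ Real.exp (h * r) ∧
        D.good (d * k + 1) ∧ d * k + 1 ∉ Q := by
  classical
  obtain ⟨C, hC, he⟩ := engine D
  refine ⟨C, hC, ?_⟩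
  intro Q hQ r w N s hr hw hN hcard h a V X M hh ha hqh hha hV hX hM hs
  obtain ⟨q0, hq0⟩ := he Q hQ _ rfl
  have hQp : ∀ q ∈ Q, q.Prime := fun q hq => D.good_prime q (hQ q hq).1
  obtain ⟨DD, hDD, hd⟩ := subprods hQp (fun q hq => (hQ q hq).2) q0 hr hcard hw hqh
  have hN1 : (1:ℝ) ≤ N := by exact_mod_cast hN
  have hL1 : (1:ℝ) ≤ ((∏ q ∈ Q, q : ℕ) : ℝ) := by
    exact_mod_cast Finset.prod_pos (fun q hq => (hQp q hq).pos)
  have hlogL : Real.log ((∏ q ∈ Q, q : ℕ) : ℝ) ≤ h * Q.card := by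
    rw [Real.log_le_iff_le_exp (by linarith)]
    push_cast
    calc ∏ q ∈ Q, (q:ℝ) ≤ ∏ q ∈ Q, Real.exp h :=
          Finset.prod_le_prod (fun _ _ => by positivity) hqh
      _ = _ := by rw [Finset.prod_const, ← Real.exp_nat_mul, mul_comm]
  have hlogL0 := Real.log_nonneg hL1
  have hV0 : 0 < V := by rw [hV]; positivity
  have hX0 : 0 ≤ X := by rw [hX]; positivity
  have hM0 : 0 < M := by rw [hM]; positivity
  obtain ⟨J, rfl⟩ : ∃ J, N = J + 1 := ⟨N - 1, by omega⟩
  have hcast : ((J + 1 : ℕ) : ℝ) = J + 1 := by push_cast; rfl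
  rw [hcast] at hha hV hX hM hN1
  let R : ℕ → ℕ → Prop := fun k d => D.good (d * k + 1) ∧ d * k + 1 ∉ Q
  have key : ∀ d ∈ DD, 1 / M ≤ ∑ k ∈ Icc 1 ⌊Real.exp X⌋₊, if R k d then 1 / (k:ℝ) else 0 := by
    intro d hdd
    obtain ⟨h1, h2, h3, h4, h5, h6⟩ := hd d hdd
    have hd0 : 0 < d := by omega
    refine one_mod hd0 D.good_prime ((range (⌊Real.exp X⌋₊ + 1)).filter
      (fun p => D.good p ∧ (p : ZMod d) = 1 ∧ p ∉ Q)) ?_ ?_ R (fun _ _ => Iff.rfl)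
    · intro p
      rw [mem_filter, mem_range, Nat.lt_succ_iff]
    · rw [hM]
      have hdexp : (d:ℝ) ≤ Real.exp a ^ (J + 1) := by
        refine h6.trans ?_
        rw [← Real.exp_nat_mul, hcast]
        exact Real.exp_le_exp.2 hha
      refine hq0 d h1 h3 J (1 / V) X (by positivity) ?_ ?_ _ ?_
      · rw [one_div_one_div, hV, mul_pow (Real.exp a)]
        gcongr
      · have e1 : 1 / V * X / 2 = (J + 1) * (a + C * (J + 1)) := by
          rw [hX]; field_simp
        rw [e1, mul_add _ a, Real.exp_add]
        have e2 : Real.exp ((J + 1) * a) = Real.exp a ^ (J + 1) := by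
          rw [← Real.exp_nat_mul, hcast]
        have e3 : Real.exp ((J + 1) * (C * (J + 1))) = Real.exp (C * (J + 1)) ^ (J + 1) := by
          rw [← Real.exp_nat_mul, hcast]
        rw [e2, e3]
        gcongr
        linarith [Real.add_one_le_exp (C * ((J:ℝ) + 1))]
      · intro p hp1 hp2 hp3 hp4
        rw [mem_filter, mem_range, Nat.lt_succ_iff]
        exact ⟨Nat.le_floor hp4, hp1, hp2, hp3⟩
  have hDne : DD.Nonempty := by
    rw [← Finset.card_pos]
    exact lt_of_lt_of_le (by positivity) hDD
  obtain ⟨k, hk0, hk1, hk2, hk3⟩ := pigeon hQp hDne hX0 (Nat.floor_le (Real.exp_pos X).le) hM0 hs R key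
  refine ⟨k, hk0, (Nat.le_floor_iff (Real.exp_pos X).le).1 hk1, hk2, DD.filter (R k), ?_, ?_⟩
  · refine le_trans ?_ hk3
    exact_mod_cast hDD
  · intro d hdT
    rw [mem_filter] at hdT
    obtain ⟨h1, h2, h3, h4, h5, h6⟩ := hd d hdT.1
    exact ⟨h1, h2, h4, h5, h6, hdT.2.1, hdT.2.2⟩

theorem gcd_prod_le {Q : Finset ℕ} (hQ : ∀ q ∈ Q, q.Prime) {h : ℝ} (k : ℕ) (hqh : ∀ q ∈ Q, (q:ℝ) ≤ Real.exp h) :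
    (Nat.gcd k (∏ q ∈ Q, q) : ℝ) ≤ Real.exp (h * (Q.filter (· ∣ k)).card) := by
  classical
  induction Q using Finset.induction_on with
  | empty => simp
  | insert a s ha ih =>
    have ih' := ih (fun q hq => hQ q (mem_insert_of_mem hq)) (fun q hq => hqh q (mem_insert_of_mem hq))
    have hap := hQ a (mem_insert_self a s)
    rw [Finset.prod_insert ha, Finset.filter_insert]
    have h1 : Nat.gcd k (a * ∏ q ∈ s, q) ≤ Nat.gcd k a * Nat.gcd k (∏ q ∈ s, q) := by
      apply Nat.le_of_dvd
      · exact Nat.mul_pos (Nat.gcd_pos_of_pos_right _ hap.pos)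
          (Nat.gcd_pos_of_pos_right _ (Finset.prod_pos fun q hq => (hQ q (mem_insert_of_mem hq)).pos))
      · exact Nat.gcd_mul_right_dvd_mul_gcd k a _
    have h1' : (Nat.gcd k (a * ∏ q ∈ s, q) : ℝ) ≤ Nat.gcd k a * Nat.gcd k (∏ q ∈ s, q) := by exact_mod_cast h1
    split_ifs with hak
    · rw [Finset.card_insert_of_notMem (by simp [ha])]
      push_cast
      rw [mul_add, mul_one, Real.exp_add, mul_comm (Real.exp _)]
      refine h1'.trans ?_
      have h2 : Nat.gcd k a = a := Nat.gcd_eq_right hak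
      rw [h2]
      have := hqh a (mem_insert_self a s)
      gcongr
    · have h2 : Nat.gcd k a = 1 := ((Nat.coprime_comm.1 ((Nat.Prime.coprime_iff_not_dvd hap).2 hak)))
      rw [h2] at h1'
      simp only [Nat.cast_one, one_mul] at h1'
      exact h1'.trans ih'
end CS

namespace CS
open Finset

theorem s1_w {r j : ℕ} (hr : 0 < r) (h1 : 4 * r ≤ j) (h2 : (2 * r) ^ r ≤ j) :
    ∃ w : ℕ, 0 < w ∧ r * w + r ≤ j ∧ j ^ r ≤ j * w ^ r := by
  have hdm := Nat.div_add_mod j r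
  have hml := Nat.mod_lt j hr
  have h4 : 4 ≤ j / r := (Nat.le_div_iff_mul_le hr).2 h1
  obtain ⟨v, hv⟩ : ∃ v, j / r = v + 4 := ⟨j / r - 4, by omega⟩
  rw [hv] at hdm
  refine ⟨v + 3, by omega, by rw [mul_add] at hdm ⊢; omega, ?_⟩
  have h3 : j ≤ 2 * r * (v + 3) := by nlinarith
  calc j ^ r ≤ (2 * r * (v + 3)) ^ r := Nat.pow_le_pow_left h3 r
    _ = (2 * r) ^ r * (v + 3) ^ r := mul_pow _ _ _
    _ ≤ _ := Nat.mul_le_mul_right _ h2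

theorem s1_cube {x l : ℝ} (hx : 3 ≤ x) (hlx : l ≤ x) : 1 + 2 * l * x ≤ x ^ 3 := by
  have h1 : l * x ≤ x * x := mul_le_mul_of_nonneg_right hlx (by linarith)
  have h2 : x * x * 3 ≤ x * x * x := mul_le_mul_of_nonneg_left hx (by positivity)
  have h3 : x ^ 3 = x * x * x := by ring
  have h4 : 1 ≤ x * x := by nlinarith
  rw [h3]
  linarith [mul_assoc 2 l x]

theorem s1_num {C N x V X M l c : ℝ} (hC : 1 ≤ C) (hN : 1 ≤ N) (hx3 : 3 ≤ x) (h1 : 4 * (C * N) * N ≤ x)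
    (h2 : 4 * M ≤ x) (hM : 0 ≤ M) (hl : 0 ≤ l) (hlx : l ≤ x) (hc : c = x)
    (hV : V = x * (C * N * (1 + 2 * l * c) ^ 114)) (hX : X = 2 * V * (N * (l + C * N))) :
    0 ≤ X ∧ X ≤ x ^ 345 ∧ 2 * M * (1 + X) ≤ x ^ 346 := by
  subst hc
  have hCN : 1 ≤ C * N := by nlinarith
  have hCNx : C * N ≤ c := by nlinarith
  have e1 : 1 + 2 * l * c ≤ c ^ 3 := s1_cube hx3 hlx
  have e2 : (1 + 2 * l * c) ^ 114 ≤ c ^ 342 := by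
    calc (1 + 2 * l * c) ^ 114 ≤ (c ^ 3) ^ 114 := by gcongr
      _ = c ^ 342 := by rw [← pow_mul]
  have hV0 : 0 ≤ V := by rw [hV]; positivity
  have hVle : V ≤ C * N * c ^ 343 := by
    rw [hV]
    calc c * (C * N * (1 + 2 * l * c) ^ 114) ≤ c * (C * N * c ^ 342) := by gcongr
      _ = C * N * (c ^ 342 * c) := by ring
      _ = _ := by rw [← pow_succ]
  have hX0 : 0 ≤ X := by rw [hX]; positivity
  have hXle : X ≤ c ^ 345 := by
    rw [hX]
    calc 2 * V * (N * (l + C * N)) ≤ 2 * (C * N * c ^ 343) * (N * (c + c)) := by gcongr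
      _ = (4 * (C * N) * N) * (c ^ 343 * c) := by ring
      _ ≤ c * (c ^ 343 * c) := by gcongr
      _ = c ^ 345 := by rw [← pow_succ, ← pow_succ']
  refine ⟨hX0, hXle, ?_⟩
  have h3 : 1 ≤ c ^ 345 := one_le_pow₀ (by linarith)
  calc 2 * M * (1 + X) ≤ 2 * M * (c ^ 345 + c ^ 345) := by gcongr
    _ = 4 * M * c ^ 345 := by ring
    _ ≤ c * c ^ 345 := by gcongr
    _ = _ := by rw [← pow_succ']

theorem s1_exp {x X : ℝ} (hx : 3 ≤ x) (hX : X ≤ x ^ 345) {y : ℝ} (hy : y ≤ x ^ 3) : X + y + 1 ≤ x ^ 350 := by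
  have h1 : x ^ 3 ≤ x ^ 345 := pow_le_pow_right₀ (by linarith) (by norm_num)
  have h2 : 1 ≤ x ^ 345 := one_le_pow₀ (by linarith)
  have h3 : x ^ 350 = x ^ 345 * x ^ 5 := by rw [← pow_add]
  have h4 : (3:ℝ) ≤ x ^ 5 := by
    calc (3:ℝ) ≤ x := hx
      _ = x ^ 1 := by rw [pow_one]
      _ ≤ x ^ 5 := pow_le_pow_right₀ (by linarith) (by norm_num)
  rw [h3]
  nlinarith

theorem s1_count {x T B y : ℝ} {r : ℕ} (hx : 3 ≤ x) (hr : 3200 ≤ r) (hy : x ^ r ≤ x * y) (hT : y ≤ B * T) (hT0 : 0 ≤ T)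
    (hB : B ≤ x ^ 346) : (x ^ 350) ^ 8 ≤ T := by
  have h1 : x ^ 347 * (x ^ 350) ^ 8 ≤ x ^ 347 * T := by
    calc x ^ 347 * (x ^ 350) ^ 8 = x ^ (347 + 350 * 8) := by rw [pow_add, pow_mul]
      _ ≤ x ^ r := pow_le_pow_right₀ (by linarith) (by omega)
      _ ≤ x * y := hy
      _ ≤ x * (B * T) := by gcongr
      _ ≤ x * (x ^ 346 * T) := by gcongr
      _ = _ := by rw [← mul_assoc, ← pow_succ']
  exact le_of_mul_le_mul_left h1 (by positivity)

theorem exp_succ {y : ℝ} (hy : 0 ≤ y) : Real.exp y + 1 ≤ Real.exp (y + 1) := by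
  rw [Real.exp_add _ 1]
  have h8 : 1 ≤ Real.exp y := Real.one_le_exp hy
  have h9 := Real.add_one_le_exp (1:ℝ)
  nlinarith

theorem stage1_aux (D : AD) (H0 r : ℕ) (hr : 3200 ≤ r) : ∃ H : ℕ, H0 ≤ H ∧ ∃ E : ℕ, 0 < E ∧ (E:ℝ) ≤ Real.exp H ∧
    ∃ Q : Finset ℕ, Q.card = H ^ 8 ∧ ∀ q ∈ Q, D.good q ∧ D.N0 < q ∧ (q:ℝ) ≤ Real.exp H ∧ q - 1 ∣ E := by
  classical
  obtain ⟨C, hC, hcomb⟩ := comb D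
  obtain ⟨N, hN⟩ : ∃ N, N = 2 * r := ⟨_, rfl⟩
  obtain ⟨M, hM⟩ : ∃ M : ℝ, M = (C * N) ^ N := ⟨_, rfl⟩
  have hN1 : 1 ≤ N := by omega
  have hN1' : (1:ℝ) ≤ N := by exact_mod_cast hN1
  have hM0 : 0 ≤ M := by rw [hM]; positivity
  obtain ⟨j, hj, Q0, hQ0, hQ0'⟩ := good_dense D (3 + H0 + 4 * r + (2 * r) ^ r + ⌈4 * (C * N) * N⌉₊ + ⌈4 * M⌉₊)
  generalize hG : (2 * r) ^ r = G at hj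
  obtain ⟨x, hx⟩ : ∃ x : ℝ, x = j := ⟨_, rfl⟩
  have hj3 : 3 ≤ j := by omega
  have hx3 : (3:ℝ) ≤ x := by rw [hx]; exact_mod_cast hj3
  have hxa : 4 * (C * N) * N ≤ x := by
    rw [hx]; exact (Nat.le_ceil _).trans (by exact_mod_cast (by omega : ⌈4 * (C * N) * N⌉₊ ≤ j))
  have hxb : 4 * M ≤ x := by
    rw [hx]; exact (Nat.le_ceil _).trans (by exact_mod_cast (by omega : ⌈4 * M⌉₊ ≤ j))
  have hxr : 4 * (r:ℝ) ≤ x := by rw [hx]; exact_mod_cast (by omega : 4 * r ≤ j)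
  obtain ⟨w, hw0, hw1, hw2⟩ := s1_w (r := r) (j := j) (by omega) (by omega) (by omega)
  have hx0 : 0 < x := by linarith
  obtain ⟨l, hl⟩ : ∃ l, l = Real.log x := ⟨_, rfl⟩
  have hl0 : 0 ≤ l := by rw [hl]; exact Real.log_nonneg (by linarith)
  have hlx : l ≤ x := by rw [hl]; linarith [Real.log_le_sub_one_of_pos hx0]
  have hexpl : Real.exp l = x := by rw [hl, Real.exp_log hx0]
  obtain ⟨V, hV⟩ : ∃ V, V = x * (C * N * (1 + 2 * l * Q0.card) ^ 114) := ⟨_, rfl⟩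
  obtain ⟨X, hX⟩ : ∃ X, X = 2 * V * (N * (l + C * N)) := ⟨_, rfl⟩
  obtain ⟨hX0, hXle, hB⟩ := s1_num hC hN1' hx3 hxa hxb hM0 hl0 hlx (c := (Q0.card : ℝ)) (by rw [hQ0, hx]) hV hX
  obtain ⟨s, hs⟩ := pow_unbounded_of_one_lt (2 * M * ((Q0.card + 1) * (1 + X))) (by norm_num : (1:ℝ) < 2)
  have hqb : ∀ q ∈ Q0, (q:ℝ) ≤ Real.exp (2 * l) := by
    intro q hq
    have h1 := (hQ0' q hq).2.2
    have h2 : (q:ℝ) ≤ x ^ 2 := by rw [hx]; exact_mod_cast h1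
    rw [two_mul, Real.exp_add, hexpl]
    linarith [sq x]
  obtain ⟨k, hk0, hk1, hk2, T, hT, hTd⟩ := hcomb Q0 (fun q hq => ⟨(hQ0' q hq).1, (hQ0' q hq).2.1⟩) r w N s
    (by omega) hw0 hN1 (by rw [hQ0]; exact hw1) (2 * l) l V X M (by linarith) hl0 hqb
    (by rw [hN]; push_cast; linarith [mul_comm l (r:ℝ)]) (by rw [hexpl]; exact hV) hX hM hs.le
  have hcardT : (x ^ 350) ^ 8 ≤ (T.card : ℝ) := by
    refine s1_count hx3 hr ?_ hT (by positivity) hB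
    rw [hx]; exact_mod_cast hw2
  have hL0 : 0 < ∏ q ∈ Q0, q := Finset.prod_pos (fun q hq => (D.good_prime q (hQ0' q hq).1).pos)
  obtain ⟨H, hH⟩ : ∃ H : ℕ, H = j ^ 350 := ⟨_, rfl⟩
  have hHr : (H : ℝ) = x ^ 350 := by rw [hx, hH, Nat.cast_pow]
  have hjH : j ≤ H := by rw [hH]; exact Nat.le_self_pow (by norm_num) j
  clear hH
  have himg : (T.image (fun d => d * k + 1)).card = T.card := by
    apply Finset.card_image_of_injOn
    intro a _ b _ hab
    exact Nat.eq_of_mul_eq_mul_right hk0 (Nat.add_right_cancel hab)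
  have hcard2 : H ^ 8 ≤ (T.image (fun d => d * k + 1)).card := by
    rw [himg]
    have : ((H ^ 8 : ℕ) : ℝ) ≤ (T.card : ℝ) := by
      rw [Nat.cast_pow, hHr]; exact hcardT
    exact_mod_cast this
  obtain ⟨Q, hQsub, hQcard⟩ := Finset.exists_subset_card_eq hcard2
  refine ⟨H, by omega, k * ∏ q ∈ Q0, q, Nat.mul_pos hk0 hL0, ?_, Q, hQcard, ?_⟩
  · rw [hHr]
    push_cast
    calc (k:ℝ) * ∏ q ∈ Q0, (q:ℝ) ≤ Real.exp X * ∏ q ∈ Q0, Real.exp (2 * l) := by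
          gcongr with q hq
          exact hqb q hq
      _ = Real.exp (X + x * (2 * l)) := by
          rw [Finset.prod_const, hQ0, ← Real.exp_nat_mul, Real.exp_add, hx]
      _ ≤ _ := by
          apply Real.exp_le_exp.2
          have := s1_exp hx3 hXle (y := x * (2 * l)) (by linarith [s1_cube hx3 hlx, mul_comm x (2 * l)])
          linarith
  · intro q hq
    have hq1 := hQsub hq
    rw [mem_image] at hq1
    obtain ⟨d, hd, rfl⟩ := hq1
    obtain ⟨h1, h2, h3, h4, h5, h6, h7⟩ := hTd d hd
    refine ⟨h6, ?_, ?_, ?_⟩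
    · have := Nat.le_mul_of_pos_right d hk0
      omega
    · rw [hHr]
      push_cast
      have e1 : (d:ℝ) * k ≤ Real.exp (X + 2 * l * r) := by
        rw [Real.exp_add, mul_comm (Real.exp X)]
        gcongr
      have e2 : X + 2 * l * r + 1 ≤ x ^ 350 := by
        apply s1_exp hx3 hXle
        have hr0 : (0:ℝ) ≤ r := Nat.cast_nonneg r
        have e5 : l * r ≤ l * x := mul_le_mul_of_nonneg_left (by linarith) hl0
        linarith [s1_cube hx3 hlx, mul_assoc 2 l (r:ℝ), mul_assoc 2 l x]
      have e3 : Real.exp (X + 2 * l * r) + 1 ≤ Real.exp (X + 2 * l * r + 1) := exp_succ (by positivity)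
      have e4 := Real.exp_le_exp.2 e2
      exact (add_le_add_left e1 1).trans (e3.trans e4)
    · simp only [Nat.add_sub_cancel]
      rw [mul_comm k]
      exact Nat.mul_dvd_mul_right h1 k

theorem stage1 (D : AD) (H0 : ℕ) : ∃ H : ℕ, H0 ≤ H ∧ ∃ E : ℕ, 0 < E ∧ (E:ℝ) ≤ Real.exp H ∧
    ∃ Q : Finset ℕ, Q.card = H ^ 8 ∧ ∀ q ∈ Q, D.good q ∧ D.N0 < q ∧ (q:ℝ) ≤ Real.exp H ∧ q - 1 ∣ E :=
  stage1_aux D H0 3200 le_rfl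
end CS

namespace CS
open Finset

theorem pow_le_exp_nat {x : ℝ} (hx : 0 ≤ x) (n : ℕ) : x ^ n ≤ Real.exp (n * x) := by
  rw [Real.exp_nat_mul]
  gcongr
  linarith [Real.add_one_le_exp x]

theorem s2_lin {x : ℝ} (hx : 2000 ≤ x) : 2000 * x ≤ x ^ 5 ∧ 2000 * x ^ 4 ≤ x ^ 5 ∧ 2000 * x ^ 5 ≤ x ^ 6 ∧ 2000 * x ^ 6 ≤ x ^ 7 ∧ x ≤ x ^ 5 := by
  have h1 : 1 ≤ x := by linarith
  have h4 : 1 ≤ x ^ 3 := one_le_pow₀ h1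
  have a1 : x ^ 5 = x * x ^ 4 := by ring
  have a2 : x ^ 6 = x * x ^ 5 := by ring
  have a3 : x ^ 7 = x * x ^ 6 := by ring
  have b2 : 2000 * x ^ 4 ≤ x ^ 5 := by rw [a1]; gcongr
  have b3 : 2000 * x ^ 5 ≤ x ^ 6 := by rw [a2]; gcongr
  have b4 : 2000 * x ^ 6 ≤ x ^ 7 := by rw [a3]; gcongr
  have b5 : x ≤ x ^ 4 := le_self_pow₀ h1 (by norm_num)
  exact ⟨by linarith, b2, b3, b4, by nlinarith⟩

theorem s2_X {C x V X : ℝ} (hC : 1 ≤ C) (hCx : C ≤ x) (hx : 2000 ≤ x)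
    (hV : V = Real.exp (x ^ 5) * (C * x ^ 3 * (1 + x * x ^ 8) ^ 114)) (hX : X = 2 * V * (x ^ 3 * (x ^ 5 + C * x ^ 3))) :
    0 ≤ X ∧ 1 + X + x ^ 9 ≤ Real.exp (2 * x ^ 5) := by
  have hx0 : 0 < x := by linarith
  have h1 : 1 ≤ x := by linarith
  have hV0 : 0 ≤ V := by rw [hV]; positivity
  have hX0 : 0 ≤ X := by rw [hX]; positivity
  refine ⟨hX0, ?_⟩
  have e1 : 1 + x * x ^ 8 ≤ x ^ 10 := by
    have a1 : 1 ≤ x ^ 9 := one_le_pow₀ h1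
    have a2 : x ^ 10 = x * x ^ 9 := by ring
    have a3 : x * x ^ 8 = x ^ 9 := by ring
    rw [a2, a3]; nlinarith
  have e2 : (1 + x * x ^ 8) ^ 114 ≤ x ^ 1140 := by
    calc _ ≤ (x ^ 10) ^ 114 := by gcongr
      _ = _ := by rw [← pow_mul]
  have e3 : V ≤ Real.exp (x ^ 5) * x ^ 1144 := by
    rw [hV]
    calc _ ≤ Real.exp (x ^ 5) * (x * x ^ 3 * x ^ 1140) := by gcongr
      _ = _ := by rw [← pow_succ', ← pow_add]
  have e4 : 2 * (x ^ 3 * (x ^ 5 + C * x ^ 3)) ≤ x ^ 9 := by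
    have a1 : x ^ 5 + C * x ^ 3 ≤ 2 * x ^ 5 := by
      have : C * x ^ 3 ≤ x * x ^ 3 := by gcongr
      have a2 : x * x ^ 3 ≤ x * x ^ 4 := by gcongr; norm_num
      have a3 : x ^ 5 = x * x ^ 4 := by ring
      linarith
    calc 2 * (x ^ 3 * (x ^ 5 + C * x ^ 3)) ≤ 2 * (x ^ 3 * (2 * x ^ 5)) := by gcongr
      _ = 4 * x ^ 8 := by ring
      _ ≤ x * x ^ 8 := by gcongr; linarith
      _ = _ := by ring
  have e5 : X ≤ Real.exp (x ^ 5) * x ^ 1153 := by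
    calc X = V * (2 * (x ^ 3 * (x ^ 5 + C * x ^ 3))) := by rw [hX]; ring
      _ ≤ Real.exp (x ^ 5) * x ^ 1144 * x ^ 9 := by gcongr
      _ = _ := by rw [mul_assoc, ← pow_add]
  have hE1 : 1 ≤ Real.exp (x ^ 5) := Real.one_le_exp (by positivity)
  have e6 : 1 + X + x ^ 9 ≤ Real.exp (x ^ 5) * x ^ 1154 := by
    have a1 : 1 ≤ x ^ 1153 := one_le_pow₀ h1
    have a2 : x ^ 9 ≤ x ^ 1153 := pow_le_pow_right₀ h1 (by norm_num)
    have a3 : x ^ 1154 = x ^ 1153 * x := by rw [← pow_succ]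
    rw [a3]
    generalize x ^ 1153 = y at *
    generalize Real.exp (x ^ 5) = e at *
    have a4 : y ≤ e * y := by nlinarith
    have a5 : e * y * 3 ≤ e * y * x := by gcongr; linarith
    linarith [mul_assoc e y x]
  calc 1 + X + x ^ 9 ≤ Real.exp (x ^ 5) * x ^ 1154 := e6
    _ ≤ Real.exp (x ^ 5) * Real.exp ((1154:ℕ) * x) := by
        gcongr
        exact pow_le_exp_nat hx0.le _
    _ = Real.exp (x ^ 5 + (1154:ℕ) * x) := by rw [Real.exp_add]
    _ ≤ _ := by
        apply Real.exp_le_exp.2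
        have := (s2_lin hx).1
        push_cast
        linarith

theorem s2_M {C x M X : ℝ} {H : ℕ} (hC : 1 ≤ C) (hCx : C ≤ x) (hx : 2000 ≤ x) (hHx : x = H) (hX0 : 0 ≤ X)
    (hX : 1 + X + x ^ 9 ≤ Real.exp (2 * x ^ 5)) (hM : M = (C * x ^ 3) ^ (H ^ 3)) :
    2 * M * ((x ^ 8 + 1) * (1 + X)) ≤ Real.exp (3 * x ^ 5) := by
  have hx0 : 0 < x := by linarith
  have h1 : 1 ≤ x := by linarith
  have e1 : M ≤ Real.exp (4 * x ^ 4) := by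
    rw [hM]
    calc (C * x ^ 3) ^ (H ^ 3) ≤ (x * x ^ 3) ^ (H ^ 3) := by gcongr
      _ = (x ^ 4) ^ (H ^ 3) := by congr 1; ring
      _ ≤ Real.exp ((4:ℕ) * x) ^ (H ^ 3) := by
          gcongr
          exact pow_le_exp_nat hx0.le _
      _ = Real.exp (4 * x ^ 4) := by
          rw [← Real.exp_nat_mul]
          congr 1
          push_cast
          rw [← hHx]
          ring
  have hM0 : 0 ≤ M := by rw [hM]; positivity
  have e2 : 2 * (x ^ 8 + 1) ≤ Real.exp (9 * x) := by
    have a1 : 1 ≤ x ^ 8 := one_le_pow₀ h1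
    have a2 := pow_le_exp_nat hx0.le 9
    have a3 : x ^ 9 = x * x ^ 8 := by ring
    push_cast at a2
    nlinarith
  have e3 : 1 + X ≤ Real.exp (2 * x ^ 5) := by linarith [pow_pos hx0 9]
  calc 2 * M * ((x ^ 8 + 1) * (1 + X)) = M * (2 * (x ^ 8 + 1)) * (1 + X) := by ring
    _ ≤ Real.exp (4 * x ^ 4) * Real.exp (9 * x) * Real.exp (2 * x ^ 5) := by gcongr
    _ = Real.exp (4 * x ^ 4 + 9 * x + 2 * x ^ 5) := by rw [Real.exp_add, Real.exp_add]
    _ ≤ _ := by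
      apply Real.exp_le_exp.2
      obtain ⟨b1, b2, _⟩ := s2_lin hx
      have : 0 ≤ x ^ 4 := by positivity
      linarith

theorem exp_three_le (n : ℕ) : Real.exp (3 * n) ≤ 2 ^ (6 * n) := by
  have h : Real.exp 1 ≤ 2 ^ 2 := by linarith [Real.exp_one_lt_d9]
  calc Real.exp (3 * n) = Real.exp 1 ^ (3 * n) := by
        rw [← Real.exp_nat_mul]; push_cast; ring_nf
    _ ≤ (2 ^ 2) ^ (3 * n) := by gcongr
    _ = _ := by rw [← pow_mul]; congr 1; ring

theorem exp_lt_three (n : ℕ) : Real.exp n ≤ 3 ^ n := by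
  have h : Real.exp 1 ≤ 3 := by linarith [Real.exp_one_lt_d9]
  calc Real.exp n = Real.exp 1 ^ n := by rw [← Real.exp_nat_mul]; simp
    _ ≤ _ := by gcongr

theorem s2_fin {x E g l B T y : ℝ} (hx : 2000 ≤ x) (hE0 : 0 ≤ E) (hE : E ≤ Real.exp x) (hg0 : 0 ≤ g)
    (hg : g ≤ Real.exp (x * (6 * x ^ 5))) (hl : l ≤ Real.exp (2 * x ^ 5))
    (hB0 : 0 < B) (hB : B ≤ Real.exp (3 * x ^ 5)) (hy : Real.exp (x ^ 7) ≤ y) (hT : y ≤ B * T) : E * g * l < T := by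
  have h1 : B * (E * g * l) < B * T := by
    refine lt_of_lt_of_le ?_ (hy.trans hT)
    calc B * (E * g * l) ≤ B * (E * g * Real.exp (2 * x ^ 5)) := by gcongr
      _ ≤ Real.exp (3 * x ^ 5) * (Real.exp x * Real.exp (x * (6 * x ^ 5)) * Real.exp (2 * x ^ 5)) := by gcongr
      _ = Real.exp (3 * x ^ 5 + (x + x * (6 * x ^ 5) + 2 * x ^ 5)) := by simp only [Real.exp_add]
      _ < _ := by
        apply Real.exp_lt_exp.2
        obtain ⟨b1, b2, b3, b4, b5⟩ := s2_lin hx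
        have e : x * (6 * x ^ 5) = 6 * x ^ 6 := by ring
        rw [e]
        have : 0 < x ^ 6 := by positivity
        linarith
  exact lt_of_mul_lt_mul_left h1 hB0.le

theorem log_kL {Q : Finset ℕ} (hQ : ∀ q ∈ Q, 0 < q) {h X : ℝ} (hqh : ∀ q ∈ Q, (q:ℝ) ≤ Real.exp h) {k : ℕ} (hk : 0 < k)
    (hkX : (k:ℝ) ≤ Real.exp X) : Real.log ((k * ∏ q ∈ Q, q : ℕ) : ℝ) ≤ X + h * Q.card := by
  have hL : 0 < ∏ q ∈ Q, q := Finset.prod_pos hQ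
  rw [Real.log_le_iff_le_exp (by exact_mod_cast Nat.mul_pos hk hL), Real.exp_add]
  push_cast
  calc (k:ℝ) * ∏ q ∈ Q, (q:ℝ) ≤ Real.exp X * ∏ q ∈ Q, Real.exp h := by
        gcongr with q hq
        exact hqh q hq
    _ = _ := by rw [Finset.prod_const, ← Real.exp_nat_mul, mul_comm h]
end CS

namespace CS
open Finset

theorem final_AD (D : AD) (B : ℕ) : ∃ t : Finset ℕ, (∀ p ∈ t, D.good p) ∧ B < ∏ p ∈ t, p ∧ IsCarmichael (∏ p ∈ t, p) := by
  classical
  obtain ⟨C, hC, hcomb⟩ := comb D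
  obtain ⟨H, hH0, E, hE0, hE, Q, hQc, hQ⟩ := stage1 D (2000 + B + ⌈C⌉₊)
  obtain ⟨x, hx⟩ : ∃ x : ℝ, x = H := ⟨_, rfl⟩
  have hx2 : (2000:ℝ) ≤ x := by rw [hx]; exact_mod_cast (by omega : 2000 ≤ H)
  have hCx : C ≤ x := by
    rw [hx]; exact (Nat.le_ceil _).trans (by exact_mod_cast (by omega : ⌈C⌉₊ ≤ H))
  have hQcx : (Q.card : ℝ) = x ^ 8 := by rw [hQc, hx, Nat.cast_pow]
  have hN : ((H ^ 3 : ℕ) : ℝ) = x ^ 3 := by rw [hx, Nat.cast_pow]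
  have h5 : ((H ^ 5 : ℕ) : ℝ) = x ^ 5 := by rw [hx, Nat.cast_pow]
  have h7 : ((H ^ 7 : ℕ) : ℝ) = x ^ 7 := by rw [hx, Nat.cast_pow]
  have hx0 : 0 < x := by linarith
  have hHpos : 0 < H := by omega
  obtain ⟨V, hV⟩ : ∃ V, V = Real.exp (x ^ 5) * (C * x ^ 3 * (1 + x * x ^ 8) ^ 114) := ⟨_, rfl⟩
  obtain ⟨X, hX⟩ : ∃ X, X = 2 * V * (x ^ 3 * (x ^ 5 + C * x ^ 3)) := ⟨_, rfl⟩
  obtain ⟨M, hM⟩ : ∃ M : ℝ, M = (C * x ^ 3) ^ (H ^ 3) := ⟨_, rfl⟩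
  obtain ⟨hX0, hX1⟩ := s2_X hC hCx hx2 hV hX
  have hB := s2_M hC hCx hx2 hx hX0 hX1 hM
  have hM0 : 0 < M := by rw [hM]; positivity
  have hqx : ∀ q ∈ Q, (q:ℝ) ≤ Real.exp x := fun q hq => by rw [hx]; exact (hQ q hq).2.2.1
  have hQp : ∀ q ∈ Q, q.Prime := fun q hq => D.good_prime q (hQ q hq).1
  have hs : 2 * M * ((Q.card + 1) * (1 + X)) ≤ 2 ^ (6 * H ^ 5) := by
    rw [hQcx]
    refine hB.trans ?_
    have := exp_three_le (H ^ 5)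
    rwa [h5] at this
  obtain ⟨k, hk0, hk1, hk2, T, hT, hTd⟩ := hcomb Q (fun q hq => ⟨(hQ q hq).1, (hQ q hq).2.1⟩) (H ^ 7) 3 (H ^ 3) (6 * H ^ 5)
    (by positivity) (by norm_num) (by positivity)
    (by rw [hQc, pow_succ H 7]
        calc H ^ 7 * 3 + H ^ 7 = H ^ 7 * 4 := by ring
          _ ≤ H ^ 7 * H := Nat.mul_le_mul_left _ (by omega))
    x (x ^ 5) V X M hx0.le (by positivity) hqx
    (by rw [hN, h7]; apply le_of_eq; ring) (by rw [hN, hQcx]; exact hV) (by rw [hN]; exact hX) (by rw [hN]; exact hM) hs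
  obtain ⟨P, hP⟩ : ∃ P, P = T.image (fun d => d * k + 1) := ⟨_, rfl⟩
  have hPc : P.card = T.card := by
    rw [hP]
    apply Finset.card_image_of_injOn
    intro a _ b _ hab
    exact Nat.eq_of_mul_eq_mul_right hk0 (Nat.add_right_cancel hab)
  have hPm : ∀ p ∈ P, ∃ d ∈ T, p = d * k + 1 := by
    intro p hp
    rw [hP, mem_image] at hp
    obtain ⟨d, hd, he⟩ := hp
    exact ⟨d, hd, he.symm⟩
  have hPg : ∀ p ∈ P, D.good p := by
    intro p hp
    obtain ⟨d, hd, rfl⟩ := hPm p hp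
    exact (hTd d hd).2.2.2.2.2.1
  have hcardlt : ((E * Nat.gcd k (∏ q ∈ Q, q) : ℕ) : ℝ) * Real.log ((k * ∏ q ∈ Q, q : ℕ) : ℝ) < P.card := by
    rw [hPc, Nat.cast_mul]
    refine s2_fin hx2 (B := 2 * M * (1 + X)) (y := (3:ℝ) ^ (H ^ 7)) (by positivity) (by rw [hx]; exact hE) (by positivity)
      ?_ ?_ (by positivity) ?_ ?_ hT
    · refine (gcd_prod_le hQp k hqx).trans ?_
      apply Real.exp_le_exp.2
      apply mul_le_mul_of_nonneg_left _ hx0.le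
      rw [← h5]
      exact_mod_cast hk2.le
    · refine (log_kL (fun q hq => (hQp q hq).pos) hqx hk0 hk1).trans ?_
      rw [hQcx]
      have : x * x ^ 8 = x ^ 9 := by ring
      rw [this]; linarith
    · refine le_trans ?_ hB
      have h8 : 0 ≤ x ^ 8 := by positivity
      have : 0 ≤ 2 * M * (x ^ 8 * (1 + X)) := by positivity
      linarith
    · rw [← h7]; exact exp_lt_three _
  obtain ⟨t, ht, ⟨p, hpt⟩, hcar⟩ := carmichael_of_many k (∏ q ∈ Q, q) E hk0 (Finset.prod_pos fun q hq => (hQp q hq).pos) hE0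
    Q hQp rfl (fun q hq => (hQ q hq).2.2.2) P (fun p hp => D.good_prime p (hPg p hp))
    (fun p hp => by
      obtain ⟨d, hd, rfl⟩ := hPm p hp
      exact (hTd d hd).2.2.2.2.2.2)
    (fun p hp => by
      obtain ⟨d, hd, rfl⟩ := hPm p hp
      exact ⟨d, (hTd d hd).1, (hTd d hd).2.1, rfl⟩) hcardlt
  refine ⟨t, fun p hp => hPg p (ht hp), ?_, hcar⟩
  obtain ⟨d, hd, hpd⟩ := hPm p (ht hpt)
  have h1 : 2 ^ (H ^ 7) ≤ d := (hTd d hd).2.2.1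
  have h2 : H ^ 7 < 2 ^ (H ^ 7) := Nat.lt_two_pow_self
  have h3 : H ≤ H ^ 7 := Nat.le_self_pow (by norm_num) H
  have h4 : d ≤ d * k := Nat.le_mul_of_pos_right d hk0
  have h6 : p ≤ ∏ p ∈ t, p := Nat.le_of_dvd (Finset.prod_pos fun p hp => (D.good_prime p (hPg p (ht hp))).pos)
    (Finset.dvd_prod_of_mem _ hpt)
  generalize 2 ^ (H ^ 7) = z at h1 h2
  generalize H ^ 7 = y at h2 h3
  omega

end CS

theorem infinitely_many_carmichael_split_infinite (f : Polynomial ℤ) (hmonic : f.Monic)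
    (hsq : Squarefree f) (hdeg : 0 < f.natDegree) :
    {n : ℕ | IsCarmichael n ∧ ∀ p : ℕ, p.Prime → p ∣ n → SplitsModLinear f p}.Infinite := by
  obtain ⟨D, hD⟩ := CS.exists_AD_f f hmonic
  rw [Set.infinite_iff_exists_gt]
  intro B
  obtain ⟨t, h1, h2, h3⟩ := CS.final_AD D B
  refine ⟨∏ p ∈ t, p, ⟨h3, ?_⟩, h2⟩
  intro p hp hpd
  obtain ⟨q, hq, hpq⟩ := (Prime.dvd_finsetProd_iff hp.prime _).1 hpd
  have := (Nat.prime_dvd_prime_iff_eq hp (D.good_prime q (h1 q hq))).1 hpq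
  rw [this]
  exact hD q (h1 q hq)
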